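/- arXiv:1903.04162 — 4 statements merged into one kernel-verified Lean document; each statement's English description precedes it below -/
import Mathlib

section
/- Let k be a nonnegative integer and let n ≥ 4k + 19. Every 3-uniform hypergraph H on n vertices with minimum degree δ₁(H) ≥ kn + 6k² − 3k + 3 contains a linear path of length 2k + 1. -/
/-- The degree of a vertex `v` in a hypergraph with edge set `E`:
the number of edges containing `v`. -/
def hdegree {V : Type*} [DecidableEq V] (E : Finset (Finset V)) (v : V) : ℕ :=
  (E.filter (fun e => v ∈ e)).card

/-- The hypergraph with edge set `E` contains a linear path of length `k`:
a collection of `k` (distinct) edges `e₁, …, e_k` such that `|eᵢ ∩ e_j| = 1`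
if `|i - j| = 1` and `eᵢ ∩ e_j = ∅` otherwise. -/
def HasLinearPath {V : Type*} [DecidableEq V] (E : Finset (Finset V)) (k : ℕ) : Prop :=
  ∃ f : Fin k → Finset V, Function.Injective f ∧ (∀ i, f i ∈ E) ∧
    ∀ i j : Fin k, i ≠ j →
      (((i : ℕ) + 1 = j ∨ (j : ℕ) + 1 = i) → (f i ∩ f j).card = 1) ∧
      (¬((i : ℕ) + 1 = j ∨ (j : ℕ) + 1 = i) → f i ∩ f j = ∅)

/-- `LPath T w a b l s`: the list `l = [v₀, u₁, v₁, …, u_m, v_m]` runs from `a = v₀` to `b = v_m`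
through triples `T vᵢ uᵢ₊₁ vᵢ₊₁`, and `s` is the sum of the weights `w vᵢ vᵢ₊₁`. -/
inductive LPath {V : Type*} (T : V → V → V → Prop) (w : V → V → ℕ) :
    V → V → List V → ℕ → Prop
  | single (a : V) : LPath T w a a [a] 0
  | cons {a u c b : V} {l : List V} {s : ℕ} (h : T a u c) (hl : LPath T w c b l s) :
      LPath T w a b (a :: u :: l) (w a c + s)

/-- A ternary relation which is invariant under permutations and holds only for distinct
entries. -/
structure IsTripleSystem {V : Type*} (T : V → V → V → Prop) : Prop where
  swap : ∀ {a b c}, T a b c → T b a c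
  rot : ∀ {a b c}, T a b c → T b c a
  ne : ∀ {a b c}, T a b c → a ≠ b

namespace IsTripleSystem

variable {V : Type*} {T : V → V → V → Prop} {a b c : V}

lemma rev (hT : IsTripleSystem T) (h : T a b c) : T c b a := hT.swap (hT.rot h)

lemma swap_right (hT : IsTripleSystem T) (h : T a b c) : T a c b := hT.rot (hT.swap h)

end IsTripleSystem

namespace LPath

variable {V : Type*} {T : V → V → V → Prop} {w : V → V → ℕ} {a b c d x : V} {l l' : List V}
  {s s' : ℕ}

lemma join (h₁ : LPath T w a b l s) (h : T b x c) (h₂ : LPath T w c d l' s') :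
    LPath T w a d (l ++ x :: l') (s + w b c + s') := by
  induction h₁ with
  | single a => simpa using cons h h₂
  | cons h' _ ih => simpa [add_assoc] using cons h' (ih h)

lemma reverse (hT : IsTripleSystem T) (hw : ∀ x y, w x y = w y x) (h : LPath T w a b l s) :
    LPath T w b a l.reverse s := by
  induction h with
  | single a => simpa using single a
  | @cons a u c b l s h _ ih =>
    have := join ih (hT.rev h) (single a)
    simpa [hw, add_comm] using this

lemma head_mem (h : LPath T w a b l s) : a ∈ l := by
  cases h <;> simp

lemma last_mem (h : LPath T w a b l s) : b ∈ l := by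
  induction h with
  | single a => simp
  | cons _ _ ih => simp [ih]

lemma length_odd (h : LPath T w a b l s) : ∃ m, l.length = 2 * m + 1 := by
  induction h with
  | single a => exact ⟨0, rfl⟩
  | cons _ _ ih =>
    obtain ⟨m, hm⟩ := ih
    exact ⟨m + 1, by simp [hm]; ring⟩

lemma weight_le (h : LPath T w a b l s) (hw : ∀ x y, w x y ≤ 1) : s ≤ l.length := by
  induction h with
  | single a => simp
  | @cons a u c b l s _ _ ih =>
    have := hw a c
    simp only [List.length_cons]
    omega

lemma sum_le (h : LPath T w a b l s) (f g : V → ℕ) (M : ℕ)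
    (H : ∀ L R c d u s₁ s₂, LPath T w a c L s₁ → LPath T w d b R s₂ → T c u d →
      l = L ++ u :: R → s = s₁ + w c d + s₂ → f d + g c + f u + g u ≤ M) :
    (l.map f).sum + (l.map g).sum ≤ f a + g b + M * (l.length / 2) := by
  induction h with
  | single a => simp
  | @cons a u c b l s h hl ih =>
    have h₁ := H [a] l a c u 0 s (single a) hl h rfl (by simp)
    have h₂ := ih fun L R c' d u' s₁ s₂ hL hR ht hl hs =>
      H (a :: u :: L) R c' d u' _ s₂ (cons h hL) hR ht (by simp [hl]) (by rw [hs]; ring)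
    have h₃ : (a :: u :: l).length / 2 = l.length / 2 + 1 := by simp; omega
    rw [h₃, mul_add]
    simp only [List.map_cons, List.sum_cons]
    omega

lemma triple_getD (h : LPath T w a b l s) (z : V) (i : ℕ) (hi : 2 * i + 2 < l.length) :
    T (l.getD (2 * i) z) (l.getD (2 * i + 1) z) (l.getD (2 * i + 2) z) := by
  induction h generalizing i with
  | single a => simp at hi
  | @cons a u c b l s h hl ih =>
    cases i with
    | zero => cases hl <;> simpa using h
    | succ i =>
      have := ih i (by simp at hi; omega)
      simpa [mul_add] using this

lemma not_triple_of_notMem (hT : IsTripleSystem T) {m : ℕ} {p q : V}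
    (hmax : ∀ a b l s, LPath T w a b l s → l.Nodup → l.length ≠ 2 * m + 3)
    (h : LPath T w a b l s) (hn : l.Nodup) (hl : l.length = 2 * m + 1) (hp : p ∉ l) (hq : q ∉ l) :
    ¬T a p q := fun ht => by
  have hpq := hT.ne (hT.rot ht)
  refine hmax _ _ _ _ (cons (hT.rev ht) h) ?_ (by simp [hl])
  simp [hn, hp, hq, hpq.symm]

end LPath

section Counting

open Finset

open scoped Classical in
/-- The set of `q ∈ S` with `T a p q`. -/
noncomputable def tripleSet {V : Type*} (T : V → V → V → Prop) (S : Finset V) (a p : V) :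
    Finset V :=
  S.filter (T a p ·)

/-- The number of `q ∈ S` with `T a p q`. -/
noncomputable def tripleCount {V : Type*} (T : V → V → V → Prop) (S : Finset V) (a p : V) : ℕ :=
  (tripleSet T S a p).card

section

variable {V : Type*} {T : V → V → V → Prop} {S : Finset V} {a p q : V}

lemma mem_tripleSet : q ∈ tripleSet T S a p ↔ q ∈ S ∧ T a p q := by
  simp [tripleSet]

lemma tripleCount_comm (hT : IsTripleSystem T) (S : Finset V) (a p : V) :
    tripleCount T S a p = tripleCount T S p a := by
  unfold tripleCount
  congr 1
  ext q
  simp only [mem_tripleSet]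
  exact ⟨fun h => ⟨h.1, hT.swap h.2⟩, fun h => ⟨h.1, hT.swap h.2⟩⟩

lemma tripleCount_le_of_forall {A : Finset V}
    (h : ∀ q ∈ S, T a p q → q ∈ A) : tripleCount T S a p ≤ A.card :=
  card_le_card fun q hq => h q (mem_tripleSet.1 hq).1 (mem_tripleSet.1 hq).2

lemma tripleCount_eq_zero (h : ∀ q ∈ S, ¬T a p q) : tripleCount T S a p = 0 :=
  card_eq_zero.2 (eq_empty_of_forall_notMem fun q hq =>
    h q (mem_tripleSet.1 hq).1 (mem_tripleSet.1 hq).2)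

lemma exists_of_tripleCount_pos (h : 0 < tripleCount T S a p) : ∃ q ∈ S, T a p q := by
  obtain ⟨q, hq⟩ := card_pos.1 h
  exact ⟨q, mem_tripleSet.1 hq⟩

lemma exists_ne_of_one_lt_tripleCount (h : 1 < tripleCount T S a p) (z : V) :
    ∃ q ∈ S, T a p q ∧ q ≠ z := by
  obtain ⟨q, hq, hz⟩ := exists_mem_ne h z
  exact ⟨q, (mem_tripleSet.1 hq).1, (mem_tripleSet.1 hq).2, hz⟩

end

variable {V : Type*} [DecidableEq V] {T : V → V → V → Prop}

lemma tripleCount_le_card_erase (hT : IsTripleSystem T) (S : Finset V) (a p : V) :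
    tripleCount T S a p ≤ ((S.erase a).erase p).card :=
  tripleCount_le_of_forall fun q hq h => by
    simp only [mem_erase]
    exact ⟨(hT.ne (hT.rot h)).symm, hT.ne (hT.rot (hT.rot h)), hq⟩

lemma tripleCount_le_card_sub_two (hT : IsTripleSystem T) {S : Finset V} {a p : V} (ha : a ∈ S)
    (hp : p ∈ S) : tripleCount T S a p ≤ S.card - 2 := by
  by_cases hap : a = p
  · rw [tripleCount_eq_zero fun q _ h => hT.ne h hap]
    exact Nat.zero_le _
  · have h := tripleCount_le_card_erase hT S a p
    rw [card_erase_of_mem (mem_erase.2 ⟨Ne.symm hap, hp⟩), card_erase_of_mem ha] at h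
    omega

variable [Fintype V]

lemma tripleCount_add_compl (S : Finset V) (a p : V) :
    tripleCount T S a p + tripleCount T Sᶜ a p = tripleCount T univ a p := by
  classical
  unfold tripleCount tripleSet
  rw [← card_union_of_disjoint (disjoint_filter_filter disjoint_compl_right), ← filter_union,
    union_compl]

lemma sum_tripleCount_le (hT : IsTripleSystem T) (S : Finset V) (a : V)
    (h : ∀ p q, p ∉ S → q ∉ S → ¬T a p q) :
    ∑ p, tripleCount T univ a p ≤
      ∑ p ∈ S, (2 * tripleCount T Sᶜ a p + tripleCount T S a p) := by
  have h₁ : ∀ p ∈ Sᶜ, tripleCount T univ a p = tripleCount T S a p := fun p hp => by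
    rw [← tripleCount_add_compl S, Nat.add_eq_left]
    exact tripleCount_eq_zero fun q hq => h p q (mem_compl.1 hp) (mem_compl.1 hq)
  have h₂ : ∑ p ∈ Sᶜ, tripleCount T S a p = ∑ p ∈ S, tripleCount T Sᶜ a p := by
    classical
    simp only [tripleCount, tripleSet, card_filter]
    rw [sum_comm]
    refine sum_congr rfl fun p _ => sum_congr rfl fun q _ => ?_
    exact if_congr ⟨hT.swap_right, hT.swap_right⟩ rfl rfl
  rw [← sum_add_sum_compl S, sum_congr rfl h₁, h₂, ← sum_add_distrib]
  refine le_of_eq (sum_congr rfl fun p _ => ?_)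
  rw [← tripleCount_add_compl S]
  ring

end Counting

lemma List.Nodup.of_count_le_add {V : Type*} [DecidableEq V] {l X l' : List V} (hl : l.Nodup)
    (hX : X.Nodup) (hdisj : X.Forall (· ∉ l)) (hc : ∀ v, l'.count v ≤ l.count v + X.count v) :
    l'.Nodup := by
  rw [List.nodup_iff_count_le_one] at *
  intro v
  have h := hc v
  have h₁ := hl v
  have h₂ := hX v
  by_cases hv : v ∈ X
  · rw [List.count_eq_zero_of_not_mem (List.forall_iff_forall_mem.1 hdisj v hv)] at h
    omega
  · rw [List.count_eq_zero_of_not_mem hv] at h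
    omega

/-- The arithmetic behind `LPath.split_sum_le`. -/
lemma split_arith {H X W ad bc au bu cd ad' bc' au' bu' cd' w₁ w₂ w₃ : ℕ}
    (hHX : H ≤ X) (hX : 6 ≤ X) (hW : 7 ≤ W)
    (h₁ : 2 ≤ au → cd = 0) (h₂ : 2 ≤ au → bu = 0) (h₃ : 1 ≤ ad → w₁ ≤ w₃) (h₄ : 1 ≤ bc → ad ≤ 3)
    (h₁' : 2 ≤ bu → cd = 0) (h₂' : 2 ≤ bu → au = 0) (h₃' : 1 ≤ bc → w₂ ≤ w₃)
    (h₄' : 1 ≤ ad → bc ≤ 3)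
    (l₁ : w₁ = 0 ↔ ad' + ad ≤ H) (l₂ : w₂ = 0 ↔ bc' + bc ≤ H) (l₃ : w₃ = 0 ↔ cd' + cd ≤ H)
    (i₁ : ad' ≤ H) (i₂ : bc' ≤ H) (i₃ : au' ≤ H) (i₄ : bu' ≤ H) (i₅ : cd' ≤ H)
    (c₁ : ad ≤ W) (c₂ : bc ≤ W) (c₃ : au ≤ W) (c₄ : bu ≤ W) :
    (2 * ad + ad') + (2 * bc + bc') + (2 * au + au') + (2 * bu + bu') ≤ 2 * W + 4 * H + X := by
  have v : (2 * ad + ad') + (2 * bc + bc') ≤ 2 * W + 2 * H := by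
    clear * - h₄ h₄' i₁ i₂ c₁ c₂ hW
    omega
  have v' : cd = 0 → (2 * ad + ad') + (2 * bc + bc') ≤ 2 * H + X := fun h => by
    have e : w₃ = 0 := l₃.2 (by omega)
    have e₁ : 1 ≤ ad → ad' + ad ≤ H := fun h => l₁.1 (by have := h₃ h; omega)
    have e₂ : 1 ≤ bc → bc' + bc ≤ H := fun h => l₂.1 (by have := h₃' h; omega)
    clear * - e₁ e₂ h₄ h₄' hHX hX i₁ i₂
    omega
  by_cases ha : 2 ≤ au
  · have := v' (h₁ ha)
    have := h₂ ha
    omega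
  by_cases hb : 2 ≤ bu
  · have := v' (h₁' hb)
    have := h₂' hb
    omega
  omega

namespace LPath

open Finset

variable {V : Type*} [Fintype V] [DecidableEq V] {T : V → V → V → Prop} {w : V → V → ℕ}

/-- If no linear path has `m + 1` edges and all degrees are large, then the ends of a linear path
with `m` edges lie in at most two common triples leaving the path. -/
lemma tripleCount_ends_le_two (hT : IsTripleSystem T) (hw : ∀ x y, w x y = w y x) {m D s : ℕ}
    {a b : V} {l : List V}
    (hmax : ∀ a b l s, LPath T w a b l s → l.Nodup → l.length ≠ 2 * m + 3)
    (hcard : 2 * m + 4 ≤ Fintype.card V)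
    (hdeg : ∀ d, D ≤ ∑ p, tripleCount T univ d p) (hD : m * (Fintype.card V + 2 * m) < D)
    (h : LPath T w a b l s) (hn : l.Nodup) (hl : l.length = 2 * m + 1) :
    tripleCount T l.toFinsetᶜ a b ≤ 2 := by
  by_contra! h3
  obtain ⟨d, hd, x, hx, y, hy, hdx, hdy, hxy⟩ := two_lt_card.1 h3
  simp only [mem_tripleSet, mem_compl, List.mem_toFinset] at hd hx hy
  set S := l.toFinset with hS
  have hScard : S.card = 2 * m + 1 := by rw [hS, List.toFinset_card_of_nodup hn, hl]
  have hdS : d ∈ Sᶜ := by simp [hS, hd.1]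
  have hSc : (Sᶜ.erase d).card = Fintype.card V - 2 * m - 2 := by
    rw [card_erase_of_mem hdS, card_compl, hScard]
    omega
  have hcross : ∀ p, tripleCount T Sᶜ d p ≤ Fintype.card V - 2 * m - 2 := fun p => by
    rw [← hSc]
    exact (tripleCount_le_card_erase hT _ _ _).trans (card_le_card (erase_subset _ _))
  have hinner : ∀ p ∈ S, tripleCount T S d p ≤ 2 * m := fun p hp => by
    have := tripleCount_le_card_erase hT S d p
    rw [erase_eq_of_notMem (mem_compl.1 hdS), card_erase_of_mem hp, hScard] at this
    omega
  have hout : ∀ p q, p ∉ S → q ∉ S → ¬T d p q := by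
    intro p q hp hq ht
    simp only [hS, List.mem_toFinset] at hp hq
    have n₁ := hT.ne ht
    have n₂ := hT.ne (hT.rot ht)
    have n₃ := hT.ne (hT.rot (hT.rot ht))
    cases h with
    | single => exact hT.ne hd.2 rfl
    | @cons _ u c _ l' _ h' hl' =>
      refine hmax _ _ _ _ (cons (hT.rev ht) (cons (hT.rot (hT.rot hd.2)) (hl'.reverse hT hw)))
        ?_ ?_
      · refine hn.of_count_le_add (X := [q, p, d]) (by simp [n₂.symm, n₃, n₁.symm])
          ⟨hq, hp, hd.1⟩ fun v => ?_
        simp [List.count_cons]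
        omega
      · simp at hl ⊢; omega
  have hca : tripleCount T Sᶜ d a = 0 := tripleCount_eq_zero fun q hq ht => by
    simp only [hS, mem_compl, List.mem_toFinset] at hq
    have n₃ := hT.ne (hT.rot (hT.rot ht))
    refine hmax _ _ _ _ (cons (hT.rot (hT.rot ht)) h) ?_ ?_
    · refine hn.of_count_le_add (X := [q, d]) (by simp [n₃]) ⟨hq, hd.1⟩ fun v => ?_
      simp [List.count_cons]
      omega
    · simp at hl ⊢; omega
  have hcb : tripleCount T Sᶜ d b = 0 := tripleCount_eq_zero fun q hq ht => by
    simp only [hS, mem_compl, List.mem_toFinset] at hq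
    have n₃ := hT.ne (hT.rot (hT.rot ht))
    refine hmax _ _ _ _ (cons (hT.rot (hT.rot ht)) (h.reverse hT hw)) ?_ ?_
    · refine hn.of_count_le_add (X := [q, d]) (by simp [n₃]) ⟨hq, hd.1⟩ fun v => ?_
      simp [List.count_cons]
      omega
    · simp at hl ⊢; omega
  have hsum := h.sum_le (tripleCount T Sᶜ d) (tripleCount T Sᶜ d) (Fintype.card V - 2 * m - 2) (by
    intro L R c d' u s₁ s₂ hL hR ht hlr _
    have hu : tripleCount T Sᶜ d u = 0 := tripleCount_eq_zero fun q hq htq => by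
      simp only [hS, mem_compl, List.mem_toFinset] at hq
      have n₃ := hT.ne (hT.rot (hT.rot htq))
      obtain ⟨z, hzl, hz, hzq, hzd⟩ : ∃ z, z ∉ l ∧ T a b z ∧ z ≠ q ∧ z ≠ d := by
        by_cases hxq : x = q
        · exact ⟨y, hy.1, hy.2, fun e => hxy (hxq.trans e.symm), hdy.symm⟩
        · exact ⟨x, hx.1, hx.2, hxq, hdx.symm⟩
      cases hR with
      | single =>
        refine hmax _ _ _ _ (cons (hT.rot (hT.rot htq))
          (cons (hT.rot ht) (hL.reverse hT hw))) ?_ ?_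
        · refine hn.of_count_le_add (X := [q, d]) (by simp [n₃]) ⟨hq, hd.1⟩ fun v => ?_
          simp [hlr, List.count_cons]
          omega
        · subst hlr; simp at hl ⊢; omega
      | @cons _ u' c' _ R' _ h' hR' =>
        refine hmax _ _ _ _ (cons (hT.rot (hT.rot htq))
          (cons (hT.rot ht) ((hL.reverse hT hw).join (hT.swap_right hz) (hR'.reverse hT hw)))) ?_ ?_
        · refine hn.of_count_le_add (X := [q, d, z]) (by simp [n₃, hzq.symm, hzd.symm])
            ⟨hq, hd.1, hzl⟩ fun v => ?_
          simp [hlr, List.count_cons]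
          omega
        · subst hlr; simp at hl ⊢; omega
    have hcd : ∀ q ∈ Sᶜ, ∀ q' ∈ Sᶜ, T d c q → T d d' q' → q = q' := by
      intro q hq q' hq' htq htq'
      by_contra hne
      simp only [hS, mem_compl, List.mem_toFinset] at hq hq'
      have n₁ := hT.ne (hT.rot (hT.rot htq))
      have n₂ := hT.ne (hT.rot (hT.rot htq'))
      refine hmax _ _ _ _ (hL.join (hT.rot htq) (cons (hT.swap_right htq') hR)) ?_ ?_
      · refine hn.of_count_le_add (X := [q, d, q']) (by simp [n₁, hne, n₂.symm])
          ⟨hq, hd.1, hq'⟩ fun v => ?_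
        simp [hlr, List.count_cons]
        omega
      · subst hlr; simp at hl ⊢; omega
    have h₁ := hcross c
    have h₂ := hcross d'
    rw [hu]
    by_contra! hlt
    obtain ⟨q, hq, htq⟩ := exists_of_tripleCount_pos (T := T) (S := Sᶜ) (a := d) (p := c) (by omega)
    obtain ⟨q', hq', htq'⟩ :=
      exists_of_tripleCount_pos (T := T) (S := Sᶜ) (a := d) (p := d') (by omega)
    rcases Nat.lt_or_ge 1 (tripleCount T Sᶜ d c) with h₃ | h₃
    · obtain ⟨r, hr, htr, hne⟩ := exists_ne_of_one_lt_tripleCount h₃ q'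
      exact hne (hcd r hr q' hq' htr htq')
    · obtain ⟨r, hr, htr, hne⟩ := exists_ne_of_one_lt_tripleCount
        (T := T) (S := Sᶜ) (a := d) (p := d') (by omega) q
      exact hne (hcd q hq r hr htq htr).symm)
  rw [← List.sum_toFinset _ hn, ← hS, hca, hcb, hl] at hsum
  have h₁ := (hdeg d).trans (sum_tripleCount_le hT S d hout)
  have h₂ := sum_le_card_nsmul S _ _ hinner
  rw [sum_add_distrib, ← mul_sum] at h₁
  rw [hScard, smul_eq_mul] at h₂
  obtain ⟨e, he⟩ := Nat.exists_eq_add_of_le hcard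
  rw [show (2 * m + 1) / 2 = m by omega] at hsum
  rw [he] at hsum hD
  rw [show 2 * m + 4 + e - 2 * m - 2 = e + 2 by omega] at hsum
  nlinarith

/-- Constraints on the triples at the end `a` of a linear path that has the largest number of edges
and, subject to this, the largest weight. -/
lemma split_bounds (hT : IsTripleSystem T) (hw : ∀ x y, w x y = w y x) {m D s₁ s₂ : ℕ}
    {a b c d u : V} {L R : List V} {S : Finset V}
    (hmax : ∀ a b l s, LPath T w a b l s → l.Nodup → l.length ≠ 2 * m + 3)
    (hweight : ∀ a b l s, LPath T w a b l s → l.Nodup → l.length = 2 * m + 1 →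
      s ≤ s₁ + w c d + s₂)
    (hcard : 2 * m + 4 ≤ Fintype.card V)
    (hdeg : ∀ d, D ≤ ∑ p, tripleCount T univ d p) (hD : m * (Fintype.card V + 2 * m) < D)
    (hL : LPath T w a c L s₁) (hR : LPath T w d b R s₂)
    (hn : (L ++ u :: R).Nodup) (hl : (L ++ u :: R).length = 2 * m + 1)
    (hS : ∀ v, v ∈ S ↔ v ∈ L ++ u :: R) :
    (2 ≤ tripleCount T Sᶜ a u → tripleCount T Sᶜ c d = 0) ∧
    (2 ≤ tripleCount T Sᶜ a u → tripleCount T Sᶜ b u = 0) ∧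
    (1 ≤ tripleCount T Sᶜ a d → w a d ≤ w c d) ∧
    (1 ≤ tripleCount T Sᶜ b c → tripleCount T Sᶜ a d ≤ 3) := by
  refine ⟨fun h => tripleCount_eq_zero fun z hz htz => ?_,
    fun h => tripleCount_eq_zero fun z hz htz => ?_, fun h => ?_, fun h => ?_⟩
  · obtain ⟨x, hx, htx, hne⟩ := exists_ne_of_one_lt_tripleCount h z
    simp only [mem_compl, hS] at hz hx
    refine hmax _ _ _ _ (cons (hT.rev htx) (hL.join (hT.swap_right htz) hR)) ?_ ?_
    · refine hn.of_count_le_add (X := [x, z]) (by simp [hne]) ⟨hx, hz⟩ fun v => ?_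
      simp [List.count_cons]
      omega
    · simp at hl ⊢; omega
  · obtain ⟨x, hx, htx, hne⟩ := exists_ne_of_one_lt_tripleCount h z
    simp only [mem_compl, hS] at hz hx
    refine hmax _ _ _ _ ((hL.reverse hT hw).join (hT.swap_right htx)
      (cons (hT.rot htz) (hR.reverse hT hw))) ?_ ?_
    · refine hn.of_count_le_add (X := [x, z]) (by simp [hne]) ⟨hx, hz⟩ fun v => ?_
      simp [List.count_cons]
      omega
    · simp at hl ⊢; omega
  · obtain ⟨x, hx, htx⟩ := exists_of_tripleCount_pos h
    simp only [mem_compl, hS] at hx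
    have := hweight _ _ _ _ ((hL.reverse hT hw).join (hT.swap_right htx) hR)
      (hn.of_count_le_add (X := [x]) (by simp) hx fun v => by
        simp [List.count_cons]
        omega)
      (by simp at hl ⊢; omega)
    omega
  · obtain ⟨y, hy, hty⟩ := exists_of_tripleCount_pos h
    have hy' := hy
    simp only [mem_compl, hS] at hy'
    have h₁ := tripleCount_ends_le_two hT hw hmax hcard hdeg hD
      (hR.join (hT.swap_right hty) (hL.reverse hT hw))
      (hn.of_count_le_add (X := [y]) (by simp) hy' fun v => by
        simp [List.count_cons]
        omega)
      (by simp at hl ⊢; omega)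
    have h₂ : tripleCount T Sᶜ a d ≤ (insert y (tripleSet T
        (R ++ y :: L.reverse).toFinsetᶜ d a)).card :=
      tripleCount_le_of_forall fun q hq htq => by
        simp only [mem_insert, mem_tripleSet, mem_compl, List.mem_toFinset, hS] at hq ⊢
        by_cases hqy : q = y
        · exact Or.inl hqy
        · refine Or.inr ⟨?_, hT.swap htq⟩
          simp only [List.mem_append, List.mem_cons, List.mem_reverse, not_or] at hq ⊢
          tauto
    exact h₂.trans ((card_insert_le _ _).trans (Nat.succ_le_succ h₁))

/-- The triples at both ends of a linear path with the largest number of edges and, subject to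
this, the largest weight. Here a pair has weight one if its codegree exceeds `H`. -/
lemma split_sum_le (hT : IsTripleSystem T) (hw : ∀ x y, w x y = w y x) {m D H X s₁ s₂ : ℕ}
    {a b c d u : V} {L R : List V} {S : Finset V}
    (hlight : ∀ x y, w x y = 0 ↔ tripleCount T univ x y ≤ H) (hmH : 2 * m ≤ H + 1)
    (hHX : H ≤ X) (hX : 6 ≤ X)
    (hmax : ∀ a b l s, LPath T w a b l s → l.Nodup → l.length ≠ 2 * m + 3)
    (hweight : ∀ a b l s, LPath T w a b l s → l.Nodup → l.length = 2 * m + 1 →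
      s ≤ s₁ + w c d + s₂)
    (hcard : 2 * m + 8 ≤ Fintype.card V)
    (hdeg : ∀ d, D ≤ ∑ p, tripleCount T univ d p) (hD : m * (Fintype.card V + 2 * m) < D)
    (hL : LPath T w a c L s₁) (hR : LPath T w d b R s₂)
    (hn : (L ++ u :: R).Nodup) (hl : (L ++ u :: R).length = 2 * m + 1)
    (hS : S = (L ++ u :: R).toFinset) :
    (2 * tripleCount T Sᶜ a d + tripleCount T S a d) +
      (2 * tripleCount T Sᶜ b c + tripleCount T S b c) +
      (2 * tripleCount T Sᶜ a u + tripleCount T S a u) +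
      (2 * tripleCount T Sᶜ b u + tripleCount T S b u) ≤
      2 * (Fintype.card V - 2 * m - 1) + 4 * H + X := by
  have hrev : (L ++ u :: R).reverse = R.reverse ++ u :: L.reverse := by simp
  have hmem : ∀ v, v ∈ S ↔ v ∈ L ++ u :: R := fun v => by rw [hS, List.mem_toFinset]
  have hScard : S.card = 2 * m + 1 := by rw [hS, List.toFinset_card_of_nodup hn, hl]
  have hinner : ∀ {x y}, x ∈ S → y ∈ S → tripleCount T S x y ≤ H := fun hx hy => by
    have := tripleCount_le_card_sub_two hT hx hy
    omega
  have hcross : ∀ x y, tripleCount T Sᶜ x y ≤ Fintype.card V - 2 * m - 1 := fun x y => by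
    have h : tripleCount T Sᶜ x y ≤ Sᶜ.card := tripleCount_le_of_forall fun _ h _ => h
    rw [card_compl, hScard] at h
    omega
  have haS : a ∈ S := (hmem a).2 (by simp [hL.head_mem])
  have hbS : b ∈ S := (hmem b).2 (by simp [hR.last_mem])
  have hcS : c ∈ S := (hmem c).2 (by simp [hL.last_mem])
  have hdS : d ∈ S := (hmem d).2 (by simp [hR.head_mem])
  have huS : u ∈ S := (hmem u).2 (by simp)
  obtain ⟨h₁, h₂, h₃, h₄⟩ := split_bounds (u := u) hT hw hmax hweight (by omega) hdeg hD hL hR hn hl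
    hmem
  obtain ⟨h₁', h₂', h₃', h₄'⟩ := split_bounds (u := u) (S := S) hT hw hmax
    (fun a b l s h hn hl => (hweight a b l s h hn hl).trans_eq (by rw [hw]; ring)) (by omega) hdeg
    hD (hR.reverse hT hw) (hL.reverse hT hw)
    (hrev ▸ List.nodup_reverse.2 hn) (by rw [← hrev, List.length_reverse, hl]) fun v => by
      rw [hmem, ← hrev, List.mem_reverse]
  rw [tripleCount_comm hT _ d c] at h₁'
  rw [hw d c] at h₃'
  have l₁ := hlight a d
  have l₂ := hlight b c
  have l₃ := hlight c d
  rw [← tripleCount_add_compl S] at l₁ l₂ l₃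
  have i₁ := hinner haS hdS
  have i₂ := hinner hbS hcS
  have i₃ := hinner haS huS
  have i₄ := hinner hbS huS
  have i₅ := hinner hcS hdS
  have c₁ := hcross a d
  have c₂ := hcross b c
  have c₃ := hcross a u
  have c₄ := hcross b u
  exact split_arith hHX hX (by omega) h₁ h₂ h₃ h₄ h₁' h₂' h₃' h₄' l₁ l₂ l₃ i₁ i₂ i₃ i₄ i₅
    c₁ c₂ c₃ c₄

/-- Large degrees force a linear path with `2 * k + 1` edges. -/
theorem exists_of_degree (hT : IsTripleSystem T) {k D : ℕ} (hcard : 4 * k + 19 ≤ Fintype.card V)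
    (hD : D + 6 * k = 2 * (k * Fintype.card V + 6 * k ^ 2 + 3))
    (hdeg : ∀ d, D ≤ ∑ p, tripleCount T univ d p) :
    ∃ w a b l s, LPath T w a b l s ∧ l.Nodup ∧ l.length = 2 * (2 * k + 1) + 1 := by
  let w : V → V → ℕ := fun x y => if tripleCount T univ x y ≤ 4 * k - 1 then 0 else 1
  have hw : ∀ x y, w x y = w y x := fun x y => by simp only [w, tripleCount_comm hT]
  have hw₁ : ∀ x y, w x y ≤ 1 := fun x y => by dsimp only [w]; split_ifs <;> simp
  have hlight : ∀ x y, w x y = 0 ↔ tripleCount T univ x y ≤ 4 * k - 1 := fun x y => by simp [w]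
  by_contra hno
  obtain ⟨m, hm, hP, hmax⟩ : ∃ m ≤ 2 * k,
      (∃ s a b l, LPath T w a b l s ∧ l.Nodup ∧ l.length = 2 * m + 1) ∧
      ∀ a b l s, LPath T w a b l s → l.Nodup → l.length ≠ 2 * m + 3 := by
    by_contra! hstep
    have key : ∀ m ≤ 2 * k + 1, ∃ s a b l, LPath T w a b l s ∧ l.Nodup ∧ l.length = 2 * m + 1 := by
      intro m
      induction m with
      | zero =>
        obtain ⟨v⟩ : Nonempty V := Fintype.card_pos_iff.1 (by omega)
        exact fun _ => ⟨0, v, v, [v], single v, by simp, by simp⟩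
      | succ m ih =>
        intro hm
        obtain ⟨a, b, l, s, h⟩ := hstep m (by omega) (ih (by omega))
        exact ⟨s, a, b, l, h⟩
    obtain ⟨s, a, b, l, h⟩ := key _ le_rfl
    exact hno ⟨w, a, b, l, s, h⟩
  have hbdd : BddAbove {s | ∃ a b l, LPath T w a b l s ∧ l.Nodup ∧ l.length = 2 * m + 1} := by
    refine ⟨2 * m + 1, ?_⟩
    rintro s ⟨a, b, l, h, _, hl⟩
    exact (h.weight_le hw₁).trans_eq hl
  obtain ⟨a, b, l, h, hn, hl⟩ := Nat.sSup_mem hP hbdd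
  have hweight : ∀ a b l s, LPath T w a b l s → l.Nodup → l.length = 2 * m + 1 → s ≤ _ :=
    fun a b l s h hn hl => le_csSup hbdd ⟨a, b, l, h, hn, hl⟩
  have hsum := h.sum_le (fun p => 2 * tripleCount T l.toFinsetᶜ a p + tripleCount T l.toFinset a p)
    (fun p => 2 * tripleCount T l.toFinsetᶜ b p + tripleCount T l.toFinset b p)
    (2 * (Fintype.card V - 2 * m - 1) + 4 * (4 * k - 1) + max (4 * k - 1) 6)
    fun L R c d u s₁ s₂ hL hR _ hlr hs => split_sum_le hT hw hlight (by
      have : l.length = L.length + (R.length + 1) := by simp [hlr]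
      obtain ⟨x, hx⟩ := hL.length_odd
      obtain ⟨y, hy⟩ := hR.length_odd
      omega) (le_max_left _ _) (le_max_right _ _) hmax (hs ▸ hweight) (by omega) hdeg (by
      nlinarith [Nat.mul_le_mul hm (show Fintype.card V + 2 * m ≤ Fintype.card V + 4 * k by omega),
        sq_nonneg ((k : ℤ) - 1)]) hL hR (hlr ▸ hn) (hlr ▸ hl) (by rw [hlr])
  have h₁ := (hdeg a).trans (sum_tripleCount_le hT l.toFinset a fun p q hp hq =>
    h.not_triple_of_notMem hT hmax hn hl (by simpa using hp) (by simpa using hq))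
  have h₂ := (hdeg b).trans (sum_tripleCount_le hT l.toFinset b fun p q hp hq =>
    (h.reverse hT hw).not_triple_of_notMem hT hmax (by simpa using hn) (by simpa using hl)
      (by simpa using hp) (by simpa using hq))
  have h₀ : ∀ S : Finset V, ∀ x, tripleCount T S x x = 0 := fun S x =>
    tripleCount_eq_zero fun q _ ht => hT.ne ht rfl
  rw [← List.sum_toFinset _ hn, ← List.sum_toFinset _ hn, hl, h₀, h₀, h₀, h₀,
    show (2 * m + 1) / 2 = m by omega] at hsum
  have h₃ : 2 * D ≤
      (2 * (Fintype.card V - 2 * m - 1) + 4 * (4 * k - 1) + max (4 * k - 1) 6) * m := by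
    omega
  obtain ⟨e, he⟩ := Nat.exists_eq_add_of_le hcard
  obtain ⟨j, hj⟩ := Nat.exists_eq_add_of_le hm
  rcases k with _ | _ | k
  · obtain rfl : m = 0 := by omega
    omega
  · rw [show max (4 * (0 + 1) - 1) 6 = 6 from rfl] at h₃
    obtain rfl | rfl | rfl : m = 0 ∨ m = 1 ∨ m = 2 := by omega
    all_goals omega
  · rw [max_eq_left (by omega),
      show 2 * (Fintype.card V - 2 * m - 1) + 4 * (4 * (k + 1 + 1) - 1) + (4 * (k + 1 + 1) - 1) =
        28 * k + 2 * e + 87 - 4 * m by omega] at h₃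
    rw [he] at hD
    zify [show 4 * m ≤ 28 * k + 2 * e + 87 by omega] at h₃ hD hj
    have hj' : (j : ℤ) = 2 * (k + 1 + 1) - m := by linarith
    have : (0 : ℤ) ≤ j * (12 * k + 2 * e + 55 + 4 * j) := by positivity
    rw [hj'] at this
    nlinarith

end LPath

section Hypergraph

open Finset

variable {V : Type*} [DecidableEq V] {E : Finset (Finset V)}

/-- The relation that three distinct vertices form an edge. -/
def EdgeTriple (E : Finset (Finset V)) (a b c : V) : Prop :=
  a ≠ b ∧ a ≠ c ∧ b ≠ c ∧ {a, b, c} ∈ E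

lemma isTripleSystem_edgeTriple (E : Finset (Finset V)) : IsTripleSystem (EdgeTriple E) where
  swap := fun ⟨h₁, h₂, h₃, h⟩ => ⟨h₁.symm, h₃, h₂, by rwa [insert_comm]⟩
  rot := fun {a b c} ⟨h₁, h₂, h₃, h⟩ => ⟨h₃, h₁.symm, h₂.symm, by
    rwa [show ({b, c, a} : Finset V) = {a, b, c} by ext; simp; tauto]⟩
  ne := fun h => h.1

lemma two_mul_hdegree_le [Fintype V] (hE : ∀ e ∈ E, e.card = 3) (v : V) :
    2 * hdegree E v ≤ ∑ p, tripleCount (EdgeTriple E) univ v p := by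
  classical
  have h₁ : ∑ p, tripleCount (EdgeTriple E) univ v p =
      (univ.filter fun x : V × V => EdgeTriple E v x.1 x.2).card := by
    simp only [tripleCount, tripleSet, card_filter]
    rw [← univ_product_univ, sum_product]
  rw [h₁, card_eq_sum_card_fiberwise (f := fun x => {v, x.1, x.2})
    (t := E.filter (v ∈ ·)) fun x hx => by
      simpa using (mem_filter.1 hx).2.2.2.2, mul_comm, hdegree, ← smul_eq_mul]
  refine card_nsmul_le_sum _ _ _ fun e he => ?_
  obtain ⟨heE, hve⟩ := mem_filter.1 he
  obtain ⟨x, y, hxy, h⟩ := card_eq_two.1 (show (e.erase v).card = 2 by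
    rw [card_erase_of_mem hve, hE e heE])
  have hx : v ≠ x := fun hx => notMem_erase v e (by rw [h]; simp [hx])
  have hy : v ≠ y := fun hy => notMem_erase v e (by rw [h]; simp [hy])
  have hexy : {v, x, y} = e := by rw [← insert_erase hve, h]
  have hxyE : EdgeTriple E v x y := ⟨hx, hy, hxy, hexy ▸ heE⟩
  rw [← card_pair (show (x, y) ≠ (y, x) from fun h => hxy (Prod.ext_iff.1 h).1)]
  refine card_le_card fun z hz => ?_
  simp only [mem_filter, mem_univ, true_and]
  rcases mem_insert.1 hz with rfl | hz
  · exact ⟨hxyE, hexy⟩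
  · rw [mem_singleton.1 hz]
    exact ⟨(isTripleSystem_edgeTriple E).swap_right hxyE, by rw [← hexy, pair_comm]⟩

lemma LPath.hasLinearPath {w : V → V → ℕ} {a b : V} {l : List V} {s m : ℕ}
    (h : LPath (EdgeTriple E) w a b l s) (hn : l.Nodup) (hl : l.length = 2 * m + 1) :
    HasLinearPath E m := by
  have hinj : ∀ {i j}, i < l.length → j < l.length → (l.getD i a = l.getD j a ↔ i = j) :=
    fun {i j} hi hj => by
      rw [List.getD_eq_getElem _ _ hi, List.getD_eq_getElem _ _ hj, hn.getElem_inj_iff]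
  let f : Fin m → Finset V := fun i =>
    ((Icc (2 * (i : ℕ)) (2 * i + 2))).image fun j => l.getD j a
  have hmem : ∀ (i : Fin m) (j : ℕ), j < l.length →
      (l.getD j a ∈ f i ↔ 2 * (i : ℕ) ≤ j ∧ j ≤ 2 * i + 2) := by
    intro i j hj
    simp only [f, mem_image, mem_Icc]
    constructor
    · rintro ⟨x, hx, hxj⟩
      rwa [← (hinj (by omega) hj).1 hxj]
    · exact fun h => ⟨j, h, rfl⟩
  have hf : ∀ i : Fin m, f i = {l.getD (2 * i) a, l.getD (2 * i + 1) a, l.getD (2 * i + 2) a} := by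
    intro i
    have : Icc (2 * (i : ℕ)) (2 * i + 2) = {2 * (i : ℕ), 2 * (i : ℕ) + 1, 2 * (i : ℕ) + 2} := by
      ext x
      simp only [mem_Icc, mem_insert, mem_singleton]
      omega
    simp only [f, this, image_insert, image_singleton]
  have hadj : ∀ i j : Fin m, (i : ℕ) + 1 = j → (f i ∩ f j).card = 1 := by
    intro i j hij
    rw [card_eq_one]
    refine ⟨l.getD (2 * j) a, ?_⟩
    ext x
    rw [mem_inter, mem_singleton]
    constructor
    · rintro ⟨hi, hj⟩
      obtain ⟨y, hy, rfl⟩ := mem_image.1 hi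
      rw [mem_Icc] at hy
      rw [hmem j y (by omega)] at hj
      rw [hinj (by omega) (by omega)]
      omega
    · rintro rfl
      rw [hmem _ _ (by omega), hmem _ _ (by omega)]
      omega
  refine ⟨f, fun i j hij => ?_, fun i => ?_, fun i j hij => ⟨?_, fun h => ?_⟩⟩
  · have h₁ := (hmem i (2 * i + 1) (by omega)).2 (by omega)
    rw [hij, hmem _ _ (by omega)] at h₁
    omega
  · rw [hf]
    exact (h.triple_getD a i (by omega)).2.2.2
  · rintro (h | h)
    · exact hadj i j h
    · rw [inter_comm]
      exact hadj j i h
  · refine eq_empty_of_forall_notMem fun x hx => ?_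
    obtain ⟨hi, hj⟩ := mem_inter.1 hx
    obtain ⟨y, hy, rfl⟩ := mem_image.1 hi
    rw [mem_Icc] at hy
    rw [hmem j y (by omega)] at hj
    omega

end Hypergraph

theorem min_degree_implies_long_odd_linear_path
    (k n : ℕ) (hn : n ≥ 4 * k + 19)
    (V : Type*) [Fintype V] [DecidableEq V] (hV : Fintype.card V = n)
    (E : Finset (Finset V)) (hE : ∀ e ∈ E, e.card = 3)
    (hdeg : ∀ v : V, hdegree E v ≥ k * n + 6 * k ^ 2 - 3 * k + 3) :
    HasLinearPath E (2 * k + 1) := by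
  subst hV
  have hk : 3 * k ≤ k * Fintype.card V + 6 * k ^ 2 := by nlinarith
  obtain ⟨w, a, b, l, s, h, hn, hl⟩ := LPath.exists_of_degree (isTripleSystem_edgeTriple E) hn
    (D := 2 * (k * Fintype.card V + 6 * k ^ 2 - 3 * k + 3)) (by omega) fun d =>
      (Nat.mul_le_mul_left 2 (hdeg d)).trans (two_mul_hdegree_le hE d)
  exact h.hasLinearPath hn hl
end

section
/- Let k be a nonnegative integer and let n ≥ 4k + 21. Every 3-uniform hypergraph H on n vertices with minimum degree δ₁(H) ≥ kn + 6k² + 7k + 6 contains a linear path of length 2k + 2. -/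
/-- The triple `{a, b, c}` is an edge of `E`. -/
def Tri {V : Type*} [DecidableEq V] (E : Finset (Finset V)) (a b c : V) : Prop :=
  ({a, b, c} : Finset V) ∈ E

/-- `LP E a b S n`: there is a linear path with `n` edges in `E`, with vertex set `S`, whose
first edge has `a` as an end and whose last edge has `b` as an end. -/
inductive LP {V : Type*} [DecidableEq V] (E : Finset (Finset V)) : V → V → Finset V → ℕ → Prop
  | nil (a : V) : LP E a a {a} 0
  | cons {a u b c : V} {S : Finset V} {n : ℕ} : Tri E a u b → LP E b c S n → a ∉ S → u ∉ S →
      a ≠ u → LP E a c (insert a (insert u S)) (n + 1)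

section LinearPath

variable {V : Type*} [DecidableEq V] {E : Finset (Finset V)}

lemma Tri.swap_left {a b c : V} (h : Tri E a b c) : Tri E b a c := by
  unfold Tri at *; rwa [Finset.insert_comm]

lemma Tri.swap_right {a b c : V} (h : Tri E a b c) : Tri E a c b := by
  unfold Tri at *; rwa [Finset.pair_comm]

lemma Tri.rotate {a b c : V} (h : Tri E a b c) : Tri E b c a := h.swap_left.swap_right

lemma Tri.reverse {a b c : V} (h : Tri E a b c) : Tri E c b a := h.rotate.swap_left

lemma Tri.ne (hE : ∀ e ∈ E, e.card = 3) {a b c : V} (h : Tri E a b c) :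
    a ≠ b ∧ a ≠ c ∧ b ≠ c := by
  have h3 := hE _ h
  refine ⟨?_, ?_, ?_⟩ <;> rintro rfl
  · have := Finset.card_le_two (a := a) (b := c)
    simp at h3; omega
  · have := Finset.card_le_two (a := b) (b := a)
    rw [Finset.insert_comm] at h3
    simp at h3; omega
  · have := Finset.card_le_two (a := a) (b := b)
    simp at h3; omega

lemma LP.card {a b : V} {S : Finset V} {n : ℕ} (h : LP E a b S n) : S.card = 2 * n + 1 := by
  induction h with
  | nil => simp
  | cons _ _ ha hu hau ih =>
    rw [Finset.card_insert_of_notMem (by simp [ha, hau]), Finset.card_insert_of_notMem hu, ih]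
    ring

lemma LP.join {a b c d r : V} {S T : Finset V} {n m : ℕ} (h : LP E a b S n) (h' : LP E c d T m)
    (hST : Disjoint S T) (ht : Tri E b r c) (hrS : r ∉ S) (hrT : r ∉ T) :
    LP E a d (S ∪ insert r T) (n + m + 1) := by
  induction h with
  | nil a =>
    rw [Finset.disjoint_singleton_left] at hST
    have := LP.cons ht h' hST hrT (by grind)
    rw [← Finset.insert_eq, Nat.zero_add]
    exact this
  | @cons a u b' c' S' n' hab hl ha hu hau ih =>
    rw [Finset.disjoint_left] at hST
    have h1 := ih (by rw [Finset.disjoint_left]; grind) ht (by grind)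
    have := LP.cons hab h1 (by grind) (by grind) hau
    convert this using 1
    · grind
    · ring

lemma LP.symm {a b : V} {S : Finset V} {n : ℕ} (h : LP E a b S n) : LP E b a S n := by
  induction h with
  | nil a => exact LP.nil a
  | @cons a u b c S n hab hl ha hu hau ih =>
    have := ih.join (LP.nil a) (by simpa using ha) hab.reverse hu (by simpa using hau.symm)
    convert this using 1
    grind

/-- The vertices `v 0, …, v n` and `u 0, …, u (n-1)` form a linear path with edges
`{v i, u i, v (i+1)}`. -/
structure IsIdx (E : Finset (Finset V)) (v u : ℕ → V) (n : ℕ) : Prop where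
  v_inj : ∀ i j, i ≤ n → j ≤ n → v i = v j → i = j
  u_inj : ∀ i j, i < n → j < n → u i = u j → i = j
  u_ne_v : ∀ i j, i < n → j ≤ n → u i ≠ v j
  tri : ∀ i < n, Tri E (v i) (u i) (v (i + 1))

/-- The vertices of an indexed path lying between `v i` and `v j`. -/
def seg (v u : ℕ → V) (i j : ℕ) : Finset V := (Finset.Icc i j).image v ∪ (Finset.Ico i j).image u

lemma mem_seg {v u : ℕ → V} {i j : ℕ} {x : V} :
    x ∈ seg v u i j ↔ (∃ t, i ≤ t ∧ t ≤ j ∧ v t = x) ∨ ∃ t, i ≤ t ∧ t < j ∧ u t = x := by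
  simp [seg, and_assoc]

lemma v_mem_seg {v u : ℕ → V} {i j t : ℕ} (h1 : i ≤ t) (h2 : t ≤ j) : v t ∈ seg v u i j :=
  mem_seg.2 (Or.inl ⟨t, h1, h2, rfl⟩)

lemma u_mem_seg {v u : ℕ → V} {i j t : ℕ} (h1 : i ≤ t) (h2 : t < j) : u t ∈ seg v u i j :=
  mem_seg.2 (Or.inr ⟨t, h1, h2, rfl⟩)

lemma seg_subset {v u : ℕ → V} {i j i' j' : ℕ} (h1 : i' ≤ i) (h2 : j ≤ j') :
    seg v u i j ⊆ seg v u i' j' := by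
  intro x hx
  rw [mem_seg] at *
  rcases hx with ⟨t, a, b, c⟩ | ⟨t, a, b, c⟩
  · exact Or.inl ⟨t, by omega, by omega, c⟩
  · exact Or.inr ⟨t, by omega, by omega, c⟩

lemma seg_self (v u : ℕ → V) (i : ℕ) : seg v u i i = {v i} := by simp [seg]

lemma seg_succ (v u : ℕ → V) {i j : ℕ} (h : i ≤ j) :
    seg v u i (j + 1) = insert (v (j + 1)) (insert (u j) (seg v u i j)) := by
  ext x
  simp only [Finset.mem_insert, mem_seg]
  constructor
  · rintro (⟨t, a, b, c⟩ | ⟨t, a, b, c⟩)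
    · by_cases ht : t = j + 1
      · subst ht; exact Or.inl c.symm
      · exact Or.inr (Or.inr (Or.inl ⟨t, a, by omega, c⟩))
    · by_cases ht : t = j
      · subst ht; exact Or.inr (Or.inl c.symm)
      · exact Or.inr (Or.inr (Or.inr ⟨t, a, by omega, c⟩))
  · rintro (rfl | rfl | ⟨t, a, b, c⟩ | ⟨t, a, b, c⟩)
    · exact Or.inl ⟨j + 1, by omega, le_rfl, rfl⟩
    · exact Or.inr ⟨j, h, by omega, rfl⟩
    · exact Or.inl ⟨t, a, by omega, c⟩
    · exact Or.inr ⟨t, a, by omega, c⟩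

namespace IsIdx

variable {v u : ℕ → V} {n : ℕ}

lemma v_mem_iff (h : IsIdx E v u n) {i j t : ℕ} (hj : j ≤ n) (ht : t ≤ n) :
    v t ∈ seg v u i j ↔ i ≤ t ∧ t ≤ j := by
  rw [mem_seg]
  constructor
  · rintro (⟨s, a, b, c⟩ | ⟨s, a, b, c⟩)
    · have := h.v_inj s t (by omega) ht c
      omega
    · exact absurd c (h.u_ne_v s t (by omega) ht)
  · rintro ⟨a, b⟩; exact Or.inl ⟨t, a, b, rfl⟩

lemma u_mem_iff (h : IsIdx E v u n) {i j t : ℕ} (hj : j ≤ n) (ht : t < n) :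
    u t ∈ seg v u i j ↔ i ≤ t ∧ t < j := by
  rw [mem_seg]
  constructor
  · rintro (⟨s, a, b, c⟩ | ⟨s, a, b, c⟩)
    · exact absurd c.symm (h.u_ne_v t s ht (by omega))
    · have := h.u_inj s t (by omega) ht c
      omega
  · rintro ⟨a, b⟩; exact Or.inr ⟨t, a, b, rfl⟩

lemma disjoint_seg (h : IsIdx E v u n) {i j i' j' : ℕ} (hj : j < i') (hn : j' ≤ n) :
    Disjoint (seg v u i j) (seg v u i' j') := by
  rw [Finset.disjoint_left]
  intro x hx hx'
  rw [mem_seg] at hx'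
  rcases hx' with ⟨t, a, b, rfl⟩ | ⟨t, a, b, rfl⟩
  · rw [h.v_mem_iff (by omega) (by omega)] at hx; omega
  · rw [h.u_mem_iff (by omega) (by omega)] at hx; omega

lemma lp (h : IsIdx E v u n) {i j : ℕ} (hij : i ≤ j) (hj : j ≤ n) :
    LP E (v i) (v j) (seg v u i j) (j - i) := by
  induction j, hij using Nat.le_induction with
  | base => simpa [seg_self] using LP.nil (v i)
  | succ j hij ih =>
    have h1 : v (j + 1) ∉ seg v u i j := by
      rw [h.v_mem_iff (by omega) hj]; omega
    have h2 : u j ∉ seg v u i j := by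
      rw [h.u_mem_iff (by omega) (by omega)]; omega
    have := (ih (by omega)).join (LP.nil (v (j + 1))) (by simpa using h1) (h.tri j (by omega))
      h2 (by simpa using h.u_ne_v j (j + 1) (by omega) hj)
    convert this using 1
    · rw [seg_succ v u hij]; grind
    · omega

lemma lp_u_right (h : IsIdx E v u n) {i j : ℕ} (hij : i ≤ j) (hj : j < n) :
    LP E (v i) (u j) (seg v u i (j + 1)) (j + 1 - i) := by
  have h1 : v (j + 1) ∉ seg v u i j := by
    rw [h.v_mem_iff (by omega) hj]; omega
  have h2 : u j ∉ seg v u i j := by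
    rw [h.u_mem_iff (by omega) (by omega)]; omega
  have := (h.lp hij (by omega)).join (LP.nil (u j)) (by simpa using h2)
    (h.tri j (by omega)).swap_right h1 (by simpa using (h.u_ne_v j (j + 1) (by omega) hj).symm)
  convert this using 1
  · rw [seg_succ v u hij]; grind
  · omega

lemma lp_u_left (h : IsIdx E v u n) {i j : ℕ} (hij : i < j) (hj : j ≤ n) :
    LP E (u i) (v j) (seg v u i j) (j - i) := by
  have hd : v i ∉ seg v u (i + 1) j := by
    rw [h.v_mem_iff hj (by omega)]; omega
  have hd' : u i ∉ seg v u (i + 1) j := by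
    rw [h.u_mem_iff hj (by omega)]; omega
  have := LP.cons (h.tri i (by omega)).swap_left (h.lp (show i + 1 ≤ j by omega) hj) hd' hd
    (h.u_ne_v i i (by omega) (by omega))
  convert this using 1
  · ext x
    simp only [Finset.mem_insert, mem_seg]
    constructor
    · rintro (⟨t, a, b, c⟩ | ⟨t, a, b, c⟩)
      · by_cases ht : t = i
        · subst ht; exact Or.inr (Or.inl c.symm)
        · exact Or.inr (Or.inr (Or.inl ⟨t, by omega, b, c⟩))
      · by_cases ht : t = i
        · subst ht; exact Or.inl c.symm
        · exact Or.inr (Or.inr (Or.inr ⟨t, by omega, b, c⟩))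
    · rintro (rfl | rfl | ⟨t, a, b, c⟩ | ⟨t, a, b, c⟩)
      · exact Or.inr ⟨i, le_rfl, hij, rfl⟩
      · exact Or.inl ⟨i, le_rfl, hij.le, rfl⟩
      · exact Or.inl ⟨t, by omega, b, c⟩
      · exact Or.inr ⟨t, by omega, b, c⟩
  · omega

lemma card_seg (h : IsIdx E v u n) : (seg v u 0 n).card = 2 * n + 1 := by
  have := (h.lp (Nat.zero_le n) le_rfl).card
  simpa using this

/-- The reversed path. -/
lemma rev (h : IsIdx E v u n) : IsIdx E (fun i => v (n - i)) (fun i => u (n - 1 - i)) n where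
  v_inj i j hi hj hv := by
    have := h.v_inj _ _ (by omega) (by omega) hv
    omega
  u_inj i j hi hj hv := by
    have := h.u_inj _ _ (by omega) (by omega) hv
    omega
  u_ne_v i j hi hj := h.u_ne_v _ _ (by omega) (by omega)
  tri i hi := by
    have := (h.tri (n - 1 - i) (by omega)).reverse
    have e1 : n - 1 - i + 1 = n - i := by omega
    have e2 : n - (i + 1) = n - 1 - i := by omega
    simpa only [e1, e2] using this

lemma seg_rev (v u : ℕ → V) (n : ℕ) :
    seg (fun i => v (n - i)) (fun i => u (n - 1 - i)) 0 n = seg v u 0 n := by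
  ext x
  simp only [mem_seg]
  constructor
  · rintro (⟨t, a, b, c⟩ | ⟨t, a, b, c⟩)
    · exact Or.inl ⟨n - t, by omega, by omega, c⟩
    · exact Or.inr ⟨n - 1 - t, by omega, by omega, c⟩
  · rintro (⟨t, a, b, c⟩ | ⟨t, a, b, c⟩)
    · exact Or.inl ⟨n - t, by omega, by omega, by rw [← c]; congr 1; omega⟩
    · exact Or.inr ⟨n - 1 - t, by omega, by omega, by rw [← c]; congr 1; omega⟩

/-- The path with the roles of `v 0` and `u 0` exchanged. -/
lemma swap (h : IsIdx E v u n) (hn : 1 ≤ n) :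
    IsIdx E (Function.update v 0 (u 0)) (Function.update u 0 (v 0)) n where
  v_inj i j hi hj hv := by
    have a := h.v_inj i j hi hj
    have b := h.u_ne_v 0 j hn hj
    have c := h.u_ne_v 0 i hn hi
    simp only [Function.update_apply] at hv
    grind
  u_inj i j hi hj hv := by
    have a := h.u_inj i j hi hj
    have b := h.u_ne_v i 0 hi (by omega)
    have c := h.u_ne_v j 0 hj (by omega)
    simp only [Function.update_apply] at hv
    grind
  u_ne_v i j hi hj := by
    have a := h.u_ne_v i j hi hj
    have b := h.v_inj j 0 hj (by omega)
    have c := h.u_inj i 0 hi hn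
    have d := h.u_ne_v 0 0 hn (by omega)
    simp only [Function.update_apply]
    grind
  tri i hi := by
    have a := h.tri i hi
    rcases i with _ | i
    · simpa using a.swap_left
    · simpa using a

lemma seg_swap (v u : ℕ → V) {n : ℕ} (hn : 1 ≤ n) :
    seg (Function.update v 0 (u 0)) (Function.update u 0 (v 0)) 0 n = seg v u 0 n := by
  ext x
  simp only [mem_seg, Function.update_apply]
  constructor
  · rintro (⟨t, a, b, c⟩ | ⟨t, a, b, c⟩)
    · by_cases ht : t = 0
      · exact Or.inr ⟨0, by omega, by omega, by simpa [ht] using c⟩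
      · exact Or.inl ⟨t, by omega, by omega, by simpa [ht] using c⟩
    · by_cases ht : t = 0
      · exact Or.inl ⟨0, by omega, by omega, by simpa [ht] using c⟩
      · exact Or.inr ⟨t, by omega, by omega, by simpa [ht] using c⟩
  · rintro (⟨t, a, b, c⟩ | ⟨t, a, b, c⟩)
    · by_cases ht : t = 0
      · exact Or.inr ⟨0, by omega, by omega, by simpa [ht] using c⟩
      · exact Or.inl ⟨t, by omega, by omega, by simpa [ht] using c⟩
    · by_cases ht : t = 0
      · exact Or.inl ⟨0, by omega, by omega, by simpa [ht] using c⟩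
      · exact Or.inr ⟨t, by omega, by omega, by simpa [ht] using c⟩

end IsIdx

lemma LP.exists_isIdx {a b : V} {S : Finset V} {n : ℕ} (h : LP E a b S n) :
    ∃ v u : ℕ → V, IsIdx E v u n ∧ v 0 = a ∧ v n = b ∧ seg v u 0 n = S := by
  induction h with
  | nil a =>
    exact ⟨fun _ => a, fun _ => a, ⟨by omega, by omega, by omega, by omega⟩, rfl, rfl,
      by simp [seg_self]⟩
  | @cons a u b c S n hab hl ha hu hau ih =>
    obtain ⟨v', u', hi, h0, hn, hS⟩ := ih
    have hv' : ∀ t ≤ n, v' t ∈ S := fun t ht => hS ▸ v_mem_seg (Nat.zero_le t) ht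
    have hu' : ∀ t < n, u' t ∈ S := fun t ht => hS ▸ u_mem_seg (Nat.zero_le t) ht
    refine ⟨fun i => Nat.casesOn i a v', fun i => Nat.casesOn i u u', ⟨?_, ?_, ?_, ?_⟩, rfl, hn, ?_⟩
    · rintro (_ | i) (_ | j) hi' hj' hv
      · rfl
      · exact absurd (hv' j (by omega)) (by simpa [← hv] using ha)
      · exact absurd (hv' i (by omega)) (by simpa [hv] using ha)
      · simpa using hi.v_inj i j (by omega) (by omega) hv
    · rintro (_ | i) (_ | j) hi' hj' hv
      · rfl
      · exact absurd (hu' j (by omega)) (by simpa [← hv] using hu)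
      · exact absurd (hu' i (by omega)) (by simpa [hv] using hu)
      · simpa using hi.u_inj i j (by omega) (by omega) hv
    · rintro (_ | i) (_ | j) hi' hj' hv
      · exact hau hv.symm
      · exact absurd (hv' j (by omega)) (by simpa [← hv] using hu)
      · exact absurd (hu' i (by omega)) (by simpa [hv] using ha)
      · exact hi.u_ne_v i j (by omega) (by omega) hv
    · rintro (_ | i) hi'
      · simpa [h0] using hab
      · exact hi.tri i (by omega)
    · ext x
      rw [← hS]
      simp only [Finset.mem_insert, mem_seg]
      constructor
      · rintro (⟨_ | t, p, q, r⟩ | ⟨_ | t, p, q, r⟩)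
        · exact Or.inl r.symm
        · exact Or.inr (Or.inr (Or.inl ⟨t, by omega, by omega, r⟩))
        · exact Or.inr (Or.inl r.symm)
        · exact Or.inr (Or.inr (Or.inr ⟨t, by omega, by omega, r⟩))
      · rintro (rfl | rfl | ⟨t, p, q, r⟩ | ⟨t, p, q, r⟩)
        · exact Or.inl ⟨0, le_rfl, by omega, rfl⟩
        · exact Or.inr ⟨0, le_rfl, by omega, rfl⟩
        · exact Or.inl ⟨t + 1, by omega, by omega, r⟩
        · exact Or.inr ⟨t + 1, by omega, by omega, r⟩

lemma IsIdx.hasLinearPath {v u : ℕ → V} {n m : ℕ} (h : IsIdx E v u n) (hm : m ≤ n) :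
    HasLinearPath E m := by
  have key : ∀ i j : ℕ, i < j → j < m →
      (i + 1 = j → ({v i, u i, v (i + 1)} ∩ {v j, u j, v (j + 1)} : Finset V).card = 1) ∧
      (i + 1 ≠ j → ({v i, u i, v (i + 1)} ∩ {v j, u j, v (j + 1)} : Finset V) = ∅) := by
    intro i j hij hj
    have a1 := h.v_inj i j (by omega) (by omega)
    have a2 := h.v_inj i (j + 1) (by omega) (by omega)
    have a3 := h.v_inj (i + 1) j (by omega) (by omega)
    have a4 := h.v_inj (i + 1) (j + 1) (by omega) (by omega)
    have b1 := h.u_ne_v i j (by omega) (by omega)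
    have b2 := h.u_ne_v i (j + 1) (by omega) (by omega)
    have b3 := h.u_ne_v j i (by omega) (by omega)
    have b4 := h.u_ne_v j (i + 1) (by omega) (by omega)
    have c := h.u_inj i j (by omega) (by omega)
    constructor
    · rintro rfl
      rw [Finset.card_eq_one]
      refine ⟨v (i + 1), ?_⟩
      ext x
      simp only [Finset.mem_inter, Finset.mem_insert, Finset.mem_singleton]
      grind
    · intro hne
      ext x
      simp only [Finset.mem_inter, Finset.mem_insert, Finset.mem_singleton]
      grind
  have key' : ∀ i j : Fin m, i ≠ j →
      (((i : ℕ) + 1 = j ∨ (j : ℕ) + 1 = i) →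
        ({v i, u i, v (i + 1)} ∩ {v j, u j, v (j + 1)} : Finset V).card = 1) ∧
      (¬((i : ℕ) + 1 = j ∨ (j : ℕ) + 1 = i) →
        ({v i, u i, v (i + 1)} ∩ {v j, u j, v (j + 1)} : Finset V) = ∅) := by
    intro i j hij
    rcases lt_or_gt_of_ne (Fin.val_ne_of_ne hij) with hlt | hlt
    · have := key i j hlt j.2
      exact ⟨fun hh => this.1 (by omega), fun hh => this.2 (by omega)⟩
    · have := key j i hlt i.2
      rw [Finset.inter_comm]
      exact ⟨fun hh => this.1 (by omega), fun hh => this.2 (by omega)⟩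
  refine ⟨fun i => {v i, u i, v (i + 1)}, ?_, fun i => h.tri i (by omega), key'⟩
  intro i j hij
  by_contra hne
  have hk := key' i j hne
  simp only at hij
  rw [hij, Finset.inter_self] at hk
  have h1 := hk.2
  have hu : u (j : ℕ) ∈ ({v j, u j, v (j + 1)} : Finset V) := by simp
  have hu' : u (j : ℕ) ∈ ({v i, u i, v (i + 1)} : Finset V) := by rw [hij]; exact hu
  simp only [Finset.mem_insert, Finset.mem_singleton] at hu'
  have b1 := h.u_ne_v j i (by omega) (by omega)
  have b2 := h.u_ne_v j (i + 1) (by omega) (by omega)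
  have b3 := h.u_inj j i (by omega) (by omega)
  have : (j : ℕ) ≠ i := fun hh => hne (Fin.ext hh.symm)
  tauto

end LinearPath

section OneSided

variable {V : Type*} [DecidableEq V] {E : Finset (Finset V)}

/-- The number of vertices `r ∈ W` such that `{a, x, r}` is an edge. -/
def cd (E : Finset (Finset V)) (W : Finset V) (a x : V) : ℕ :=
  (W.filter fun r => ({a, x, r} : Finset V) ∈ E).card

lemma exists_of_lt_cd {W F : Finset V} {a x : V} (h : F.card < cd E W a x) :
    ∃ r ∈ W, r ∉ F ∧ Tri E a x r := by
  obtain ⟨r, hr, hrF⟩ := Finset.exists_mem_notMem_of_card_lt_card h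
  rw [Finset.mem_filter] at hr
  exact ⟨r, hr.1, hrF, hr.2⟩

/-- An indexed path which is longest among the paths in `seg v u 0 n ∪ W` with right end `v n`. -/
structure RightMax (E : Finset (Finset V)) (W : Finset V) (v u : ℕ → V) (n : ℕ) : Prop where
  idx : IsIdx E v u n
  disj : ∀ x ∈ W, x ∉ seg v u 0 n
  max : ∀ s S m, LP E s (v n) S m → (∀ x ∈ S, x ∈ seg v u 0 n ∨ x ∈ W) → m ≤ n

namespace RightMax

variable {W : Finset V} {v u : ℕ → V} {n : ℕ}

lemma swap (h : RightMax E W v u n) (hn : 1 ≤ n) :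
    RightMax E W (Function.update v 0 (u 0)) (Function.update u 0 (v 0)) n where
  idx := h.idx.swap hn
  disj := by rw [IsIdx.seg_swap v u hn]; exact h.disj
  max := by
    rw [IsIdx.seg_swap v u hn, Function.update_of_ne (by omega : n ≠ 0)]
    exact h.max

lemma not_tri (h : RightMax E W v u n) (hE : ∀ e ∈ E, e.card = 3) {r r' : V} (hr : r ∈ W)
    (hr' : r' ∈ W) : ¬ Tri E (v 0) r r' := by
  intro ht
  have h0 := h.idx.lp (Nat.zero_le n) le_rfl
  have := h.max _ _ _ (LP.cons ht.reverse h0 (h.disj _ hr') (h.disj _ hr) (ht.ne hE).2.2.symm)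
    (by simp only [Finset.mem_insert]; grind)
  omega

lemma splice (h : RightMax E W v u n) {s p m p' c a a' : V} {S₁ S₂ S₃ : Finset V} {n₁ n₂ n₃ : ℕ}
    (h₁ : LP E s p S₁ n₁) (h₂ : LP E m p' S₂ n₂) (h₃ : LP E c (v n) S₃ n₃)
    (s₁ : S₁ ⊆ seg v u 0 n) (s₂ : S₂ ⊆ seg v u 0 n) (s₃ : S₃ ⊆ seg v u 0 n)
    (d₁₂ : Disjoint S₁ S₂) (d₁₃ : Disjoint S₁ S₃) (d₂₃ : Disjoint S₂ S₃)
    (ha : a ∈ seg v u 0 n) (ha' : a' ∈ seg v u 0 n) (haa : a ≠ a')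
    (a₁ : a ∉ S₁) (a₂ : a ∉ S₂) (a₃ : a ∉ S₃) (a₁' : a' ∉ S₁) (a₂' : a' ∉ S₂) (a₃' : a' ∉ S₃)
    (c₁ : 4 ≤ cd E W a p) (c₂ : 4 ≤ cd E W a m) (c₃ : 4 ≤ cd E W a' p') (c₄ : 4 ≤ cd E W a' c) :
    n₁ + n₂ + n₃ + 4 ≤ n := by
  obtain ⟨r₁, w₁, -, t₁⟩ := exists_of_lt_cd (F := ∅) (by simp; omega : _ < cd E W a p)
  obtain ⟨r₂, w₂, f₂, t₂⟩ := exists_of_lt_cd (F := {r₁}) (by simp; omega : _ < cd E W a m)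
  obtain ⟨r₃, w₃, f₃, t₃⟩ := exists_of_lt_cd (F := {r₁, r₂})
    (by have := Finset.card_le_two (a := r₁) (b := r₂); omega : _ < cd E W a' p')
  obtain ⟨r₄, w₄, f₄, t₄⟩ := exists_of_lt_cd (F := {r₁, r₂, r₃})
    (by have := Finset.card_le_three (a := r₁) (b := r₂) (c := r₃); omega : _ < cd E W a' c)
  have q₁ := h.disj _ w₁
  have q₂ := h.disj _ w₂
  have q₃ := h.disj _ w₃
  have q₄ := h.disj _ w₄
  simp only [Finset.mem_insert, Finset.mem_singleton, not_or] at f₂ f₃ f₄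
  have g : ∀ r, r ∉ seg v u 0 n → r ∉ S₁ ∧ r ∉ S₂ ∧ r ∉ S₃ ∧ r ≠ a ∧ r ≠ a' := fun r hr =>
    ⟨fun hx => hr (s₁ hx), fun hx => hr (s₂ hx), fun hx => hr (s₃ hx), fun hx => hr (hx ▸ ha),
      fun hx => hr (hx ▸ ha')⟩
  have g₁ := g _ q₁
  have g₂ := g _ q₂
  have g₃ := g _ q₃
  have g₄ := g _ q₄
  have f₂' := Ne.symm f₂
  have f₃' := And.imp Ne.symm Ne.symm f₃
  have f₄' := And.imp Ne.symm (And.imp Ne.symm Ne.symm) f₄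
  have g₁' : a ≠ r₁ ∧ a' ≠ r₁ := And.imp Ne.symm Ne.symm g₁.2.2.2
  have g₂' : a ≠ r₂ ∧ a' ≠ r₂ := And.imp Ne.symm Ne.symm g₂.2.2.2
  have g₃' : a ≠ r₃ ∧ a' ≠ r₃ := And.imp Ne.symm Ne.symm g₃.2.2.2
  have g₄' : a ≠ r₄ ∧ a' ≠ r₄ := And.imp Ne.symm Ne.symm g₄.2.2.2
  have haa' := haa.symm
  have k₁ := (LP.nil a').join h₃ (by simpa using a₃') t₄.swap_right (by simp [g₄]) (by simp [g₄])
  have k₂ := h₂.join k₁ (by simp [*]) t₃.rotate (by simp [*]) (by simp [*])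
  have k₃ := (LP.nil a).join k₂ (by simp [*]) t₂.swap_right (by simp [*]) (by simp [*])
  have k₄ := h₁.join k₃ (by simp [*]) t₁.rotate (by simp [*]) (by simp [*])
  have := h.max _ _ _ k₄ (by
    simp only [Finset.mem_union, Finset.mem_insert, Finset.mem_singleton]
    rintro x (hx | rfl | rfl | rfl | hx | rfl | rfl | rfl | hx)
    · exact Or.inl (s₁ hx)
    · exact Or.inr w₁
    · exact Or.inl ha
    · exact Or.inr w₂
    · exact Or.inl (s₂ hx)
    · exact Or.inr w₃
    · exact Or.inl ha'
    · exact Or.inr w₄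
    · exact Or.inl (s₃ hx))
  omega

end RightMax

/-- A pattern of heavy pairs which allows `a` to be inserted into the path. -/
def Insertable (E : Finset (Finset V)) (W : Finset V) (v u : ℕ → V) (n : ℕ) (a : V) : Prop :=
  ∃ j, 1 ≤ j ∧ j < n ∧ 4 ≤ cd E W a (u j) ∧ 4 ≤ cd E W a (v (j + 1)) ∧
    (4 ≤ cd E W a (v j) ∨ (2 ≤ j ∧ 4 ≤ cd E W a (u (j - 1))))

lemma IsIdx.exists_lp_of_or {v u : ℕ → V} {n i j : ℕ} (h : IsIdx E v u n) (hij : i ≤ j)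
    (hj : j ≤ n) {P : V → Prop} (hP : P (v j) ∨ (i + 1 ≤ j ∧ P (u (j - 1)))) :
    ∃ p, P p ∧ LP E (v i) p (seg v u i j) (j - i) := by
  rcases hP with hP | ⟨hlt, hP⟩
  · exact ⟨v j, hP, h.lp hij hj⟩
  · refine ⟨u (j - 1), hP, ?_⟩
    have := h.lp_u_right (show i ≤ j - 1 by omega) (by omega)
    rwa [Nat.sub_add_cancel (by omega)] at this

namespace RightMax

variable {W : Finset V} {v u : ℕ → V} {n : ℕ}

lemma not_two_insertions_of_le (h : RightMax E W v u n) {a a' : V} (ha : a ∈ seg v u 0 n)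
    (ha' : a' ∈ seg v u 0 n) (haa : a ≠ a') (h1 : a ∉ seg v u 1 n) (h1' : a' ∉ seg v u 1 n)
    {j j' : ℕ} (hj : 1 ≤ j) (hjj : j ≤ j') (hj' : j' < n)
    (c₁ : 4 ≤ cd E W a (u j)) (c₂ : 4 ≤ cd E W a (v (j + 1)))
    (c₃ : 4 ≤ cd E W a (v j) ∨ (1 + 1 ≤ j ∧ 4 ≤ cd E W a (u (j - 1))))
    (c₁' : 4 ≤ cd E W a' (u j')) (c₂' : 4 ≤ cd E W a' (v (j' + 1)))
    (c₃' : 4 ≤ cd E W a' (v j') ∨ (1 + 1 ≤ j' ∧ 4 ≤ cd E W a' (u (j' - 1)))) : False := by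
  have hi := h.idx
  obtain ⟨p, hp, l₁⟩ := hi.exists_lp_of_or (P := fun x => 4 ≤ cd E W a x) hj (by omega) c₃
  have l₃ := hi.lp (show j' + 1 ≤ n by omega) le_rfl
  have mid : ∃ m p' S₂ n₂, LP E m p' S₂ n₂ ∧ S₂ ⊆ seg v u 1 n ∧ Disjoint (seg v u 1 j) S₂ ∧
      Disjoint S₂ (seg v u (j' + 1) n) ∧ 4 ≤ cd E W a m ∧ 4 ≤ cd E W a' p' ∧
      j' ≤ n₂ + j + 1 := by
    have huj : u j ∈ seg v u 1 n := u_mem_seg hj (by omega)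
    have huj' : u j ∉ seg v u 1 j := by rw [hi.u_mem_iff (by omega) (by omega)]; omega
    have huj'' : u j ∉ seg v u (j' + 1) n := by rw [hi.u_mem_iff (by omega) (by omega)]; omega
    rcases Nat.eq_or_lt_of_le hjj with rfl | hlt
    · exact ⟨u j, u j, _, _, LP.nil _, by simpa using huj, by simpa using huj',
        by simpa using huj'', c₁, c₁', by omega⟩
    · by_cases hs : j' = j + 1 ∧ 4 ≤ cd E W a' (u j)
      · exact ⟨u j, u j, _, _, LP.nil _, by simpa using huj, by simpa using huj',
          by simpa using huj'', c₁, hs.2, by omega⟩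
      · have c : 4 ≤ cd E W a' (v j') ∨ (j + 1 + 1 ≤ j' ∧ 4 ≤ cd E W a' (u (j' - 1))) := by
          rcases c₃' with c | ⟨-, c⟩
          · exact Or.inl c
          · refine Or.inr ⟨?_, c⟩
            by_contra hlt'
            obtain rfl : j' = j + 1 := by omega
            exact hs ⟨rfl, by simpa using c⟩
        obtain ⟨p', hp', l₂⟩ := hi.exists_lp_of_or (P := fun x => 4 ≤ cd E W a' x)
          (show j + 1 ≤ j' by omega) (by omega) c
        exact ⟨_, p', _, _, l₂, seg_subset (by omega) (by omega),
          hi.disjoint_seg (by omega) (by omega), hi.disjoint_seg (by omega) le_rfl, c₂, hp',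
          by omega⟩
  obtain ⟨m, p', S₂, n₂, l₂, s₂, d₁₂, d₂₃, cm, cp', hn₂⟩ := mid
  have s₁ : seg v u 1 j ⊆ seg v u 1 n := seg_subset le_rfl (by omega)
  have s₃ : seg v u (j' + 1) n ⊆ seg v u 1 n := seg_subset (by omega) le_rfl
  have s : seg v u 1 n ⊆ seg v u 0 n := seg_subset (by omega) le_rfl
  have := h.splice l₁ l₂ l₃ (s₁.trans s) (s₂.trans s) (s₃.trans s) d₁₂
    (hi.disjoint_seg (by omega) le_rfl) d₂₃ ha ha' haa (fun hx => h1 (s₁ hx))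
    (fun hx => h1 (s₂ hx)) (fun hx => h1 (s₃ hx)) (fun hx => h1' (s₁ hx))
    (fun hx => h1' (s₂ hx)) (fun hx => h1' (s₃ hx)) hp cm cp' c₂'
  omega

lemma not_insertable_or (h : RightMax E W v u n) (hn : 1 ≤ n) :
    ¬ Insertable E W v u n (v 0) ∨ ¬ Insertable E W v u n (u 0) := by
  by_contra! hcon
  obtain ⟨⟨j, b₁, b₂, b₃, b₄, b₅⟩, ⟨j', b₁', b₂', b₃', b₄', b₅'⟩⟩ := hcon
  have hi := h.idx
  have m₁ : v 0 ∈ seg v u 0 n := v_mem_seg le_rfl (by omega)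
  have m₂ : u 0 ∈ seg v u 0 n := u_mem_seg le_rfl (by omega)
  have m₃ : v 0 ∉ seg v u 1 n := by rw [hi.v_mem_iff le_rfl (by omega)]; omega
  have m₄ : u 0 ∉ seg v u 1 n := by rw [hi.u_mem_iff le_rfl (by omega)]; omega
  have ne := hi.u_ne_v 0 0 hn (by omega)
  rcases le_total j j' with hle | hle
  · exact h.not_two_insertions_of_le m₁ m₂ ne.symm m₃ m₄ b₁ hle b₂' b₃ b₄ b₅ b₃' b₄' b₅'
  · exact h.not_two_insertions_of_le m₂ m₁ ne m₄ m₃ b₁' hle b₂ b₃' b₄' b₅' b₃ b₄ b₅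

lemma insertable_swap {a : V} :
    Insertable E W (Function.update v 0 (u 0)) (Function.update u 0 (v 0)) n a ↔
      Insertable E W v u n a := by
  unfold Insertable
  refine exists_congr fun j => and_congr_right fun hj => ?_
  rw [Function.update_of_ne (by omega : j ≠ 0), Function.update_of_ne (by omega : j ≠ 0),
    Function.update_of_ne (by omega : j + 1 ≠ 0)]
  refine and_congr_right fun _ => and_congr_right fun _ => and_congr_right fun _ =>
    or_congr_right (and_congr_right fun hj2 => ?_)
  rw [Function.update_of_ne (by omega : j - 1 ≠ 0)]

lemma prepend_two (h : RightMax E W v u n) {x y z : V} {S : Finset V} {m : ℕ}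
    (hl : LP E z (v n) S m) (hS : S ⊆ seg v u 0 n) (hx : x ∈ seg v u 0 n) (hy : y ∈ seg v u 0 n)
    (hxS : x ∉ S) (hyS : y ∉ S) (hxy : x ≠ y) (c₁ : 2 ≤ cd E W y x) (c₂ : 2 ≤ cd E W y z) :
    m + 2 ≤ n := by
  obtain ⟨r₁, w₁, -, t₁⟩ := exists_of_lt_cd (F := ∅) (by simp; omega : _ < cd E W y x)
  obtain ⟨r₂, w₂, f₂, t₂⟩ := exists_of_lt_cd (F := {r₁}) (by simp; omega : _ < cd E W y z)
  have q₁ := h.disj _ w₁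
  have q₂ := h.disj _ w₂
  simp only [Finset.mem_singleton] at f₂
  have k₁ := (LP.nil y).join hl (by simpa using hyS) t₂.swap_right (by grind) (by grind)
  have k₂ := (LP.nil x).join k₁ (by simp; grind) t₁.rotate (by grind) (by grind)
  have := h.max _ _ _ k₂ (by grind)
  omega

lemma not_heavy_first (h : RightMax E W v u n) (hn : 1 ≤ n) (c₁ : 2 ≤ cd E W (v 0) (u 0))
    (c₂ : 2 ≤ cd E W (v 0) (v 1)) : False := by
  have hi := h.idx
  have := h.prepend_two (hi.lp hn le_rfl) (seg_subset (by omega) le_rfl)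
    (u_mem_seg le_rfl (by omega)) (v_mem_seg le_rfl (by omega))
    (by rw [hi.u_mem_iff le_rfl (by omega)]; omega)
    (by rw [hi.v_mem_iff le_rfl (by omega)]; omega) (hi.u_ne_v 0 0 hn (by omega)) c₁ c₂
  omega

lemma not_heavy_second (h : RightMax E W v u n) (hn : 2 ≤ n) (c₁ : 2 ≤ cd E W (v 0) (u 0))
    (c₂ : 2 ≤ cd E W (v 0) (u 1)) : False := by
  have hi := h.idx
  have := h.prepend_two (hi.lp_u_left (show 1 < n by omega) le_rfl)
    (seg_subset (by omega) le_rfl)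
    (u_mem_seg le_rfl (by omega)) (v_mem_seg le_rfl (by omega))
    (by rw [hi.u_mem_iff le_rfl (by omega)]; omega)
    (by rw [hi.v_mem_iff le_rfl (by omega)]; omega) (hi.u_ne_v 0 0 (by omega) (by omega)) c₁ c₂
  omega

end RightMax

lemma card_add_card_le_of_shift {A B I : Finset ℕ} (hA : A ⊆ I) (hB : B ⊆ I)
    (hB' : ∀ i, i + 1 ∈ B → i ∈ I) (h0 : ¬ (0 ∈ A ∧ 0 ∈ B))
    (hAB : ∀ j, j + 1 ∈ A → j + 1 ∈ B → j ∉ A ∧ j ∉ B) : A.card + B.card ≤ I.card := by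
  have hp : ∀ j ∈ A ∩ B, 1 ≤ j := by
    intro j hj
    rw [Finset.mem_inter] at hj
    rcases j with _ | j
    · exact absurd hj h0
    · omega
  have hc : ((A ∩ B).image (fun j => j - 1)).card = (A ∩ B).card := by
    refine Finset.card_image_of_injOn fun x hx y hy hxy => ?_
    have := hp x hx
    have := hp y hy
    omega
  have hd : Disjoint (A ∪ B) ((A ∩ B).image (fun j => j - 1)) := by
    rw [Finset.disjoint_left]
    intro x hx hx'
    rw [Finset.mem_image] at hx'
    obtain ⟨y, hy, rfl⟩ := hx'
    have h1 := hp y hy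
    obtain ⟨j, rfl⟩ : ∃ j, y = j + 1 := ⟨y - 1, by omega⟩
    rw [Finset.mem_inter] at hy
    have := hAB j hy.1 hy.2
    simp at hx
    tauto
  have hs : (A ∪ B) ∪ ((A ∩ B).image (fun j => j - 1)) ⊆ I := by
    refine Finset.union_subset (Finset.union_subset hA hB) fun x hx => ?_
    rw [Finset.mem_image] at hx
    obtain ⟨y, hy, rfl⟩ := hx
    have h1 := hp y hy
    obtain ⟨j, rfl⟩ : ∃ j, y = j + 1 := ⟨y - 1, by omega⟩
    exact hB' j (Finset.mem_inter.1 hy).2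
  have h1 := Finset.card_le_card hs
  rw [Finset.card_union_of_disjoint hd, hc] at h1
  have h2 := Finset.card_union_add_card_inter A B
  omega

/-- The edge indices near which the left end `v 0` has a neighbour of codegree at least two. -/
def leftIdx (E : Finset (Finset V)) (W : Finset V) (v u : ℕ → V) (n : ℕ) : Finset ℕ :=
  (Finset.range n).filter fun i => 2 ≤ cd E W (v 0) (u i) ∨ 2 ≤ cd E W (v 0) (v (i + 1)) ∨
    (i + 1 < n ∧ 2 ≤ cd E W (v 0) (u (i + 1)))

lemma erase_seg_subset (v u : ℕ → V) (n : ℕ) {x : V} (hx : x ∈ (seg v u 0 n).erase (v 0)) :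
    ∃ i < n, x = v (i + 1) ∨ x = u i := by
  rw [Finset.mem_erase, mem_seg] at hx
  obtain ⟨hne, ⟨t, -, b, rfl⟩ | ⟨t, -, b, rfl⟩⟩ := hx
  · rcases t with _ | t
    · exact absurd rfl hne
    · exact ⟨t, by omega, Or.inl rfl⟩
  · exact ⟨t, b, Or.inr rfl⟩

lemma card_heavy_le (E : Finset (Finset V)) (W : Finset V) (v u : ℕ → V) (n : ℕ) :
    (((seg v u 0 n).erase (v 0)).filter fun x => 2 ≤ cd E W (v 0) x).card ≤
      2 * (leftIdx E W v u n).card := by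
  have : (((seg v u 0 n).erase (v 0)).filter fun x => 2 ≤ cd E W (v 0) x) ⊆
      (leftIdx E W v u n).image (fun i => v (i + 1)) ∪ (leftIdx E W v u n).image u := by
    intro x hx
    rw [Finset.mem_filter] at hx
    obtain ⟨i, hi, rfl | rfl⟩ := erase_seg_subset v u n hx.1
    · refine Finset.mem_union_left _ (Finset.mem_image_of_mem (fun i => v (i + 1)) ?_)
      simp [leftIdx, hi, hx.2]
    · refine Finset.mem_union_right _ (Finset.mem_image_of_mem u ?_)
      simp [leftIdx, hi, hx.2]
  refine (Finset.card_le_card this).trans ((Finset.card_union_le _ _).trans ?_)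
  have h1 := Finset.card_image_le (s := leftIdx E W v u n) (f := fun i => v (i + 1))
  have h2 := Finset.card_image_le (s := leftIdx E W v u n) (f := u)
  omega

lemma RightMax.card_very_heavy_le {W : Finset V} {v u : ℕ → V} {n : ℕ} (h : RightMax E W v u n)
    (hins : ¬ Insertable E W v u n (v 0)) :
    (((seg v u 0 n).erase (v 0)).filter fun x => 4 ≤ cd E W (v 0) x).card ≤
      (leftIdx E W v u n).card := by
  set A := (Finset.range n).filter fun i => 4 ≤ cd E W (v 0) (v (i + 1)) with hA
  set B := (Finset.range n).filter fun i => 4 ≤ cd E W (v 0) (u i) with hB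
  have hmA : ∀ i, i ∈ A ↔ i < n ∧ 4 ≤ cd E W (v 0) (v (i + 1)) := by simp [hA]
  have hmB : ∀ i, i ∈ B ↔ i < n ∧ 4 ≤ cd E W (v 0) (u i) := by simp [hB]
  have key : A.card + B.card ≤ (leftIdx E W v u n).card := by
    refine card_add_card_le_of_shift ?_ ?_ ?_ ?_ ?_
    · intro i hi
      rw [hmA] at hi
      simp only [leftIdx, Finset.mem_filter, Finset.mem_range]
      exact ⟨hi.1, Or.inr (Or.inl (by omega))⟩
    · intro i hi
      rw [hmB] at hi
      simp only [leftIdx, Finset.mem_filter, Finset.mem_range]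
      exact ⟨hi.1, Or.inl (by omega)⟩
    · intro i hi
      rw [hmB] at hi
      simp only [leftIdx, Finset.mem_filter, Finset.mem_range]
      exact ⟨by omega, Or.inr (Or.inr ⟨by omega, by omega⟩)⟩
    · rw [hmA, hmB]
      rintro ⟨⟨h1, h2⟩, -, h3⟩
      exact h.not_heavy_first (by omega) (by omega) (le_trans (by norm_num : 2 ≤ 4) h2)
    · intro j h1 h2
      rw [hmA] at h1
      rw [hmB] at h2
      rw [hmA, hmB]
      constructor
      · rintro ⟨-, h3⟩
        exact hins ⟨j + 1, by omega, h1.1, h2.2, h1.2, Or.inl h3⟩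
      · rintro ⟨-, h3⟩
        rcases j with _ | j
        · exact h.not_heavy_second (by omega) (by omega) (le_trans (by norm_num : 2 ≤ 4) h2.2)
        · exact hins ⟨j + 1 + 1, by omega, h1.1, h2.2, h1.2, Or.inr ⟨by omega, by simpa using h3⟩⟩
  have : (((seg v u 0 n).erase (v 0)).filter fun x => 4 ≤ cd E W (v 0) x) ⊆
      A.image (fun i => v (i + 1)) ∪ B.image u := by
    intro x hx
    rw [Finset.mem_filter] at hx
    obtain ⟨i, hi, rfl | rfl⟩ := erase_seg_subset v u n hx.1
    · exact Finset.mem_union_left _ (Finset.mem_image_of_mem (fun i => v (i + 1))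
        ((hmA i).2 ⟨hi, hx.2⟩))
    · exact Finset.mem_union_right _ (Finset.mem_image_of_mem u ((hmB i).2 ⟨hi, hx.2⟩))
  refine (Finset.card_le_card this).trans ((Finset.card_union_le _ _).trans ?_)
  have h1 := Finset.card_image_le (s := A) (f := fun i => v (i + 1))
  have h2 := Finset.card_image_le (s := B) (f := u)
  omega

/-- Edges at `a` inside `P ∪ W`, when no edge at `a` has its other two vertices in `W`. -/
lemma card_edges_le {P W : Finset V} {a : V} (hE : ∀ e ∈ E, e.card = 3) (ha : a ∈ P)
    (hW : ∀ r ∈ W, ∀ r' ∈ W, ¬ Tri E a r r') :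
    (E.filter fun e => a ∈ e ∧ e ⊆ P ∪ W).card ≤
      (P.card - 1).choose 2 + ∑ x ∈ P.erase a, cd E W a x := by
  have hsub : (E.filter fun e => a ∈ e ∧ e ⊆ P ∪ W) ⊆
      ((P.erase a).powersetCard 2).image (insert a) ∪ (P.erase a).biUnion fun x =>
        (W.filter fun r => ({a, x, r} : Finset V) ∈ E).image fun r => {a, x, r} := by
    intro e he
    rw [Finset.mem_filter] at he
    obtain ⟨heE, hae, heU⟩ := he
    have h2 : (e.erase a).card = 2 := by rw [Finset.card_erase_of_mem hae, hE e heE]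
    obtain ⟨x, y, hxy, hexy⟩ := Finset.card_eq_two.1 h2
    have hee : e = {a, x, y} := by rw [← hexy, Finset.insert_erase hae]
    have hne := Tri.ne hE (show Tri E a x y by unfold Tri; rwa [← hee])
    have hx : x ∈ P ∪ W := heU (by simp [hee])
    have hy : y ∈ P ∪ W := heU (by simp [hee])
    rw [Finset.mem_union] at hx hy
    have htri : Tri E a x y := by unfold Tri; rwa [← hee]
    rw [Finset.mem_union, Finset.mem_image, Finset.mem_biUnion]
    rcases hx with hx | hx
    · rcases hy with hy | hy
      · left
        refine ⟨{x, y}, ?_, hee.symm⟩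
        rw [Finset.mem_powersetCard]
        refine ⟨?_, Finset.card_pair hxy⟩
        intro z hz
        simp only [Finset.mem_insert, Finset.mem_singleton] at hz
        rw [Finset.mem_erase]
        grind
      · right
        refine ⟨x, Finset.mem_erase.2 ⟨hne.1.symm, hx⟩, ?_⟩
        rw [Finset.mem_image]
        exact ⟨y, Finset.mem_filter.2 ⟨hy, htri⟩, hee.symm⟩
    · rcases hy with hy | hy
      · right
        refine ⟨y, Finset.mem_erase.2 ⟨hne.2.1.symm, hy⟩, ?_⟩
        rw [Finset.mem_image]
        exact ⟨x, Finset.mem_filter.2 ⟨hx, htri.swap_right⟩, by rw [hee, Finset.pair_comm]⟩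
      · exact absurd htri (hW x hx y hy)
  refine (Finset.card_le_card hsub).trans ((Finset.card_union_le _ _).trans ?_)
  refine Nat.add_le_add ?_ ?_
  · refine Finset.card_image_le.trans ?_
    rw [Finset.card_powersetCard, Finset.card_erase_of_mem ha]
  · refine Finset.card_biUnion_le.trans (Finset.sum_le_sum fun x _ => ?_)
    exact Finset.card_image_le

lemma sum_cd_le (E : Finset (Finset V)) (W Q : Finset V) (a : V) :
    ∑ x ∈ Q, cd E W a x ≤ Q.card + 2 * (Q.filter fun x => 2 ≤ cd E W a x).card +
      (W.card - 3) * (Q.filter fun x => 4 ≤ cd E W a x).card := by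
  have h1 : ∀ x ∈ Q, cd E W a x ≤ 1 + 2 * (if 2 ≤ cd E W a x then 1 else 0) +
      (W.card - 3) * (if 4 ≤ cd E W a x then 1 else 0) := by
    intro x _
    have : cd E W a x ≤ W.card := Finset.card_filter_le _ _
    split_ifs <;> omega
  refine (Finset.sum_le_sum h1).trans (le_of_eq ?_)
  rw [Finset.sum_add_distrib, Finset.sum_add_distrib, ← Finset.mul_sum, ← Finset.mul_sum,
    Finset.card_filter, Finset.card_filter]
  simp

lemma RightMax.card_edges_le {W : Finset V} {v u : ℕ → V} {n : ℕ} (h : RightMax E W v u n)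
    (hE : ∀ e ∈ E, e.card = 3) (hins : ¬ Insertable E W v u n (v 0)) {K : ℕ}
    (hK : (leftIdx E W v u n).card ≤ K) :
    (E.filter fun e => v 0 ∈ e ∧ e ⊆ seg v u 0 n ∪ W).card ≤
      (2 * n).choose 2 + (2 * n + 4 * K + (W.card - 3) * K) := by
  have h0 : v 0 ∈ seg v u 0 n := v_mem_seg le_rfl (by omega)
  have h1 := _root_.card_edges_le hE h0
    (fun r hr r' hr' => h.not_tri hE hr hr')
  have h2 := sum_cd_le E W ((seg v u 0 n).erase (v 0)) (v 0)
  have h3 := card_heavy_le E W v u n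
  have h4 := h.card_very_heavy_le hins
  have h5 := Nat.mul_le_mul_left (W.card - 3) (h4.trans hK)
  rw [Finset.card_erase_of_mem h0, h.idx.card_seg] at h2
  rw [h.idx.card_seg] at h1
  simp only [Nat.add_sub_cancel] at h1 h2
  omega

end OneSided

section Cycle

variable {V : Type*} [DecidableEq V] {E : Finset (Finset V)}

lemma LP.exists_join_join {a p c d e f b b' : V} {S T U : Finset V} {l m n : ℕ}
    (h₁ : LP E a p S l) (h₂ : LP E c d T m) (h₃ : LP E e f U n) (hST : Disjoint S T)
    (hSU : Disjoint S U) (hTU : Disjoint T U) (ht : Tri E p b c) (ht' : Tri E d b' e)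
    (hbS : b ∉ S) (hbT : b ∉ T) (hbU : b ∉ U) (hbS' : b' ∉ S) (hbT' : b' ∉ T) (hbU' : b' ∉ U)
    (hbb : b ≠ b') : ∃ X, LP E a f X (l + m + n + 2) := by
  have h := (h₁.join h₂ hST ht hbS hbT).join h₃ (by simp [*]) ht'
    (by simp [*, hbb.symm]) hbU'
  exact ⟨_, by simpa [add_assoc, add_comm, add_left_comm] using h⟩

namespace IsIdx

variable {v u : ℕ → V} {n : ℕ}

lemma exists_lp_of_cycle (h : IsIdx E v u n) {b c : V} (hn : 1 ≤ n) (hb : b ∉ seg v u 0 n)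
    (ht : Tri E (v 0) b (v n)) (hc : c ∈ insert b (seg v u 0 n)) :
    ∃ z S, LP E c z S n ∧ S ⊆ insert b (seg v u 0 n) := by
  have key : ∀ i ≤ n, LP E c (v n) (seg v u i n) (n - i) →
      ∃ z S, LP E c z S n ∧ S ⊆ insert b (seg v u 0 n) := by
    intro i hi hl
    rcases i with _ | i
    · exact ⟨_, _, hl, Finset.subset_insert _ _⟩
    · have s₁ : seg v u (i + 1) n ⊆ seg v u 0 n := seg_subset (by omega) le_rfl
      have s₂ : seg v u 0 i ⊆ seg v u 0 n := seg_subset le_rfl (by omega)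
      have := hl.join (h.lp (Nat.zero_le i) (by omega)) (h.disjoint_seg (by omega) le_rfl).symm
        ht.reverse (fun hx => hb (s₁ hx)) (fun hx => hb (s₂ hx))
      refine ⟨_, _, by convert this using 1; omega, ?_⟩
      exact Finset.union_subset (s₁.trans (Finset.subset_insert _ _))
        (Finset.insert_subset_insert _ s₂)
  rw [Finset.mem_insert, mem_seg] at hc
  rcases hc with rfl | ⟨i, -, hi, rfl⟩ | ⟨i, -, hi, rfl⟩
  · have s₂ : seg v u 0 (n - 1) ⊆ seg v u 0 n := seg_subset le_rfl (by omega)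
    have hvn : v n ∈ seg v u 0 n := v_mem_seg (by omega) le_rfl
    have := LP.cons ht.rotate (h.lp (Nat.zero_le (n - 1)) (by omega)) (fun hx => hb (s₂ hx))
      (by rw [h.v_mem_iff (by omega) le_rfl]; omega) (fun hx => hb (hx ▸ hvn))
    refine ⟨_, _, by convert this using 1; omega, ?_⟩
    exact Finset.insert_subset_insert _ (Finset.insert_subset hvn s₂)
  · exact key i hi (h.lp hi le_rfl)
  · exact key i hi.le (h.lp_u_left hi le_rfl)

lemma exists_lp_of_chord (h : IsIdx E v u n) {b c w : V} (hn : 1 ≤ n) (hb : b ∉ seg v u 0 n)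
    (ht : Tri E (v 0) b (v n)) (hc : c ∈ seg v u 0 n) (hc0 : c ≠ v 0) (hw : Tri E (v 0) c w) :
    ∃ x y z S m, Tri E x y w ∧ LP E x z S m ∧ S ⊆ insert b (seg v u 0 n) ∧ y ∉ S ∧
      y ∈ insert b (seg v u 0 n) ∧ n ≤ 2 * m + 1 := by
  have s : ∀ i j, j ≤ n → seg v u i j ⊆ insert b (seg v u 0 n) := fun i j hj =>
    (seg_subset (Nat.zero_le i) hj).trans (Finset.subset_insert _ _)
  have h0 : v 0 ∈ insert b (seg v u 0 n) :=
    Finset.mem_insert_of_mem (v_mem_seg le_rfl (Nat.zero_le n))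
  have hc' : c ∈ insert b (seg v u 0 n) := Finset.mem_insert_of_mem hc
  rw [mem_seg] at hc
  rcases hc with ⟨j, -, hj, rfl⟩ | ⟨j, -, hj, rfl⟩
  · rcases j with _ | j
    · exact absurd rfl hc0
    · by_cases hlt : n ≤ 2 * j + 1
      · refine ⟨_, _, _, _, _, hw, h.lp (Nat.zero_le j) (by omega), s _ _ (by omega), ?_, hc',
          by omega⟩
        rw [h.v_mem_iff (by omega) hj]; omega
      · refine ⟨_, _, _, _, _, hw.swap_left, h.lp hj le_rfl, s _ _ le_rfl, ?_, h0, by omega⟩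
        rw [h.v_mem_iff le_rfl (by omega)]; omega
  · rcases j with _ | j
    · have s₁ : seg v u 1 n ⊆ seg v u 0 n := seg_subset (by omega) le_rfl
      have := (LP.nil (v 0)).join (h.lp hn le_rfl).symm (T := seg v u 1 n)
        (by rw [Finset.disjoint_singleton_left, h.v_mem_iff le_rfl (by omega)]; omega) ht
        (by rintro hx; rw [Finset.mem_singleton] at hx; exact hb (hx ▸ v_mem_seg le_rfl (by omega)))
        (fun hx => hb (s₁ hx))
      refine ⟨_, _, _, _, _, hw, this, ?_, ?_, hc', by omega⟩
      · exact Finset.union_subset (Finset.singleton_subset_iff.2 h0)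
          (Finset.insert_subset_insert _ s₁)
      · simp only [Finset.mem_union, Finset.mem_singleton, Finset.mem_insert, not_or,
          h.u_mem_iff le_rfl hj]
        exact ⟨hc0, fun hx => hb (hx ▸ u_mem_seg le_rfl (by omega)), by omega⟩
    · by_cases hlt : n ≤ 2 * (j + 1) + 1
      · refine ⟨_, _, _, _, _, hw, h.lp (Nat.zero_le (j + 1)) (by omega), s _ _ (by omega), ?_, hc',
          by omega⟩
        rw [h.u_mem_iff (by omega) hj]; omega
      · refine ⟨_, _, _, _, _, hw.swap_left, h.lp_u_left hj le_rfl, s _ _ le_rfl, ?_, h0, by omega⟩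
        rw [h.v_mem_iff le_rfl (by omega)]; omega

/-- If the ends of a longest path close up to no cycle, then their heavy neighbours do not
interlace. -/
lemma not_crossing (h : IsIdx E v u n) (hM : ∀ a z S m, LP E a z S m → m ≤ n)
    (hcyc : ∀ a z S b, LP E a z S n → b ∉ S → ¬ Tri E a b z) {W : Finset V}
    (hW : ∀ x ∈ W, x ∉ seg v u 0 n) {i : ℕ} (hi : i < n) {x y : V}
    (hx : x = u i ∨ LP E x (v n) (seg v u (i + 1) n) (n - (i + 1)))
    (hy : y = u i ∨ LP E (v 0) y (seg v u 0 i) i)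
    (cx : 2 ≤ cd E W (v 0) x) (cy : 2 ≤ cd E W (v n) y) : False := by
  obtain ⟨b, wb, -, tb⟩ := exists_of_lt_cd (F := ∅) (by simp; omega : _ < cd E W (v 0) x)
  obtain ⟨b', wb', fb, tb'⟩ := exists_of_lt_cd (F := {b}) (by simp; omega : _ < cd E W (v n) y)
  rw [Finset.mem_singleton] at fb
  have hb := hW b wb
  have hb' := hW b' wb'
  have s₁ : seg v u (i + 1) n ⊆ seg v u 0 n := seg_subset (by omega) le_rfl
  have s₂ : seg v u 0 i ⊆ seg v u 0 n := seg_subset le_rfl (by omega)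
  have hu : u i ∈ seg v u 0 n := u_mem_seg (by omega) hi
  have d : Disjoint (seg v u 0 i) (seg v u (i + 1) n) := h.disjoint_seg (by omega) le_rfl
  have d₁ : Disjoint (seg v u 0 i) {u i} := by
    rw [Finset.disjoint_singleton_right, h.u_mem_iff (by omega) hi]; omega
  have d₂ : Disjoint {u i} (seg v u (i + 1) n) := by
    rw [Finset.disjoint_singleton_left, h.u_mem_iff le_rfl hi]; omega
  have b₁ : b ∉ seg v u (i + 1) n := fun hx => hb (s₁ hx)
  have b₂ : b ∉ seg v u 0 i := fun hx => hb (s₂ hx)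
  have b₃ : b ∉ ({u i} : Finset V) := fun hx => hb (Finset.mem_singleton.1 hx ▸ hu)
  have b₁' : b' ∉ seg v u (i + 1) n := fun hx => hb' (s₁ hx)
  have b₂' : b' ∉ seg v u 0 i := fun hx => hb' (s₂ hx)
  have b₃' : b' ∉ ({u i} : Finset V) := fun hx => hb' (Finset.mem_singleton.1 hx ▸ hu)
  have l := h.lp (Nat.zero_le i) hi.le
  have r := h.lp (show i + 1 ≤ n from hi) le_rfl
  rcases hx with rfl | hx
  · rcases hy with rfl | hy
    · obtain ⟨X, hX⟩ := l.symm.exists_join_join (LP.nil (u i)) r.symm d₁ d d₂ tb.swap_right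
        tb'.rotate b₂ b₃ b₁ b₂' b₃' b₁' (Ne.symm fb)
      have := hM _ _ _ _ hX
      omega
    · obtain ⟨X, hX⟩ := (LP.nil (u i)).exists_join_join hy r.symm d₁.symm d₂ d
        tb.rotate tb'.rotate b₃ b₂ b₁ b₃' b₂' b₁' (Ne.symm fb)
      have := hM _ _ _ _ hX
      omega
  · rcases hy with rfl | hy
    · obtain ⟨X, hX⟩ := l.symm.exists_join_join hx (LP.nil (u i)) d d₁ d₂.symm tb.swap_right
        tb'.swap_right b₂ b₁ b₃ b₂' b₁' b₃' (Ne.symm fb)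
      have := hM _ _ _ _ hX
      omega
    · have := hy.symm.join hx d tb.swap_right b₂ b₁
      refine hcyc _ _ _ b' (by convert this using 1; omega) ?_ tb'.rotate
      simp [*]

end IsIdx

end Cycle

section Degree

variable {V : Type*} [DecidableEq V] {E : Finset (Finset V)}

lemma exists_rightMax (E : Finset (Finset V)) {R : Finset V} {w : V} (hw : w ∈ R) :
    ∃ v u n, RightMax E (R \ seg v u 0 n) v u n ∧ v n = w ∧ seg v u 0 n ⊆ R := by
  classical
  let P : ℕ → Prop := fun n => ∃ s S, LP E s w S n ∧ S ⊆ R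
  have hb : ∀ n, P n → n ≤ R.card := by
    rintro n ⟨s, S, hl, hS⟩
    have := hl.card
    have := Finset.card_le_card hS
    omega
  have h0 : P 0 := ⟨w, {w}, LP.nil w, Finset.singleton_subset_iff.2 hw⟩
  obtain ⟨s, S, hl, hS⟩ : P (Nat.findGreatest P R.card) := Nat.findGreatest_spec (Nat.zero_le _) h0
  obtain ⟨v, u, hi, -, hvn, rfl⟩ := hl.exists_isIdx
  refine ⟨v, u, _, ⟨hi, fun x hx => (Finset.mem_sdiff.1 hx).2, ?_⟩, hvn, hS⟩
  intro s' S' m hl' hS'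
  have hP : P m := ⟨s', S', hvn ▸ hl', fun x hx => (hS' x hx).elim (fun h => hS h)
    fun h => (Finset.mem_sdiff.1 h).1⟩
  exact Nat.le_findGreatest (hb m hP) hP

lemma RightMax.exists_not_insertable {W : Finset V} {v u : ℕ → V} {n : ℕ}
    (h : RightMax E W v u n) : ∃ v' u', RightMax E W v' u' n ∧ seg v' u' 0 n = seg v u 0 n ∧
      v' n = v n ∧ ¬ Insertable E W v' u' n (v' 0) := by
  rcases Nat.eq_zero_or_pos n with rfl | hn
  · exact ⟨v, u, h, rfl, rfl, fun ⟨j, h1, h2, _⟩ => by omega⟩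
  · rcases h.not_insertable_or hn with hi | hi
    · exact ⟨v, u, h, rfl, rfl, hi⟩
    · exact ⟨_, _, h.swap hn, IsIdx.seg_swap v u hn, Function.update_of_ne (by omega) _ _,
        by rwa [insertable_swap, Function.update_self]⟩

lemma Insertable.congr {W : Finset V} {v u v' u' : ℕ → V} {n : ℕ} {a : V}
    (hv : ∀ i ≤ n, v' i = v i) (hu : ∀ i < n, u' i = u i) (h : Insertable E W v' u' n a) :
    Insertable E W v u n a := by
  obtain ⟨j, h1, h2, c1, c2, c3⟩ := h
  rw [hu j h2] at c1
  rw [hv (j + 1) h2] at c2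
  rw [hv j h2.le, hu (j - 1) (by omega)] at c3
  exact ⟨j, h1, h2, c1, c2, c3⟩

lemma Insertable.of_right_swap {W : Finset V} {v u v' u' : ℕ → V} {n : ℕ} {a : V}
    (hv : ∀ i < n, v' i = v i) (hvn : v' n = u (n - 1)) (hu : ∀ i < n - 1, u' i = u i)
    (hun : u' (n - 1) = v n) (h : Insertable E W v' u' n a) : Insertable E W v u n a := by
  obtain ⟨j, h1, h2, c1, c2, c3⟩ := h
  rw [hv j h2, hu (j - 1) (by omega)] at c3
  by_cases hj : n = j + 1
  · subst hj
    rw [Nat.add_sub_cancel] at hvn hun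
    exact ⟨j, h1, h2, hvn ▸ c2, hun ▸ c1, c3⟩
  · rw [hu j (by omega)] at c1
    rw [hv (j + 1) (by omega)] at c2
    exact ⟨j, h1, h2, c1, c2, c3⟩

lemma hdegree_le_add (R : Finset V) (z : V) : hdegree E z ≤
    (E.filter fun e => z ∈ e ∧ e ⊆ R).card + (E.filter fun e => z ∈ e ∧ ¬ e ⊆ R).card := by
  refine (Finset.card_le_card ?_).trans (Finset.card_union_le _ _)
  intro e he
  simp only [Finset.mem_filter, Finset.mem_union] at he ⊢
  tauto

lemma choose_two_add_self (m : ℕ) : (2 * m).choose 2 + m = 2 * m ^ 2 := by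
  induction m with
  | zero => rfl
  | succ m ih =>
    rw [show 2 * (m + 1) = 2 * m + 1 + 1 by ring, Nat.choose_succ_succ' _ 1, Nat.choose_succ_succ' _ 1]
    simp only [Nat.choose_one_right, Nat.reduceAdd]
    linarith

lemma choose_two_odd (m : ℕ) : (2 * m + 1).choose 2 = m * (2 * m + 1) := by
  have := choose_two_add_self m
  rw [Nat.choose_succ_succ']
  simp only [Nat.choose_one_right, Nat.reduceAdd]
  linarith

lemma choose_two_even (m : ℕ) : (2 * m + 2).choose 2 = (m + 1) * (2 * m + 1) := by
  have := choose_two_odd m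
  rw [Nat.choose_succ_succ']
  simp only [Nat.choose_one_right, Nat.reduceAdd]
  linarith

/-- Edges at a vertex outside `C` meeting `C`, all of whose other vertices lie in `C`, when three
pairs from `C` are excluded. -/
lemma card_edges_not_subset_le [Fintype V] {C : Finset V} {z b x₁ x₂ x₃ : V}
    (hE : ∀ e ∈ E, e.card = 3) (hC : ∀ c ∈ C, ∀ r ∉ C, ∀ r' ∉ C, ¬ Tri E c r r')
    (hz : z ∉ C) (hb : b ∈ C) (h₁ : x₁ ∈ C) (h₂ : x₂ ∈ C) (h₃ : x₃ ∈ C) (hb₁ : b ≠ x₁)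
    (hb₂ : b ≠ x₂) (hb₃ : b ≠ x₃) (h₁₂ : x₁ ≠ x₂) (h₁₃ : x₁ ≠ x₃) (h₂₃ : x₂ ≠ x₃)
    (n₁ : ¬ Tri E x₁ b z) (n₂ : ¬ Tri E x₂ b z) (n₃ : ¬ Tri E x₃ b z) :
    (E.filter fun e => z ∈ e ∧ ¬ e ⊆ Finset.univ \ C).card + 3 ≤ C.card.choose 2 := by
  have hp : ∀ x y : V, x ≠ y → b ≠ x → b ≠ y → ({b, x} : Finset V) ≠ {b, y} := by
    intro x y hxy hx hy heq
    have : x ∈ ({b, y} : Finset V) := heq ▸ (by simp)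
    simp only [Finset.mem_insert, Finset.mem_singleton] at this
    exact this.elim (fun h => hx h.symm) hxy
  have hX : ({{b, x₁}, {b, x₂}, {b, x₃}} : Finset (Finset V)) ⊆ C.powersetCard 2 := by
    intro s hs
    simp only [Finset.mem_insert, Finset.mem_singleton] at hs
    rw [Finset.mem_powersetCard]
    rcases hs with rfl | rfl | rfl
    · exact ⟨by simp [Finset.insert_subset_iff, *], Finset.card_pair hb₁⟩
    · exact ⟨by simp [Finset.insert_subset_iff, *], Finset.card_pair hb₂⟩
    · exact ⟨by simp [Finset.insert_subset_iff, *], Finset.card_pair hb₃⟩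
  have hX3 : ({{b, x₁}, {b, x₂}, {b, x₃}} : Finset (Finset V)).card = 3 :=
    Finset.card_eq_three.2 ⟨_, _, _, hp _ _ h₁₂ hb₁ hb₂, hp _ _ h₁₃ hb₁ hb₃, hp _ _ h₂₃ hb₂ hb₃, rfl⟩
  have hsub : (E.filter fun e => z ∈ e ∧ ¬ e ⊆ Finset.univ \ C) ⊆
      (C.powersetCard 2 \ {{b, x₁}, {b, x₂}, {b, x₃}}).image (insert z) := by
    intro e he
    rw [Finset.mem_filter] at he
    obtain ⟨heE, hze, heU⟩ := he
    have h2 : (e.erase z).card = 2 := by rw [Finset.card_erase_of_mem hze, hE e heE]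
    have hin : insert z (e.erase z) = e := Finset.insert_erase hze
    obtain ⟨c, hce, hcC⟩ : ∃ c ∈ e, c ∈ C := by
      by_contra! hcon
      exact heU fun x hx => by simpa using hcon x hx
    have hcz : c ≠ z := fun h => hz (h ▸ hcC)
    rw [Finset.mem_image]
    refine ⟨e.erase z, ?_, hin⟩
    rw [Finset.mem_sdiff, Finset.mem_powersetCard]
    refine ⟨⟨?_, h2⟩, ?_⟩
    · intro y hy
      by_contra hyC
      have hcy : c ≠ y := fun h => hyC (h ▸ hcC)
      have hyz : y ≠ z := (Finset.mem_erase.1 hy).1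
      refine hC c hcC z hz y hyC ?_
      have : ({c, z, y} : Finset V) = e := by
        refine Finset.eq_of_subset_of_card_le ?_ ?_
        · simp [Finset.insert_subset_iff, hce, hze, (Finset.mem_erase.1 hy).2]
        · rw [hE e heE, Finset.card_eq_three.2 ⟨c, z, y, hcz, hcy, hyz.symm, rfl⟩]
      unfold Tri
      rwa [this]
    · have hT : ∀ x, e.erase z = {b, x} → Tri E x b z := by
        intro x hx
        have : Tri E z b x := by unfold Tri; rwa [← hx, hin]
        exact this.reverse
      simp only [Finset.mem_insert, Finset.mem_singleton]
      rintro (h | h | h)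
      exacts [n₁ (hT _ h), n₂ (hT _ h), n₃ (hT _ h)]
  have := (Finset.card_le_card hsub).trans Finset.card_image_le
  rw [Finset.card_sdiff_of_subset hX, hX3, Finset.card_powersetCard] at this
  have := Finset.card_le_card hX
  rw [hX3, Finset.card_powersetCard] at this
  omega

end Degree

section Main

variable {V : Type*} [Fintype V] [DecidableEq V] {E : Finset (Finset V)}

lemma IsIdx.rightMax {v u : ℕ → V} {n : ℕ} (h : IsIdx E v u n)
    (hM : ∀ a z S m, LP E a z S m → m ≤ n) :
    RightMax E (Finset.univ \ seg v u 0 n) v u n :=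
  ⟨h, fun _ hx => (Finset.mem_sdiff.1 hx).2, fun _ _ _ hl _ => hM _ _ _ _ hl⟩

lemma hdegree_eq_filter_subset {P : Finset V} (v : V) :
    hdegree E v = (E.filter fun e => v ∈ e ∧ e ⊆ P ∪ (Finset.univ \ P)).card := by
  rw [Finset.union_sdiff_of_subset (Finset.subset_univ P)]
  simp [hdegree]

lemma degree_bound_of_cycle {k n l q M D A B : ℕ} (hn : 4 * k + 21 ≤ n) (hl : l ≤ 2 * k + 1)
    (hq : q ≤ k) (hM : M + (2 * q + 1) + (2 * l + 2) = n)
    (hD : k * n + 6 * k ^ 2 + 7 * k + 6 ≤ D) (hDAB : D ≤ A + B)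
    (hA : A ≤ (2 * q).choose 2 + (2 * q + 4 * q + (M - 3) * q))
    (hB : B + 3 ≤ (2 * l + 2).choose 2) : False := by
  have h1 := choose_two_add_self q
  rw [choose_two_even] at hB
  rcases le_total 3 M with h3 | h3
  · obtain ⟨m, rfl⟩ := Nat.exists_eq_add_of_le h3
    rw [Nat.add_sub_cancel_left] at hA
    subst hM
    zify at *
    nlinarith [mul_nonneg (sub_nonneg.2 hq) (by positivity : (0 : ℤ) ≤ m + 2 * q + 5),
      mul_nonneg (sub_nonneg.2 hl) (by positivity : (0 : ℤ) ≤ 2 * l + 2 * k + 5),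
      sq_nonneg ((k : ℤ) - 1)]
  · rw [Nat.sub_eq_zero_of_le h3] at hA
    nlinarith

lemma degree_bound_of_path {k n l W D : ℕ} (hn : 4 * k + 21 ≤ n) (hl : l ≤ 2 * k + 1)
    (hW : W + (2 * l + 1) = n) (hD : k * n + 6 * k ^ 2 + 7 * k + 6 ≤ D)
    (hA : D ≤ (2 * l).choose 2 + (2 * l + 4 * k + (W - 3) * k)) : False := by
  have h1 := choose_two_add_self l
  obtain ⟨m, rfl⟩ := Nat.exists_eq_add_of_le (show 3 ≤ W by omega)
  rw [Nat.add_sub_cancel_left] at hA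
  subst hW
  zify at *
  nlinarith [mul_nonneg (sub_nonneg.2 hl) (by positivity : (0 : ℤ) ≤ 2 * l + 2 * k + 3),
    sq_nonneg ((k : ℤ) - 1)]

/-- In a 3-graph of large minimum degree, a longest path of length at most `2k + 1` does not close
up to a cycle. -/
lemma IsIdx.not_tri_ends {k n l : ℕ} {v u : ℕ → V} (h : IsIdx E v u l)
    (hM : ∀ a z S m, LP E a z S m → m ≤ l) (hn : 4 * k + 21 ≤ n) (hV : Fintype.card V = n)
    (hE : ∀ e ∈ E, e.card = 3) (hdeg : ∀ v : V, k * n + 6 * k ^ 2 + 7 * k + 6 ≤ hdegree E v)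
    (hl : 1 ≤ l) (hlk : l ≤ 2 * k + 1) {b : V} (hb : b ∉ seg v u 0 l) :
    ¬ Tri E (v 0) b (v l) := by
  intro ht
  set P := seg v u 0 l with hP
  set C := insert b P with hC
  have hbC : b ∈ C := Finset.mem_insert_self _ _
  have hPC : P ⊆ C := Finset.subset_insert _ _
  have hC2 : C.card = 2 * l + 2 := by
    rw [hC, Finset.card_insert_of_notMem hb, h.card_seg]
  have hCR : ∀ c ∈ C, ∀ r ∉ C, ∀ r' ∉ C, ¬ Tri E c r r' := by
    intro c hc r hr r' hr' htri
    obtain ⟨z, S, hl', hS⟩ := h.exists_lp_of_cycle hl hb ht hc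
    have := hM _ _ _ _ (LP.cons htri.reverse hl' (fun hx => hr' (hS hx)) (fun hx => hr (hS hx))
      (htri.ne hE).2.2.symm)
    omega
  have hRM := h.rightMax hM
  have h0P : v 0 ∈ P := v_mem_seg le_rfl (Nat.zero_le l)
  have hlP : v l ∈ P := v_mem_seg (Nat.zero_le l) le_rfl
  have huP : u 0 ∈ P := u_mem_seg le_rfl hl
  have hbW : b ∈ Finset.univ \ P := by simpa using hb
  have hzW : ∀ z, z ∉ C → z ∈ Finset.univ \ P := fun z hz => by
    simpa using fun hx => hz (hPC hx)
  obtain ⟨c, w, hcP, hc0, hwC, htw⟩ : ∃ c w, c ∈ P ∧ c ≠ v 0 ∧ w ∉ C ∧ Tri E (v 0) c w := by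
    have hlt : (E.filter fun e => v 0 ∈ e ∧ e ⊆ C ∪ ∅).card < hdegree E (v 0) := by
      have h1 := card_edges_le (W := ∅) hE (hPC h0P) (by simp)
      have h2 : ∀ x, cd E ∅ (v 0) x = 0 := fun x => by simp [cd]
      simp only [h2, Finset.sum_const_zero, add_zero, hC2] at h1
      rw [show 2 * l + 2 - 1 = 2 * l + 1 by omega, choose_two_odd] at h1
      have h3 := hdeg (v 0)
      have h4 := Nat.mul_le_mul_left k hn
      nlinarith
    obtain ⟨e, he, he'⟩ := Finset.exists_mem_notMem_of_card_lt_card hlt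
    rw [Finset.mem_filter] at he
    rw [Finset.mem_filter, Finset.union_empty, not_and, not_and] at he'
    obtain ⟨w, hwe, hwC⟩ := Finset.not_subset.1 (he' he.1 he.2)
    have hw0 : w ≠ v 0 := fun hx => hwC (hx ▸ hPC h0P)
    have h1 : ((e.erase (v 0)).erase w).card = 1 := by
      rw [Finset.card_erase_of_mem (Finset.mem_erase.2 ⟨hw0, hwe⟩),
        Finset.card_erase_of_mem he.2, hE e he.1]
    obtain ⟨c, hc⟩ := Finset.card_eq_one.1 h1
    have hec : Tri E (v 0) w c := by
      unfold Tri
      rw [← hc, Finset.insert_erase (Finset.mem_erase.2 ⟨hw0, hwe⟩), Finset.insert_erase he.2]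
      exact he.1
    refine ⟨c, w, ?_, (hec.ne hE).2.1.symm, hwC, hec.swap_right⟩
    by_contra hcP
    exact hRM.not_tri hE (hzW w hwC) (by simpa using hcP) hec
  obtain ⟨x, y, s, S, m, hxy, hlx, hSC, hyS, hyC, hm⟩ := h.exists_lp_of_chord hl hb ht hcP hc0 htw
  have hwR : w ∈ Finset.univ \ C := by simpa using hwC
  obtain ⟨v₁, u₁, q, hQ₁, hw₁, hR₁⟩ := exists_rightMax E hwR
  have hq : q ≤ k := by
    have hd : Disjoint (seg v₁ u₁ 0 q) S := by
      rw [Finset.disjoint_left]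
      exact fun t ht ht' => (Finset.mem_sdiff.1 (hR₁ ht)).2 (hSC ht')
    have := hM _ _ _ _ ((hQ₁.idx.lp (Nat.zero_le q) le_rfl).join hlx hd
      (hw₁ ▸ hxy.reverse) (fun ht => (Finset.mem_sdiff.1 (hR₁ ht)).2 hyC) hyS)
    omega
  obtain ⟨v₂, u₂, hQ, hseg, -, hins⟩ := hQ₁.exists_not_insertable
  rw [← hseg] at hQ hR₁ hins
  have hz : v₂ 0 ∉ C := fun hx =>
    (Finset.mem_sdiff.1 (hR₁ (v_mem_seg le_rfl (Nat.zero_le q)))).2 hx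
  have hK : (leftIdx E ((Finset.univ \ C) \ seg v₂ u₂ 0 q) v₂ u₂ q).card ≤ q :=
    (Finset.card_filter_le _ _).trans (by simp)
  have hA := hQ.card_edges_le hE hins hK
  rw [Finset.union_sdiff_of_subset hR₁] at hA
  have hB := card_edges_not_subset_le hE hCR hz hbC (hPC h0P) (hPC huP) (hPC hlP)
    (fun hx => hb (hx ▸ h0P)) (fun hx => hb (hx ▸ huP)) (fun hx => hb (hx ▸ hlP))
    (h.u_ne_v 0 0 hl (by omega)).symm
    (fun hx => by have := h.v_inj _ _ (by omega) le_rfl hx; omega) (h.u_ne_v 0 l hl le_rfl)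
    (hRM.not_tri hE hbW (hzW _ hz))
    (by
      have := (hRM.swap hl).not_tri hE hbW (hzW _ hz)
      rwa [Function.update_self] at this)
    (by
      have := (h.rev.rightMax hM).not_tri hE (r := b) (r' := v₂ 0)
      rw [IsIdx.seg_rev] at this
      exact this hbW (hzW _ hz))
  rw [hC2] at hB
  refine degree_bound_of_cycle hn hlk hq ?_ (hdeg (v₂ 0)) (hdegree_le_add (Finset.univ \ C) (v₂ 0))
    hA hB
  have h1 := Finset.card_sdiff_add_card_eq_card hR₁
  have h2 := Finset.card_sdiff_add_card_eq_card (Finset.subset_univ C)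
  rw [hQ.idx.card_seg] at h1
  rw [hC2, Finset.card_univ, hV] at h2
  omega

lemma RightMax.lt_card_leftIdx {k n l : ℕ} {v u : ℕ → V}
    (h : RightMax E (Finset.univ \ seg v u 0 l) v u l) (hn : 4 * k + 21 ≤ n)
    (hV : Fintype.card V = n) (hE : ∀ e ∈ E, e.card = 3)
    (hdeg : ∀ v : V, k * n + 6 * k ^ 2 + 7 * k + 6 ≤ hdegree E v) (hlk : l ≤ 2 * k + 1)
    (hins : ¬ Insertable E (Finset.univ \ seg v u 0 l) v u l (v 0)) :
    k < (leftIdx E (Finset.univ \ seg v u 0 l) v u l).card := by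
  by_contra! hK
  have hA := h.card_edges_le hE hins hK
  rw [← hdegree_eq_filter_subset] at hA
  refine degree_bound_of_path hn hlk ?_ (hdeg _) hA
  have h2 := Finset.card_sdiff_add_card_eq_card (Finset.subset_univ (seg v u 0 l))
  rwa [h.idx.card_seg, Finset.card_univ, hV] at h2

/-- A longest path may be chosen such that neither of its ends is insertable. -/
lemma IsIdx.exists_not_insertable {l : ℕ} {v u : ℕ → V} (h : IsIdx E v u l)
    (hM : ∀ a z S m, LP E a z S m → m ≤ l) : ∃ v' u', IsIdx E v' u' l ∧
      ¬ Insertable E (Finset.univ \ seg v' u' 0 l) v' u' l (v' 0) ∧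
      ¬ Insertable E (Finset.univ \ seg v' u' 0 l) (fun i => v' (l - i))
        (fun i => u' (l - 1 - i)) l (v' l) := by
  obtain ⟨v₁, u₁, h₁, hs, -, hi⟩ := (h.rightMax hM).exists_not_insertable
  rw [← hs] at hi
  have h₁ := h₁.idx
  set W := Finset.univ \ seg v₁ u₁ 0 l with hW
  by_cases hr : Insertable E W (fun i => v₁ (l - i)) (fun i => u₁ (l - 1 - i)) l (v₁ l)
  · have hl : 2 ≤ l := by
      obtain ⟨j, h1, h2, -⟩ := hr
      omega
    have hrm := h₁.rev.rightMax hM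
    rw [IsIdx.seg_rev, ← hW] at hrm
    have hi' := (hrm.not_insertable_or (by omega)).resolve_left (by simpa using hr)
    have hsw := h₁.rev.swap (by omega)
    have hss := IsIdx.seg_swap (fun i => v₁ (l - i)) (fun i => u₁ (l - 1 - i))
      (show 1 ≤ l by omega)
    rw [IsIdx.seg_rev] at hss
    rw [← RightMax.insertable_swap] at hi'
    set v₂ := Function.update (fun i => v₁ (l - i)) 0 (u₁ (l - 1 - 0)) with hv₂
    set u₂ := Function.update (fun i => u₁ (l - 1 - i)) 0 (v₁ (l - 0)) with hu₂
    have ev : ∀ i, 1 ≤ i → v₂ i = v₁ (l - i) := fun i hi => Function.update_of_ne (by omega) _ _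
    have eu : ∀ i, 1 ≤ i → u₂ i = u₁ (l - 1 - i) := fun i hi =>
      Function.update_of_ne (by omega) _ _
    have ev0 : v₂ 0 = u₁ (l - 1) := Function.update_self _ _ _
    have eu0 : u₂ 0 = v₁ l := Function.update_self _ _ _
    refine ⟨_, _, hsw.rev, ?_, ?_⟩
    · rw [IsIdx.seg_rev, hss]
      have e0 : v₂ (l - 0) = v₁ 0 := by rw [ev _ (by omega)]; simp
      rw [e0]
      refine fun hI => hi (hI.of_right_swap (fun i hi => ?_) ?_ (fun i hi => ?_) ?_)
      · rw [ev _ (by omega)]; congr 1; omega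
      · rw [Nat.sub_self, ev0]
      · rw [eu _ (by omega)]; congr 1; omega
      · rw [Nat.sub_self, eu0]
    · rw [IsIdx.seg_rev, hss]
      have e0 : v₂ (l - l) = u₁ (l - 1 - 0) := by rw [Nat.sub_self, ev0, Nat.sub_zero]
      rw [e0]
      refine fun hI => hi' (hI.congr (fun i hi => ?_) (fun i hi => ?_))
      · congr 1; omega
      · congr 1; omega
  · exact ⟨v₁, u₁, h₁, hi, hr⟩

end Main

theorem min_degree_implies_long_even_linear_path
    (k n : ℕ) (hn : n ≥ 4 * k + 21)
    (V : Type*) [Fintype V] [DecidableEq V] (hV : Fintype.card V = n)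
    (E : Finset (Finset V)) (hE : ∀ e ∈ E, e.card = 3)
    (hdeg : ∀ v : V, hdegree E v ≥ k * n + 6 * k ^ 2 + 7 * k + 6) :
    HasLinearPath E (2 * k + 2) := by
  classical
  obtain ⟨w⟩ : Nonempty V := Fintype.card_pos_iff.1 (by omega)
  obtain ⟨v, u, l, hl⟩ : ∃ v u l, IsIdx E v u l ∧ ∀ a z S m, LP E a z S m → m ≤ l := by
    let P : ℕ → Prop := fun m => ∃ a z S, LP E a z S m
    have hb : ∀ m, P m → m ≤ n := by
      rintro m ⟨a, z, S, h⟩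
      have h1 := h.card
      have h2 := Finset.card_le_univ S
      omega
    obtain ⟨a, z, S, h⟩ : P (Nat.findGreatest P n) :=
      Nat.findGreatest_spec (Nat.zero_le _) ⟨w, w, {w}, LP.nil w⟩
    obtain ⟨v, u, hi, -⟩ := h.exists_isIdx
    exact ⟨v, u, _, hi, fun a z S m hm => Nat.le_findGreatest (hb m ⟨a, z, S, hm⟩) ⟨a, z, S, hm⟩⟩
  obtain ⟨hi, hM⟩ := hl
  rcases le_or_gt (2 * k + 2) l with hlk | hlk
  · exact hi.hasLinearPath hlk
  exfalso
  have hlk : l ≤ 2 * k + 1 := by omega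
  have hl1 : 1 ≤ l := by
    have h1 := hdeg w
    obtain ⟨e, he⟩ := Finset.card_pos.1 (show 0 < hdegree E w by omega)
    have he := (Finset.mem_filter.1 he).1
    obtain ⟨x, y, z, hxy, hxz, hyz, rfl⟩ := Finset.card_eq_three.1 (hE e he)
    exact hM _ _ _ _ (LP.cons (show Tri E x y z from he) (LP.nil z) (by simpa using hxz)
      (by simpa using hyz) hxy)
  have hcyc : ∀ a z S b, LP E a z S l → b ∉ S → ¬ Tri E a b z := by
    intro a z S b hL hbS
    obtain ⟨v', u', hi', rfl, rfl, rfl⟩ := hL.exists_isIdx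
    exact hi'.not_tri_ends hM hn hV hE hdeg hl1 hlk hbS
  obtain ⟨v, u, hi, hins, hins'⟩ := hi.exists_not_insertable hM
  have hA := (hi.rightMax hM).lt_card_leftIdx hn hV hE hdeg hlk hins
  have hB := (hi.rev.rightMax hM).lt_card_leftIdx hn hV hE hdeg hlk
    (by rw [IsIdx.seg_rev]; simpa using hins')
  rw [IsIdx.seg_rev] at hB
  set W := Finset.univ \ seg v u 0 l with hW
  set A := leftIdx E W v u l with hAdef
  set B := leftIdx E W (fun i => v (l - i)) (fun i => u (l - 1 - i)) l with hBdef
  have hBl : ∀ i ∈ B, i < l := fun i hi => Finset.mem_range.1 (Finset.mem_filter.1 hi).1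
  have hB' : (B.image fun i => l - 1 - i).card = B.card := by
    refine Finset.card_image_of_injOn fun x hx y hy hxy => ?_
    have h1 := hBl x hx
    have h2 := hBl y hy
    have h3 : l - 1 - x = l - 1 - y := hxy
    omega
  obtain ⟨i, hiAB⟩ : (A ∩ B.image fun i => l - 1 - i).Nonempty := by
    by_contra hne
    rw [Finset.not_nonempty_iff_eq_empty, ← Finset.disjoint_iff_inter_eq_empty] at hne
    have h1 := Finset.card_union_of_disjoint hne
    have h2 : A ∪ B.image (fun i => l - 1 - i) ⊆ Finset.range l := by
      refine Finset.union_subset (Finset.filter_subset _ _) fun x hx => ?_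
      obtain ⟨y, hy, rfl⟩ := Finset.mem_image.1 hx
      have := hBl y hy
      rw [Finset.mem_range]
      omega
    have h3 := Finset.card_le_card h2
    rw [Finset.card_range] at h3
    omega
  obtain ⟨hiA, hiB⟩ := Finset.mem_inter.1 hiAB
  obtain ⟨j, hj, rfl⟩ := Finset.mem_image.1 hiB
  obtain ⟨hil, hx⟩ := Finset.mem_filter.1 hiA
  obtain ⟨hjl, hy⟩ := Finset.mem_filter.1 hj
  rw [Finset.mem_range] at hil hjl
  set i := l - 1 - j with hij
  have hx' : ∃ x, (x = u i ∨ LP E x (v l) (seg v u (i + 1) l) (l - (i + 1))) ∧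
      2 ≤ cd E W (v 0) x := by
    rcases hx with hx | hx | ⟨hlt, hx⟩
    · exact ⟨_, Or.inl rfl, hx⟩
    · exact ⟨_, Or.inr (hi.lp hil le_rfl), hx⟩
    · exact ⟨_, Or.inr (hi.lp_u_left hlt le_rfl), hx⟩
  have hy' : ∃ y, (y = u i ∨ LP E (v 0) y (seg v u 0 i) i) ∧ 2 ≤ cd E W (v l) y := by
    simp only [Nat.sub_zero] at hy
    rcases hy with hy | hy | ⟨hlt, hy⟩
    · exact ⟨_, Or.inl rfl, hy⟩
    · refine ⟨_, Or.inr ?_, hy⟩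
      rw [show l - (j + 1) = i by omega]
      exact hi.lp (Nat.zero_le i) hil.le
    · refine ⟨_, Or.inr ?_, hy⟩
      have := hi.lp_u_right (Nat.zero_le (l - 1 - (j + 1))) (by omega)
      rwa [show l - 1 - (j + 1) + 1 = i by omega] at this
  obtain ⟨x, hx, cx⟩ := hx'
  obtain ⟨y, hy, cy⟩ := hy'
  exact hi.not_crossing hM hcyc (fun x hx => (Finset.mem_sdiff.1 hx).2) hil hx hy cx cy
end

section
/- Let t ≥ 3 and n ≥ 2t + 17 be integers, and let H be a 3-uniform hypergraph on n vertices with minimum degree δ₁(H) ≥ g(n,t) that contains no linear path of length t + 1. If P = (x₀, x₁, ..., x_{2t}) is a linear path of length t in H, then for every k ∈ [0, t−1], d_P(0, 2k+2) + d_P(2t, 2k) ≤ n − 2t − 1. -/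
/-- `x = (x₀, x₁, …, x_{2t})` is a linear path of length `t` in the hypergraph with
edge set `E`: the `2t+1` vertices are distinct and `{x_{2i}, x_{2i+1}, x_{2i+2}} ∈ E`
for each `i ∈ [0, t-1]`. -/
def IsLinearPathSeq {V : Type*} [DecidableEq V] (E : Finset (Finset V)) (t : ℕ)
    (x : Fin (2 * t + 1) → V) : Prop :=
  Function.Injective x ∧
  ∀ i : Fin t,
    ({x ⟨2 * i, by have := i.isLt; omega⟩,
      x ⟨2 * i + 1, by have := i.isLt; omega⟩,
      x ⟨2 * i + 2, by have := i.isLt; omega⟩} : Finset V) ∈ E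

/-- `dP E x a b` is the number of vertices `y` outside the path `x` such that
`{x_a, x_b, y}` is an edge; this is `d_P(a, b)` in the paper. -/
def dP {V : Type*} [Fintype V] [DecidableEq V] (E : Finset (Finset V)) {t : ℕ}
    (x : Fin (2 * t + 1) → V) (a b : Fin (2 * t + 1)) : ℕ :=
  (Finset.univ.filter
    (fun y => (∀ i, y ≠ x i) ∧ ({x a, x b, y} : Finset V) ∈ E)).card

/-- The function `g(n,t)` from the paper:
`g(n,t) = ((t-1)/2)n + (3/2)t² - (9/2)t + 6` for odd `t`, and
`g(n,t) = ((t-2)/2)n + (3/2)t² - (5/2)t + 6` for even `t`. -/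
def gQ (n t : ℕ) : ℚ :=
  if Odd t then ((t : ℚ) - 1) / 2 * n + 3 / 2 * t ^ 2 - 9 / 2 * t + 6
  else ((t : ℚ) - 2) / 2 * n + 3 / 2 * t ^ 2 - 5 / 2 * t + 6


/-- Prepending an edge that meets a linear path of length `t` only in a vertex of its first edge
(other than the joint to the second edge) gives a linear path of length `t + 1`. -/
theorem hasLinearPath_of_prepend {V : Type*} [DecidableEq V] {E : Finset (Finset V)}
    (hE : ∀ e ∈ E, e.card = 3) {t : ℕ} {d : ℕ → V}
    (hinj : ∀ p q, p ≤ 2 * t → q ≤ 2 * t → d p = d q → p = q)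
    (hedge : ∀ i < t, ({d (2 * i), d (2 * i + 1), d (2 * i + 2)} : Finset V) ∈ E)
    {f : Finset V} (hf : f ∈ E) {j : ℕ} (hj : j < 2) (hjf : d j ∈ f)
    (honly : ∀ p ≤ 2 * t, d p ∈ f → p = j) : HasLinearPath E (t + 1) := by
  let F : ℕ → Finset V := fun i =>
    if i = 0 then f else {d (2 * (i - 1)), d (2 * (i - 1) + 1), d (2 * (i - 1) + 2)}
  have hFE : ∀ i, i < t + 1 → F i ∈ E := by
    intro i hi
    by_cases h0 : i = 0
    · simpa [F, h0] using hf
    · simpa [F, h0] using hedge (i - 1) (by omega)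
  have mem_succ : ∀ i v, v ∈ F (i + 1) ↔ ∃ p, 2 * i ≤ p ∧ p ≤ 2 * i + 2 ∧ v = d p := by
    intro i v
    simp only [F, Nat.add_eq_zero_iff, one_ne_zero, and_false, if_false, Nat.add_sub_cancel,
      Finset.mem_insert, Finset.mem_singleton]
    constructor
    · rintro (h | h | h)
      · exact ⟨_, le_rfl, by omega, h⟩
      · exact ⟨_, by omega, by omega, h⟩
      · exact ⟨_, by omega, le_rfl, h⟩
    · rintro ⟨p, h1, h2, rfl⟩
      obtain rfl | rfl | rfl : p = 2 * i ∨ p = 2 * i + 1 ∨ p = 2 * i + 2 := by omega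
      all_goals simp
  have key : ∀ i j : ℕ, i < j → j < t + 1 →
      (i + 1 = j → (F i ∩ F j).card = 1) ∧ (i + 1 ≠ j → F i ∩ F j = ∅) := by
    intro i l hil hlt
    obtain ⟨l, rfl⟩ : ∃ m, l = m + 1 := ⟨l - 1, by omega⟩
    constructor
    · intro h
      obtain rfl : i = l := by omega
      rw [Finset.card_eq_one]
      rcases i with _ | i
      · refine ⟨d j, ?_⟩
        ext v
        rw [Finset.mem_inter, mem_succ, Finset.mem_singleton]
        constructor
        · rintro ⟨h1, p, _, h2, rfl⟩
          rw [honly p (by omega) (by simpa [F] using h1)]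
        · rintro rfl
          exact ⟨by simpa [F] using hjf, j, by omega, by omega, rfl⟩
      · refine ⟨d (2 * i + 2), ?_⟩
        ext v
        rw [Finset.mem_inter, mem_succ, mem_succ, Finset.mem_singleton]
        constructor
        · rintro ⟨⟨p, _, h1, rfl⟩, q, h2, h3, hpq⟩
          have := hinj p q (by omega) (by omega) hpq
          congr 1
          omega
        · rintro rfl
          exact ⟨⟨_, by omega, le_rfl, rfl⟩, _, by omega, by omega, rfl⟩
    · intro h
      rw [Finset.eq_empty_iff_forall_notMem]
      intro v hv
      rw [Finset.mem_inter, mem_succ] at hv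
      obtain ⟨h1, q, h2, h3, rfl⟩ := hv
      rcases i with _ | i
      · have := honly q (by omega) (by simpa [F] using h1)
        omega
      · rw [mem_succ] at h1
        obtain ⟨p, h4, h5, hpq⟩ := h1
        have := hinj q p (by omega) (by omega) hpq
        omega
  have hne : ∀ i j : ℕ, i < j → j < t + 1 → F i ≠ F j := by
    intro i l hil hl heq
    have h3 := hE _ (hFE l hl)
    have hk := key i l hil hl
    rw [heq, Finset.inter_self] at hk
    by_cases h : i + 1 = l
    · have := hk.1 h
      omega
    · have := hk.2 h
      simp [this] at h3
  refine ⟨fun i => F i, ?_, fun i => hFE i i.isLt, ?_⟩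
  · intro i l h
    rcases lt_trichotomy (i : ℕ) l with hlt | heq | hgt
    · exact absurd h (hne _ _ hlt l.isLt)
    · exact Fin.ext heq
    · exact absurd h.symm (hne _ _ hgt i.isLt)
  · intro i l hil
    have hil' : (i : ℕ) ≠ l := fun h => hil (Fin.ext h)
    rcases lt_or_gt_of_ne hil' with hlt | hgt
    · have := key i l hlt l.isLt
      exact ⟨fun h => this.1 (by omega), fun h => this.2 (by omega)⟩
    · have := key l i hgt i.isLt
      rw [Finset.inter_comm] at this
      exact ⟨fun h => this.1 (by omega), fun h => this.2 (by omega)⟩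

/-- A linear cycle of length `t + 1` together with an edge meeting its vertex set in exactly one
vertex contains a linear path of length `t + 1`. -/
theorem hasLinearPath_of_cycle {V : Type*} [DecidableEq V] {E : Finset (Finset V)}
    (hE : ∀ e ∈ E, e.card = 3) {t : ℕ} {c : ℕ → V}
    (hinj : ∀ p q, p < 2 * t + 2 → q < 2 * t + 2 → c p = c q → p = q)
    (hedge : ∀ i < t, ({c (2 * i), c (2 * i + 1), c (2 * i + 2)} : Finset V) ∈ E)
    (hclose : ({c (2 * t), c (2 * t + 1), c 0} : Finset V) ∈ E)
    {f : Finset V} (hf : f ∈ E) {j : ℕ} (hj : j < 2 * t + 2) (hjf : c j ∈ f)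
    (honly : ∀ p < 2 * t + 2, c p ∈ f → p = j) : HasLinearPath E (t + 1) := by
  have hmod : ∀ p, p ≤ 2 * t → (2 * (j / 2) + p) % (2 * t + 2) =
      if 2 * (j / 2) + p < 2 * t + 2 then 2 * (j / 2) + p
      else 2 * (j / 2) + p - (2 * t + 2) := by
    intro p hp
    split_ifs with h
    · exact Nat.mod_eq_of_lt h
    · rw [Nat.mod_eq_sub_mod (by omega), Nat.mod_eq_of_lt (by omega)]
  have hjmod : (2 * (j / 2) + j % 2) % (2 * t + 2) = j := by
    rw [show 2 * (j / 2) + j % 2 = j by omega, Nat.mod_eq_of_lt hj]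
  refine hasLinearPath_of_prepend hE (d := fun p => c ((2 * (j / 2) + p) % (2 * t + 2)))
    ?_ ?_ hf (j := j % 2) (by omega) ?_ ?_
  · intro p q hp hq h
    have := hinj _ _ (Nat.mod_lt _ (by omega)) (Nat.mod_lt _ (by omega)) h
    rw [hmod p hp, hmod q hq] at this
    split_ifs at this <;> omega
  · intro i hi
    simp only [hmod (2 * i) (by omega), hmod (2 * i + 1) (by omega), hmod (2 * i + 2) (by omega)]
    rcases lt_trichotomy (j / 2 + i) t with h | h | h
    · have := hedge (j / 2 + i) h
      rw [if_pos (by omega), if_pos (by omega), if_pos (by omega)]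
      convert this using 4 <;> first | omega | (congr 1; omega)
    · rw [if_pos (by omega), if_pos (by omega), if_neg (by omega)]
      convert hclose using 4 <;> first | omega | (congr 1; omega)
    · have := hedge (j / 2 + i - (t + 1)) (by omega)
      rw [if_neg (by omega), if_neg (by omega), if_neg (by omega)]
      convert this using 4 <;> first | omega | (congr 1; omega)
  · simpa only [hjmod] using hjf
  · intro p hp h
    have := honly _ (Nat.mod_lt _ (by omega)) h
    rw [hmod p hp] at this
    split_ifs at this <;> omega

/-- A linear path `X` of length `t` whose `k`-th edge is bypassed by the edges
`{X 0, a, X (2k+2)}` and `{X (2t), b, X (2k)}` yields a linear cycle of length `t + 1`, so an edge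
meeting its vertex set in exactly one vertex produces a linear path of length `t + 1`. -/
theorem hasLinearPath_of_bypass {V : Type*} [DecidableEq V] {E : Finset (Finset V)}
    (hE : ∀ e ∈ E, e.card = 3) {t k : ℕ} (hk : k < t) {X : ℕ → V}
    (hinj : ∀ p q, p ≤ 2 * t → q ≤ 2 * t → X p = X q → p = q)
    (hedge : ∀ i < t, ({X (2 * i), X (2 * i + 1), X (2 * i + 2)} : Finset V) ∈ E)
    {a b : V} (hab : a ≠ b) (haX : ∀ p ≤ 2 * t, a ≠ X p) (hbX : ∀ p ≤ 2 * t, b ≠ X p)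
    (ha : {X 0, X (2 * k + 2), a} ∈ E) (hb : {X (2 * t), X (2 * k), b} ∈ E)
    {f : Finset V} (hf : f ∈ E) {v : V} (hvf : v ∈ f)
    (hv : v = a ∨ v = b ∨ ∃ p ≤ 2 * t, p ≠ 2 * k + 1 ∧ v = X p)
    (honly : ∀ p ≤ 2 * t, p ≠ 2 * k + 1 → X p ∈ f → X p = v)
    (haf : a ∈ f → a = v) (hbf : b ∈ f → b = v) : HasLinearPath E (t + 1) := by
  let c : ℕ → V := fun p =>
    if p = 0 then X 0 else if p = 1 then a else if p ≤ 2 * (t - k) then X (2 * k + p)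
    else if p = 2 * (t - k) + 1 then b else X (2 * t + 2 - p)
  have c0 : c 0 = X 0 := by simp [c]
  have c1 : c 1 = a := by simp [c]
  have c2 : ∀ p, 2 ≤ p → p ≤ 2 * (t - k) → c p = X (2 * k + p) := by
    intro p h1 h2
    simp only [c]
    rw [if_neg (by omega), if_neg (by omega), if_pos h2]
  have c3 : c (2 * (t - k) + 1) = b := by
    simp only [c]
    rw [if_neg (by omega), if_neg (by omega), if_neg (by omega)]
    simp
  have c4 : ∀ p, 2 * (t - k) + 2 ≤ p → c p = X (2 * t + 2 - p) := by
    intro p h1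
    simp only [c]
    rw [if_neg (by omega), if_neg (by omega), if_neg (by omega), if_neg (by omega)]
  have cinj : ∀ p q, p < 2 * t + 2 → q < 2 * t + 2 → c p = c q → p = q := by
    intro p q hp hq h
    simp only [c] at h
    split_ifs at h
    all_goals first
      | omega
      | exact absurd h hab
      | exact absurd h.symm hab
      | exact absurd h (haX _ (by omega))
      | exact absurd h.symm (haX _ (by omega))
      | exact absurd h (hbX _ (by omega))
      | exact absurd h.symm (hbX _ (by omega))
      | (have := hinj _ _ (by omega) (by omega) h; omega)
  have crange : ∀ p < 2 * t + 2, c p = a ∨ c p = b ∨ ∃ q ≤ 2 * t, q ≠ 2 * k + 1 ∧ c p = X q := by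
    intro p hp
    simp only [c]
    split_ifs
    · exact Or.inr (Or.inr ⟨_, by omega, by omega, rfl⟩)
    · exact Or.inl rfl
    · exact Or.inr (Or.inr ⟨_, by omega, by omega, rfl⟩)
    · exact Or.inr (Or.inl rfl)
    · exact Or.inr (Or.inr ⟨_, by omega, by omega, rfl⟩)
  have csurj : ∃ j < 2 * t + 2, c j = v := by
    rcases hv with rfl | rfl | ⟨p, hp, hpk, rfl⟩
    · exact ⟨1, by omega, c1⟩
    · exact ⟨_, by omega, c3⟩
    · rcases Nat.eq_zero_or_pos p with rfl | hpos
      · exact ⟨0, by omega, c0⟩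
      · rcases lt_or_gt_of_ne hpk with h | h
        · refine ⟨2 * t + 2 - p, by omega, ?_⟩
          rw [c4 _ (by omega)]
          congr 1
          omega
        · refine ⟨p - 2 * k, by omega, ?_⟩
          rw [c2 _ (by omega) (by omega)]
          congr 1
          omega
  obtain ⟨j, hj, hcj⟩ := csurj
  have cedge : ∀ i ≤ t, ({c (2 * i), c (2 * i + 1),
      if i = t then c 0 else c (2 * i + 2)} : Finset V) ∈ E := by
    intro i hi
    rcases Nat.eq_zero_or_pos i with rfl | hpos
    · rw [if_neg (by omega), c0, c1, c2 _ (by omega) (by omega), mul_zero, zero_add,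
        Finset.pair_comm]
      exact ha
    · rcases lt_trichotomy i (t - k) with h | h | h
      · rw [if_neg (by omega), c2 _ (by omega) (by omega), c2 _ (by omega) (by omega),
          c2 _ (by omega) (by omega)]
        convert hedge (k + i) (by omega) using 4 <;> first | omega | (congr 1; omega)
      · have hend : (if i = t then c 0 else c (2 * i + 2)) = X (2 * k) := by
          split_ifs
          · rw [c0]
            congr 1
            omega
          · rw [c4 _ (by omega)]
            congr 1
            omega
        rw [hend, h, c2 _ (by omega) (by omega), c3, Finset.pair_comm]
        convert hb using 3
        omega
      · have hend : (if i = t then c 0 else c (2 * i + 2)) = X (2 * (t - i)) := by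
          split_ifs
          · rw [c0]
            congr 1
            omega
          · rw [c4 _ (by omega)]
            congr 1
            omega
        rw [hend, c4 _ (by omega), c4 _ (by omega)]
        have := hedge (t - i) (by omega)
        rw [Finset.insert_comm, Finset.pair_comm, Finset.insert_comm] at this
        convert this using 1
        rw [show 2 * t + 2 - 2 * i = 2 * (t - i) + 2 by omega,
          show 2 * t + 2 - (2 * i + 1) = 2 * (t - i) + 1 by omega]
  refine hasLinearPath_of_cycle hE cinj ?_ ?_ hf hj (hcj ▸ hvf) ?_
  · intro i hi
    simpa only [if_neg hi.ne] using cedge i hi.le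
  · simpa only [if_true] using cedge t le_rfl
  · intro p hp hpf
    apply cinj p j hp hj
    rw [hcj]
    rcases crange p hp with h | h | ⟨q, hq, hqk, h⟩
    · rw [h] at hpf ⊢
      exact haf hpf
    · rw [h] at hpf ⊢
      exact hbf hpf
    · rw [h] at hpf ⊢
      exact honly q hq hqk hpf

/-- If every edge through `w` lies in `insert w S`, then `w` has degree at most `|S|` choose 2. -/
theorem hdegree_le_choose {V : Type*} [DecidableEq V] {E : Finset (Finset V)}
    (hE : ∀ e ∈ E, e.card = 3) {w : V} {S : Finset V}
    (h : ∀ f ∈ E, w ∈ f → ∀ u ∈ f, u ≠ w → u ∈ S) : hdegree E w ≤ S.card.choose 2 := by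
  rw [hdegree, ← Finset.card_powersetCard]
  refine Finset.card_le_card_of_injOn (fun f => f.erase w) ?_ ?_
  · intro f hf
    obtain ⟨hfE, hwf⟩ := Finset.mem_filter.1 hf
    refine Finset.mem_coe.2 (Finset.mem_powersetCard.2 ⟨fun u hu => ?_, ?_⟩)
    · exact h f hfE hwf u (Finset.mem_of_mem_erase hu) (Finset.ne_of_mem_erase hu)
    · rw [Finset.card_erase_of_mem hwf, hE f hfE]
  · intro f hf g hg hfg
    rw [← Finset.insert_erase (Finset.mem_filter.1 hf).2,
      ← Finset.insert_erase (Finset.mem_filter.1 hg).2]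
    exact congrArg (insert w) hfg

/-- Let `Q` be a vertex set such that, for all distinct `a ∈ A` and `b ∈ B`, no edge meets
`Q ∪ {a, b}` in exactly one vertex. If `A` has at least four vertices and `B` is nonempty, then
some vertex has degree at most `|Q| + 1` choose 2. -/
theorem exists_hdegree_le_choose {V : Type*} [DecidableEq V] {E : Finset (Finset V)}
    (hE : ∀ e ∈ E, e.card = 3) {Q A B : Finset V}
    (hAQ : ∀ a ∈ A, a ∉ Q) (hBQ : ∀ b ∈ B, b ∉ Q)
    (hQ : ∀ a ∈ A, ∀ b ∈ B, a ≠ b → ∀ f ∈ E, ∀ v ∈ f,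
      (v = a ∨ v = b ∨ v ∈ Q) → ∃ u ∈ f, (u = a ∨ u = b ∨ u ∈ Q) ∧ u ≠ v)
    (hA : 4 ≤ A.card) (hB : B.Nonempty) :
    ∃ w, hdegree E w ≤ (Q.card + 1).choose 2 := by
  obtain ⟨b, hb⟩ := hB
  have hpick : ∀ S : Finset V, S.card ≤ 3 → ∃ a ∈ A, a ∉ S := fun S hS =>
    Finset.exists_mem_notMem_of_card_lt_card (by omega)
  obtain ⟨w, hw, hwb⟩ := hpick {b} (by simp)
  rw [Finset.mem_singleton] at hwb
  refine ⟨w, ?_⟩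
  rw [← Finset.card_insert_of_notMem (hBQ b hb)]
  refine hdegree_le_choose hE fun f hf hwf u huf huw => ?_
  by_contra huS
  rw [Finset.mem_insert, not_or] at huS
  obtain ⟨hub, huQ⟩ := huS
  obtain ⟨v, hvf⟩ : ∃ v, ∀ z ∈ f, z = w ∨ z = u ∨ z = v := by
    have h1 : ((f.erase w).erase u).card = 1 := by
      rw [Finset.card_erase_of_mem (Finset.mem_erase.2 ⟨huw, huf⟩), Finset.card_erase_of_mem hwf,
        hE f hf]
    obtain ⟨v, hv⟩ := Finset.card_eq_one.1 h1
    refine ⟨v, fun z hz => ?_⟩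
    by_contra! hne
    have : z ∈ (f.erase w).erase u := by simp [hne, hz]
    rw [hv, Finset.mem_singleton] at this
    exact hne.2.2 this
  obtain ⟨a, ha, hanot⟩ := hpick {w, u, b} Finset.card_le_three
  simp only [Finset.mem_insert, Finset.mem_singleton, not_or] at hanot
  obtain ⟨haw, hau, hab⟩ := hanot
  have hwQ := hAQ w hw
  have hbQ := hBQ b hb
  obtain ⟨z, hz, hzC, hzw⟩ := hQ w hw b hb hwb f hf w hwf (Or.inl rfl)
  have hzv : z = v := by
    rcases hvf z hz with rfl | rfl | h
    · exact absurd rfl hzw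
    · tauto
    · exact h
  subst hzv
  have hzbQ : z = b ∨ z ∈ Q := by tauto
  obtain ⟨y, hy, hyC, hyz⟩ := hQ a ha b hb hab f hf z hz (by tauto)
  rcases hvf y hy with rfl | rfl | rfl
  · rcases hyC with h | h | h
    · exact haw h.symm
    · exact hwb h
    · exact hwQ h
  · rcases hyC with h | h | h
    · exact hau h.symm
    · exact hub h
    · exact huQ h
  · exact hyz rfl

/-- For `n ≥ 2t + 17`, the bound `g(n,t)` exceeds `2t + 1` choose 2. -/
theorem choose_lt_gQ {t n : ℕ} (ht : t ≥ 3) (hn : n ≥ 2 * t + 17) :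
    (((2 * t + 1).choose 2 : ℕ) : ℚ) < gQ n t := by
  have hc : (((2 * t + 1).choose 2 : ℕ) : ℚ) = t * (2 * t + 1) := by
    rw [Nat.cast_choose_two]
    push_cast
    ring
  have ht' : (3 : ℚ) ≤ t := by exact_mod_cast ht
  have hn' : (2 * t + 17 : ℚ) ≤ n := by exact_mod_cast hn
  rw [hc, gQ]
  split_ifs with hodd
  · nlinarith [mul_nonneg (sub_nonneg.2 ht') (sub_nonneg.2 hn')]
  · have ht4 : (4 : ℚ) ≤ t := by
      have : t ≠ 3 := by
        rintro rfl
        exact hodd (by decide)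
      have : 4 ≤ t := by omega
      exact_mod_cast this
    nlinarith [mul_nonneg (sub_nonneg.2 ht4) (sub_nonneg.2 hn')]

theorem dP_even_sum_le_n
    (t n : ℕ) (ht : t ≥ 3) (hn : n ≥ 2 * t + 17)
    (V : Type*) [Fintype V] [DecidableEq V] (hV : Fintype.card V = n)
    (E : Finset (Finset V)) (hE : ∀ e ∈ E, e.card = 3)
    (hdeg : ∀ v : V, gQ n t ≤ (hdegree E v : ℚ))
    (hfree : ¬ HasLinearPath E (t + 1))
    (x : Fin (2 * t + 1) → V) (hx : IsLinearPathSeq E t x)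
    (k : ℕ) (hk : k ≤ t - 1) :
    dP E x ⟨0, by omega⟩ ⟨2 * k + 2, by omega⟩ +
      dP E x ⟨2 * t, by omega⟩ ⟨2 * k, by omega⟩ ≤ n - 2 * t - 1 := by
  have h2k : 2 * k + 2 < 2 * t + 1 := by omega
  let X : ℕ → V := fun p => if h : p < 2 * t + 1 then x ⟨p, h⟩ else x 0
  have hX : ∀ p (h : p < 2 * t + 1), X p = x ⟨p, h⟩ := fun p h => dif_pos h
  have hXinj : ∀ p q, p ≤ 2 * t → q ≤ 2 * t → X p = X q → p = q := by
    intro p q hp hq h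
    rw [hX p (by omega), hX q (by omega)] at h
    exact congrArg Fin.val (hx.1 h)
  have hXedge : ∀ i < t, ({X (2 * i), X (2 * i + 1), X (2 * i + 2)} : Finset V) ∈ E := by
    intro i hi
    rw [hX (2 * i) (by omega), hX (2 * i + 1) (by omega), hX (2 * i + 2) (by omega)]
    exact hx.2 ⟨i, hi⟩
  have hout : ∀ y : V, (∀ i, y ≠ x i) → ∀ p ≤ 2 * t, y ≠ X p := by
    intro y hy p hp
    rw [hX p (by omega)]
    exact hy _
  unfold dP
  set A := Finset.univ.filter (fun y : V => (∀ i, y ≠ x i) ∧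
    ({x ⟨0, by omega⟩, x ⟨2 * k + 2, h2k⟩, y} : Finset V) ∈ E) with hAdef
  set B := Finset.univ.filter (fun y : V => (∀ i, y ≠ x i) ∧
    ({x ⟨2 * t, by omega⟩, x ⟨2 * k, by omega⟩, y} : Finset V) ∈ E) with hBdef
  have hAmem : ∀ a ∈ A, (∀ i, a ≠ x i) ∧ ({X 0, X (2 * k + 2), a} : Finset V) ∈ E := by
    intro a ha
    rw [hX 0 (by omega), hX (2 * k + 2) h2k]
    exact (Finset.mem_filter.1 ha).2
  have hBmem : ∀ b ∈ B, (∀ i, b ≠ x i) ∧ ({X (2 * t), X (2 * k), b} : Finset V) ∈ E := by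
    intro b hb
    rw [hX (2 * t) (by omega), hX (2 * k) (by omega)]
    exact (Finset.mem_filter.1 hb).2
  let Q : Finset V := ((Finset.range (2 * t + 1)).erase (2 * k + 1)).image X
  have hQmem : ∀ v, v ∈ Q ↔ ∃ p ≤ 2 * t, p ≠ 2 * k + 1 ∧ v = X p := by
    intro v
    simp only [Q, Finset.mem_image, Finset.mem_erase, Finset.mem_range]
    constructor
    · rintro ⟨p, ⟨h1, h2⟩, rfl⟩
      exact ⟨p, by omega, h1, rfl⟩
    · rintro ⟨p, h1, h2, rfl⟩
      exact ⟨p, ⟨h2, by omega⟩, rfl⟩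
  have hQcard : Q.card ≤ 2 * t := by
    refine Finset.card_image_le.trans ?_
    rw [Finset.card_erase_of_mem (by simp; omega), Finset.card_range]
    omega
  have hnotQ : ∀ y : V, (∀ i, y ≠ x i) → y ∉ Q := by
    intro y hy hyQ
    obtain ⟨p, hp, _, h⟩ := (hQmem y).1 hyQ
    exact hout y hy p hp h
  have hcyc : ∀ a ∈ A, ∀ b ∈ B, a ≠ b → ∀ f ∈ E, ∀ v ∈ f,
      (v = a ∨ v = b ∨ v ∈ Q) → ∃ u ∈ f, (u = a ∨ u = b ∨ u ∈ Q) ∧ u ≠ v := by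
    intro a ha b hb hab f hf v hvf hv
    by_contra! hcon
    refine hfree (hasLinearPath_of_bypass hE (by omega : k < t) hXinj hXedge hab
      (hout a (hAmem a ha).1) (hout b (hBmem b hb).1) (hAmem a ha).2 (hBmem b hb).2 hf hvf
      (by rwa [hQmem] at hv) ?_ ?_ ?_)
    · exact fun p hp hpk hpf => hcon _ hpf (Or.inr (Or.inr ((hQmem _).2 ⟨p, hp, hpk, rfl⟩)))
    · exact fun haf => hcon a haf (Or.inl rfl)
    · exact fun hbf => hcon b hbf (Or.inr (Or.inl rfl))
  have hdegQ : ∀ w, (Q.card + 1).choose 2 < hdegree E w := by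
    intro w
    have h1 := (choose_lt_gQ ht hn).trans_le (hdeg w)
    have h2 : (2 * t + 1).choose 2 < hdegree E w := by exact_mod_cast h1
    exact (Nat.choose_le_choose 2 (by omega)).trans_lt h2
  have hcard : ∀ S : Finset V, (∀ y ∈ S, ∀ i, y ≠ x i) → S.card ≤ n - 2 * t - 1 := by
    intro S hS
    have hdisj : Disjoint S (Finset.univ.image x) := by
      rw [Finset.disjoint_left]
      intro y hy hyx
      obtain ⟨i, _, rfl⟩ := Finset.mem_image.1 hyx
      exact hS _ hy i rfl
    have h1 := Finset.card_le_univ (S ∪ Finset.univ.image x)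
    rw [Finset.card_union_of_disjoint hdisj, Finset.card_image_of_injective _ hx.1,
      Finset.card_univ, Fintype.card_fin, hV] at h1
    omega
  have hAcard := hcard A fun y hy => (hAmem y hy).1
  have hBcard := hcard B fun y hy => (hBmem y hy).1
  by_contra! hlt
  rcases le_total 4 A.card with h4 | h4
  · obtain ⟨w, hw⟩ := exists_hdegree_le_choose hE (fun a ha => hnotQ a (hAmem a ha).1)
      (fun b hb => hnotQ b (hBmem b hb).1) hcyc h4 (Finset.card_pos.1 (by omega))
    exact absurd (hdegQ w) (not_lt.2 hw)
  · obtain ⟨w, hw⟩ := exists_hdegree_le_choose hE (fun b hb => hnotQ b (hBmem b hb).1)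
      (fun a ha => hnotQ a (hAmem a ha).1)
      (fun b hb a ha hba f hf v hvf hv => by
        obtain ⟨u, hu, huC, huv⟩ := hcyc a ha b hb hba.symm f hf v hvf (or_left_comm.1 hv)
        exact ⟨u, hu, or_left_comm.1 huC, huv⟩)
      (by omega) (Finset.card_pos.1 (by omega))
    exact absurd (hdegQ w) (not_lt.2 hw)
end

section
/- Let t ≥ 3 and n ≥ 2t + 17 be integers. Every 3-uniform hypergraph H on n vertices with minimum degree δ₁(H) ≥ ((t−1)/2)n + (3/2)t² − (9/2)t + 6 contains a linear path of length t. -/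
namespace LinearPath

variable {V : Type*}

/-- `Slot L z m w`: `m` is a middle vertex of the chain `L`, between the joints `z` and `w`. -/
inductive Slot : List V → V → V → V → Prop
  | head (z m w : V) (r : List V) : Slot (z :: m :: w :: r) z m w
  | tail (u v : V) {L : List V} {z m w : V} : Slot L z m w → Slot (u :: v :: L) z m w

namespace Slot

lemma exists_index {L : List V} {z m w : V} (h : Slot L z m w) :
    ∃ i, L[2 * i]? = some z ∧ L[2 * i + 1]? = some m ∧ L[2 * i + 2]? = some w := by
  induction h with
  | head z m w r => exact ⟨0, by simp⟩
  | tail u v _ ih =>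
    obtain ⟨i, h⟩ := ih
    exact ⟨i + 1, by simpa [Nat.mul_add] using h⟩

lemma mem {L : List V} {z m w : V} (h : Slot L z m w) : m ∈ L := by
  obtain ⟨i, _, h, _⟩ := h.exists_index
  exact List.mem_of_getElem? h

lemma unique {L : List V} (hn : L.Nodup) {z m w z' w' : V} (h : Slot L z m w)
    (h' : Slot L z' m w') : z = z' ∧ w = w' := by
  obtain ⟨i, h1, h2, h3⟩ := h.exists_index
  obtain ⟨j, h1', h2', h3'⟩ := h'.exists_index
  obtain ⟨hi, e⟩ := List.getElem?_eq_some_iff.1 h2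
  have := (List.getElem?_inj hi hn).1 (h2.trans h2'.symm)
  obtain rfl : i = j := by omega
  simp_all

lemma joint_ne {L : List V} (hn : L.Nodup) {z m w z' m' w' : V} (h : Slot L z m w)
    (h' : Slot L z' m' w') : z ≠ m' ∧ w ≠ m' := by
  obtain ⟨i, h1, h2, h3⟩ := h.exists_index
  obtain ⟨j, h1', h2', h3'⟩ := h'.exists_index
  constructor
  · rintro rfl
    obtain ⟨hi, e⟩ := List.getElem?_eq_some_iff.1 h1
    have := (List.getElem?_inj hi hn).1 (h1.trans h2'.symm)
    omega
  · rintro rfl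
    obtain ⟨hi, e⟩ := List.getElem?_eq_some_iff.1 h3
    have := (List.getElem?_inj hi hn).1 (h3.trans h2'.symm)
    omega

lemma append_left {L : List V} {z m w : V} (h : Slot L z m w) (R : List V) :
    Slot (L ++ R) z m w := by
  induction h with
  | head z m w r => exact .head _ _ _ _
  | tail u v _ ih => exact .tail _ _ ih

end Slot

variable [DecidableEq V] {E : Finset (Finset V)}

/-- The triple `{a, b, c}` is an edge. -/
def Tri (E : Finset (Finset V)) (a b c : V) : Prop := ({a, b, c} : Finset V) ∈ E

lemma Tri.swap_left {a b c : V} (h : Tri E a b c) : Tri E b a c := by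
  unfold Tri at *; rwa [Finset.insert_comm]

lemma Tri.swap_right {a b c : V} (h : Tri E a b c) : Tri E a c b := by
  unfold Tri at *; rwa [Finset.pair_comm]

lemma Tri.rev {a b c : V} (h : Tri E a b c) : Tri E c b a :=
  h.swap_left.swap_right.swap_left

/-- `Chain E a b L`: the list `L = [a, m₁, j₁, m₂, …, b]` traverses edges
`{a, m₁, j₁}, {j₁, m₂, j₂}, …` from `a` to `b`. -/
inductive Chain (E : Finset (Finset V)) : V → V → List V → Prop
  | single (v : V) : Chain E v v [v]
  | cons {a m c b : V} {L : List V} :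
      Tri E a m c → Chain E c b L → Chain E a b (a :: m :: L)

namespace Chain

lemma head_eq {a b : V} {L : List V} (h : Chain E a b L) : ∃ L', L = a :: L' := by
  cases h <;> exact ⟨_, rfl⟩

lemma join {a c d b x : V} {L R : List V} (hL : Chain E a c L) (hx : Tri E c x d)
    (hR : Chain E d b R) : Chain E a b (L ++ x :: R) := by
  induction hL with
  | single v => exact .cons hx hR
  | cons h _ ih => exact .cons h (ih hx)

lemma reverse {a b : V} {L : List V} (h : Chain E a b L) : Chain E b a L.reverse := by
  induction h with
  | single v => exact .single v
  | @cons a m c b L h _ ih => simpa using ih.join h.rev (.single a)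

lemma swap_head {a m b : V} {L : List V} (h : Chain E a b (a :: m :: L)) :
    Chain E m b (m :: a :: L) := by
  cases h with
  | cons h h' => exact .cons h.swap_left h'

lemma mem_left {a b : V} {L : List V} (h : Chain E a b L) : a ∈ L := by
  cases h <;> simp

lemma mem_right {a b : V} {L : List V} (h : Chain E a b L) : b ∈ L := by
  simpa using h.reverse.mem_left

lemma odd_length {a b : V} {L : List V} (h : Chain E a b L) : ∃ k, L.length = 2 * k + 1 := by
  induction h with
  | single v => exact ⟨0, rfl⟩
  | cons _ _ ih => obtain ⟨k, hk⟩ := ih; exact ⟨k + 1, by simp; omega⟩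

lemma getElem_mem {a b : V} {L : List V} (h : Chain E a b L) :
    ∀ (i : ℕ) (hi : 2 * i + 2 < L.length),
      Tri E (L[2 * i]) (L[2 * i + 1]) (L[2 * i + 2]) := by
  induction h with
  | single v => intro i hi; simp at hi
  | @cons a m c b L h h' ih =>
    intro i hi
    cases i with
    | zero =>
      obtain ⟨L', rfl⟩ := h'.head_eq
      simpa using h
    | succ i =>
      have := ih i (by simp at hi; omega)
      simpa [Nat.mul_add] using this

end Chain

/-- A long enough simple chain yields a linear path. -/
lemma hasLinearPath_of_chain {a b : V} {L : List V} {t : ℕ} (h : Chain E a b L) (hn : L.Nodup)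
    (hE : ∀ e ∈ E, e.card = 3) (hl : 2 * t + 1 ≤ L.length) : HasLinearPath E t := by
  let f : Fin t → Finset V := fun i => {L[2 * (i : ℕ)], L[2 * (i : ℕ) + 1], L[2 * (i : ℕ) + 2]}
  have hfE : ∀ i, f i ∈ E := fun i => h.getElem_mem i (by omega)
  have key : ∀ i j : Fin t, i ≠ j →
      (((i : ℕ) + 1 = j ∨ (j : ℕ) + 1 = i) → (f i ∩ f j).card = 1) ∧
      (¬((i : ℕ) + 1 = j ∨ (j : ℕ) + 1 = i) → f i ∩ f j = ∅) := by
    intro i j hij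
    have hij' : (i : ℕ) ≠ j := fun h => hij (Fin.ext h)
    refine ⟨?_, fun hne => ?_⟩
    · rintro (h1 | h1)
      · rw [Finset.card_eq_one]
        refine ⟨L[2 * (i : ℕ) + 2], ?_⟩
        ext v
        simp only [f, Finset.mem_inter, Finset.mem_insert, Finset.mem_singleton]
        constructor
        · rintro ⟨rfl | rfl | rfl, h2⟩
          all_goals simp only [hn.getElem_inj_iff] at h2 ⊢
          all_goals omega
        · rintro rfl
          refine ⟨by simp, ?_⟩
          simp only [hn.getElem_inj_iff]
          omega
      · rw [Finset.card_eq_one]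
        refine ⟨L[2 * (i : ℕ)], ?_⟩
        ext v
        simp only [f, Finset.mem_inter, Finset.mem_insert, Finset.mem_singleton]
        constructor
        · rintro ⟨rfl | rfl | rfl, h2⟩
          all_goals simp only [hn.getElem_inj_iff] at h2 ⊢
          all_goals omega
        · rintro rfl
          refine ⟨by simp, ?_⟩
          simp only [hn.getElem_inj_iff]
          omega
    · rw [Finset.eq_empty_iff_forall_notMem]
      intro v
      simp only [f, Finset.mem_inter, Finset.mem_insert, Finset.mem_singleton]
      rintro ⟨rfl | rfl | rfl, h2⟩
      all_goals simp only [hn.getElem_inj_iff] at h2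
      all_goals omega
  refine ⟨f, fun i j hij => ?_, hfE, key⟩
  by_contra hne
  have h3 := hE _ (hfE i)
  obtain ⟨k1, k2⟩ := key i j hne
  rw [← hij, Finset.inter_self] at k1 k2
  by_cases hc : (i : ℕ) + 1 = j ∨ (j : ℕ) + 1 = i
  · have := k1 hc; omega
  · have := k2 hc; simp [this] at h3

namespace Slot

lemma left_ne {a b : V} {L : List V} (hL : Chain E a b L) (hn : L.Nodup) {z m w : V}
    (h : Slot L z m w) : m ≠ a := by
  obtain ⟨L', rfl⟩ := hL.head_eq
  obtain ⟨i, h1, h2, h3⟩ := h.exists_index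
  rintro rfl
  have := (List.getElem?_inj (i := 0) (j := 2 * i + 1) (by simp) hn).1 (by simp [h2])
  omega

lemma append_right {a c x : V} {L R : List V} {z m w : V} (hL : Chain E a c L)
    (h : Slot R z m w) : Slot (L ++ x :: R) z m w := by
  induction hL with
  | single v => exact .tail _ _ h
  | cons _ _ ih => exact .tail _ _ ih

lemma mid {a z w b x : V} {L R : List V} (hL : Chain E a z L) (hR : Chain E w b R) :
    Slot (L ++ x :: R) z x w := by
  induction hL with
  | single v => obtain ⟨R', rfl⟩ := hR.head_eq; exact .head _ _ _ _
  | cons _ _ ih => exact .tail _ _ ih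

lemma of_append {a z w b x : V} {L R : List V} {z' m' w' : V} (hL : Chain E a z L)
    (hR : Chain E w b R) (h : Slot (L ++ x :: R) z' m' w') :
    Slot L z' m' w' ∨ m' = x ∨ Slot R z' m' w' := by
  induction hL with
  | single v =>
    cases h with
    | head => exact .inr (.inl rfl)
    | tail _ _ h => exact .inr (.inr h)
  | @cons a m c b L h0 hL' ih =>
    obtain ⟨L', rfl⟩ := hL'.head_eq
    cases h with
    | head => exact .inl (.head _ _ _ _)
    | tail _ _ h =>
      rcases ih h with h | h
      · exact .inl (.tail _ _ h)
      · exact .inr h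

lemma reverse {a b : V} {L : List V} {z m w : V} (hL : Chain E a b L) (h : Slot L z m w) :
    Slot L.reverse w m z := by
  induction hL with
  | single v => cases h
  | @cons a m0 c b L h0 hL' ih =>
    have e : (a :: m0 :: L).reverse = L.reverse ++ m0 :: [a] := by simp
    rw [e]
    obtain ⟨L', rfl⟩ := hL'.head_eq
    cases h with
    | head => exact mid hL'.reverse (.single (E := E) _)
    | tail _ _ h => exact (ih h).append_left _

lemma tri {a b : V} {L : List V} {z m w : V} (hL : Chain E a b L) (h : Slot L z m w) :
    Tri E z m w := by
  induction hL with
  | single v => cases h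
  | @cons a m0 c b L h0 hL' ih =>
    obtain ⟨L', rfl⟩ := hL'.head_eq
    cases h with
    | head => exact h0
    | tail _ _ h => exact ih h

end Slot

lemma Chain.map {a b : V} {L : List V} (σ : V → V) (hL : Chain E a b L)
    (h : ∀ z m w, Slot L z m w → Tri E (σ z) (σ m) (σ w)) :
    Chain E (σ a) (σ b) (L.map σ) := by
  induction hL with
  | single v => exact .single _
  | @cons a m0 c b L h0 hL' ih =>
    refine .cons (c := σ c) ?_ (ih fun z m w hs => h _ _ _ (.tail _ _ hs))
    obtain ⟨L', rfl⟩ := hL'.head_eq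
    exact h _ _ _ (.head _ _ _ _)

/-- The middle vertex `m` of `P` can be released in `n + 1` exchanges of middle vertices,
the last of which uses a vertex outside `P`. -/
inductive Free (E : Finset (Finset V)) (P : List V) : ℕ → V → Prop
  | base {z m w y : V} : Slot P z m w → y ∉ P → Tri E z y w → Free E P 0 m
  | step {z m w m' : V} {n : ℕ} :
      Slot P z m w → Free E P n m' → Tri E z m' w → Free E P (n + 1) m

lemma Free.slot {P : List V} {n : ℕ} {m : V} (h : Free E P n m) : ∃ z w, Slot P z m w := by
  cases h with
  | base h _ _ => exact ⟨_, _, h⟩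
  | step h _ _ => exact ⟨_, _, h⟩

lemma Free.exists_perm {a b : V} {P : List V} (hP : Chain E a b P) (hn : P.Nodup) {n : ℕ} {m : V}
    (h : Free E P n m) : (∀ n' < n, ¬ Free E P n' m) →
    ∃ (σ : Equiv.Perm V) (y : V), y ∉ P ∧ σ y = m ∧
      (∀ v, v ≠ y → (∀ n' ≤ n, ¬ Free E P n' v) → σ v = v) ∧
      ∀ z m w, Slot P z m w → Tri E z (σ m) w := by
  induction h with
  | @base z m w y hs hy ht =>
    intro _
    refine ⟨Equiv.swap y m, y, hy, by simp, fun v hv hf => ?_, fun z' m' w' hs' => ?_⟩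
    · refine Equiv.swap_apply_of_ne_of_ne hv ?_
      rintro rfl
      exact hf 0 le_rfl (.base hs hy ht)
    · by_cases hm : m' = m
      · subst hm
        obtain ⟨rfl, rfl⟩ := hs.unique hn hs'
        simpa using ht
      · rw [Equiv.swap_apply_of_ne_of_ne ?_ hm]
        · exact hs'.tri hP
        · rintro rfl; exact hy hs'.mem
  | @step z m w m' n hs hf ht ih =>
    intro hmin
    obtain ⟨σ, y, hy, hσy, hfix, hσ⟩ := ih fun n' hn' hf' =>
      hmin (n' + 1) (by omega) (.step hs hf' ht)
    have hmy : m ≠ y := by rintro rfl; exact hy hs.mem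
    have hσm : σ m = m := hfix m hmy fun n' hn' => hmin n' (by omega)
    refine ⟨σ * Equiv.swap m y, y, hy, by simp [hσm], fun v hv hf' => ?_, fun z' m'' w' hs' => ?_⟩
    · have hvm : v ≠ m := by rintro rfl; exact hf' (n + 1) le_rfl (.step hs hf ht)
      rw [Equiv.Perm.mul_apply, Equiv.swap_apply_of_ne_of_ne hvm hv]
      exact hfix v hv fun n' hn' => hf' n' (by omega)
    · by_cases hm : m'' = m
      · subst hm
        obtain ⟨rfl, rfl⟩ := hs.unique hn hs'
        simpa [hσy] using ht
      · rw [Equiv.Perm.mul_apply, Equiv.swap_apply_of_ne_of_ne hm]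
        · exact hσ _ _ _ hs'
        · rintro rfl; exact hy hs'.mem

/-- A free middle vertex can be released from a simple chain at the cost of one new vertex. -/
lemma Free.exists_chain {a b : V} {P : List V} (hP : Chain E a b P) (hn : P.Nodup) {n : ℕ} {m : V}
    (h : Free E P n m) :
    ∃ (P' : List V) (y : V), Chain E a b P' ∧ P'.Nodup ∧ P'.length = P.length ∧ y ∉ P ∧
      m ∉ P' ∧ ∀ x, x ∉ P → x ≠ y → x ∉ P' := by
  classical
  have hex : ∃ n, Free E P n m := ⟨n, h⟩
  obtain ⟨σ, y, hy, hσy, hfix, hσ⟩ := (Nat.find_spec hex).exists_perm hP hn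
    fun n' hn' => Nat.find_min hex hn'
  have hfix' : ∀ v, v ≠ y → (∀ z w, ¬ Slot P z v w) → σ v = v := fun v hv hs =>
    hfix v hv fun n' _ hf => by
      obtain ⟨z, w, hzw⟩ := hf.slot
      exact hs z w hzw
  have ha : σ a = a := hfix' a (by rintro rfl; exact hy hP.mem_left)
    fun z w hs => hs.left_ne hP hn rfl
  have hb : σ b = b := hfix' b (by rintro rfl; exact hy hP.mem_right)
    fun z w hs => (hs.reverse hP).left_ne hP.reverse (List.nodup_reverse.2 hn) rfl
  have hj : ∀ z m w, Slot P z m w → σ z = z ∧ σ w = w := by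
    intro z m w hs
    obtain ⟨i, h1, -, h3⟩ := hs.exists_index
    refine ⟨hfix' z ?_ fun z' w' hs' => ?_, hfix' w ?_ fun z' w' hs' => ?_⟩
    · rintro rfl; exact hy (List.mem_of_getElem? h1)
    · exact (hs.joint_ne hn hs').1 rfl
    · rintro rfl; exact hy (List.mem_of_getElem? h3)
    · exact (hs.joint_ne hn hs').2 rfl
  refine ⟨P.map σ, y, ?_, hn.map σ.injective, by simp, hy, ?_, fun x hx hxy => ?_⟩
  · have := hP.map σ fun z m w hs => by
      rw [(hj z m w hs).1, (hj z m w hs).2]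
      exact hσ z m w hs
    rwa [ha, hb] at this
  · rw [← hσy, List.mem_map_of_injective σ.injective]
    exact hy
  · rw [← hfix' x hxy fun z w hs => hx hs.mem, List.mem_map_of_injective σ.injective]
    exact hx

/-- The vertices outside `P` completing `{u, v}` to an edge. -/
def outer [Fintype V] (E : Finset (Finset V)) (P : List V) (u v : V) : Finset V :=
  Finset.univ.filter fun x => x ∉ P ∧ ({u, v, x} : Finset V) ∈ E

lemma mem_outer [Fintype V] {P : List V} {u v x : V} :
    x ∈ outer E P u v ↔ x ∉ P ∧ Tri E u v x := by
  simp [outer, Tri]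

lemma outer_congr [Fintype V] {P Q : List V} (h : ∀ x, x ∈ P ↔ x ∈ Q) (u v : V) :
    outer E P u v = outer E Q u v := by
  ext x
  rw [mem_outer, mem_outer, h]

lemma outer_self [Fintype V] (hE : ∀ e ∈ E, e.card = 3) (P : List V) (u : V) :
    outer E P u u = ∅ := by
  rw [Finset.eq_empty_iff_forall_notMem]
  intro x hx
  have h := hE _ (mem_outer.1 hx).2
  have := Finset.card_le_two (a := u) (b := x)
  rw [Finset.insert_idem] at h
  omega

lemma card_outer_le [Fintype V] {P : List V} (hn : P.Nodup) (u v : V) :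
    (outer E P u v).card + P.length ≤ Fintype.card V := by
  rw [← List.toFinset_card_of_nodup hn, ← Finset.card_union_of_disjoint]
  · exact Finset.card_le_univ _
  · rw [Finset.disjoint_left]
    intro x hx hx'
    exact (mem_outer.1 hx).1 (List.mem_toFinset.1 hx')

/-- Every simple chain has at most `k` edges. -/
def MaxLen (E : Finset (Finset V)) (k : ℕ) : Prop :=
  ∀ (a b : V) (L : List V), Chain E a b L → L.Nodup → L.length ≤ 2 * k + 1

lemma hdegree_le_of_maximal [Fintype V] {k : ℕ} (hE : ∀ e ∈ E, e.card = 3) (hmax : MaxLen E k)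
    {a b : V} {P : List V} (hP : Chain E a b P) (hn : P.Nodup) (hl : P.length = 2 * k + 1) :
    hdegree E a ≤ (2 * k).choose 2 + (P.map fun v => (outer E P a v).card).sum := by
  have hsub : E.filter (fun e => a ∈ e) ⊆
      ((P.toFinset.erase a).powersetCard 2).image (insert a) ∪
        P.toFinset.biUnion fun v => (outer E P a v).image fun x => {a, v, x} := by
    intro e he
    rw [Finset.mem_filter] at he
    obtain ⟨heE, hae⟩ := he
    have hc : (e.erase a).card = 2 := by rw [Finset.card_erase_of_mem hae, hE e heE]
    obtain ⟨u, v, huv, he⟩ := Finset.card_eq_two.1 hc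
    have he' : e = {a, u, v} := by rw [← he, Finset.insert_erase hae]
    have hu : u ≠ a := Finset.ne_of_mem_erase (s := e) (by simp [he])
    have hv : v ≠ a := Finset.ne_of_mem_erase (s := e) (by simp [he])
    have ht : Tri E a u v := by unfold Tri; rwa [← he']
    rw [Finset.mem_union, Finset.mem_image, Finset.mem_biUnion]
    by_cases huP : u ∈ P <;> by_cases hvP : v ∈ P
    · refine .inl ⟨{u, v}, ?_, he'.symm⟩
      rw [Finset.mem_powersetCard]
      refine ⟨?_, Finset.card_pair huv⟩
      intro x hx
      rw [Finset.mem_insert, Finset.mem_singleton] at hx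
      rcases hx with rfl | rfl <;> simp [*]
    · exact .inr ⟨u, List.mem_toFinset.2 huP, Finset.mem_image.2
        ⟨v, mem_outer.2 ⟨hvP, ht⟩, he'.symm⟩⟩
    · exact .inr ⟨v, List.mem_toFinset.2 hvP, Finset.mem_image.2
        ⟨u, mem_outer.2 ⟨huP, ht.swap_right⟩, by rw [he', Finset.pair_comm]⟩⟩
    · have := hmax _ _ (u :: v :: P) (.cons ht.swap_left.swap_right hP)
        (by simp [huP, hvP, huv, hn])
      simp at this
      omega
  unfold hdegree
  refine (Finset.card_le_card hsub).trans ((Finset.card_union_le _ _).trans ?_)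
  refine add_le_add ?_ ?_
  · refine Finset.card_image_le.trans_eq ?_
    rw [Finset.card_powersetCard, Finset.card_erase_of_mem (List.mem_toFinset.2 hP.mem_left),
      List.toFinset_card_of_nodup hn, hl, Nat.add_sub_cancel]
  · rw [← List.sum_toFinset _ hn]
    exact Finset.card_biUnion_le.trans (Finset.sum_le_sum fun v _ => Finset.card_image_le)

/-- An end of a longest chain sends many edges out of the chain. -/
lemma end_bound [Fintype V] {k m : ℕ} (hE : ∀ e ∈ E, e.card = 3) (hmax : MaxLen E k)
    (hdeg : ∀ v, k * m + 5 * k ^ 2 + 6 ≤ 2 * hdegree E v + 2 * k)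
    {a b : V} {P : List V} (hP : Chain E a b P) (hn : P.Nodup) (hl : P.length = 2 * k + 1) :
    k * m + k ^ 2 + 6 ≤ 2 * (P.map fun v => (outer E P a v).card).sum := by
  have h1 := hdegree_le_of_maximal hE hmax hP hn hl
  have h2 := hdeg a
  have h3 : 2 * (2 * k).choose 2 + 2 * k = 4 * k ^ 2 := by
    have h4 := Nat.choose_two_right (2 * k)
    have h5 : (2 * k) * (2 * k - 1) / 2 = k * (2 * k - 1) := by
      rw [mul_assoc, Nat.mul_div_cancel_left _ (by norm_num)]
    rw [h4, h5]
    cases k with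
    | zero => rfl
    | succ k => rw [show 2 * (k + 1) - 1 = 2 * k + 1 by omega]; ring
  linarith

/-- A linear cycle, given by a simple chain `L` from `a` to `w` and an edge `{w, x, a}`, can be cut
open at every vertex of `L`. -/
lemma exists_chain_of_cycle (A : List V) {a w x v : V} {B : List V}
    (hL : Chain E a w (A ++ v :: B)) (hx : Tri E w x a) (hn : (x :: (A ++ v :: B)).Nodup) :
    ∃ (b : V) (L' : List V), Chain E v b L' ∧ L'.Nodup ∧ L'.length = (A ++ v :: B).length ∧
      ∀ y ∈ L', y ∈ x :: (A ++ v :: B) := by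
  match A with
  | [] =>
    obtain ⟨L', h⟩ := hL.head_eq
    obtain rfl : v = a := by simp at h; exact h.1
    exact ⟨w, _, hL, hn.of_cons, rfl, fun y hy => List.mem_cons_of_mem _ hy⟩
  | [c] =>
    have h := hL.head_eq
    obtain ⟨L', h⟩ := h
    obtain rfl : c = a := by simp at h; exact h.1
    refine ⟨w, _, hL.swap_head, ?_, rfl, ?_⟩
    · exact (List.Perm.swap _ _ _).nodup hn.of_cons
    · intro y hy
      simp only [List.mem_cons, List.cons_append, List.nil_append] at hy ⊢
      tauto
  | a' :: c :: A' =>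
    cases hL with
    | @cons _ _ r _ _ ht hR =>
      have hp : (x :: a :: c :: (A' ++ v :: B)).Perm (c :: (A' ++ v :: (B ++ [x, a]))) := by
        have e : c :: (A' ++ v :: (B ++ [x, a])) = (c :: (A' ++ v :: B)) ++ [x, a] := by simp
        rw [e]
        exact List.perm_append_comm (l₁ := [x, a])
      have hR' : Chain E r a (A' ++ v :: (B ++ [x, a])) := by
        simpa using hR.join hx (.single a)
      obtain ⟨b, L', h1, h2, h3, h4⟩ :=
        exists_chain_of_cycle A' hR' ht (hp.nodup hn)
      refine ⟨b, L', h1, h2, ?_, fun y hy => hp.mem_iff.2 (h4 y hy)⟩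
      rw [h3]
      simp
      omega

/-- The ends of a longest chain with at least one edge are not joined by two cycles. -/
lemma no_double_cycle [Fintype V] {k m : ℕ} (hm : 18 ≤ m) (hE : ∀ e ∈ E, e.card = 3)
    (hmax : MaxLen E k)
    (hdeg : ∀ v, k * m + 5 * k ^ 2 + 6 ≤ 2 * hdegree E v + 2 * k)
    {a c w x x' : V} {R : List V} (hL : Chain E a w (a :: c :: R)) (hn : (a :: c :: R).Nodup)
    (hl : (a :: c :: R).length = 2 * k + 1) (hx : x ∉ a :: c :: R) (hx' : x' ∉ a :: c :: R)
    (hxx : x ≠ x') (ht : Tri E a x w) (ht' : Tri E a x' w) : False := by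
  obtain ⟨r, hR⟩ : ∃ r, Chain E r w R := by
    cases hL with
    | cons h h' => exact ⟨_, h'⟩
  have hP : Chain E x' r (x' :: a :: R.reverse) := .cons ht'.swap_left hR.reverse
  have hPn : (x' :: a :: R.reverse).Nodup := by
    simp_all
  have hPl : (x' :: a :: R.reverse).length = 2 * k + 1 := by
    simpa using hl
  have hb := end_bound hE hmax hdeg hP hPn hPl
  obtain ⟨v, hv, hv3⟩ : ∃ v ∈ x' :: a :: R.reverse,
      2 < (outer E (x' :: a :: R.reverse) x' v).card := by
    by_contra! hcon
    have := List.sum_le_card_nsmul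
      ((x' :: a :: R.reverse).map fun v => (outer E (x' :: a :: R.reverse) x' v).card) 2 (by
        intro y hy
        obtain ⟨v, hv, rfl⟩ := List.mem_map.1 hy
        exact hcon v hv)
    rw [List.length_map, hPl, smul_eq_mul] at this
    nlinarith
  have hvx : v ≠ x' := by
    rintro rfl
    rw [outer_self hE] at hv3
    simp at hv3
  obtain ⟨u, hu, hu'⟩ := Finset.exists_mem_notMem_of_card_lt_card
    ((Finset.card_le_two (a := c) (b := x)).trans_lt hv3)
  rw [mem_outer] at hu
  obtain ⟨huP, htu⟩ := hu
  have hvL : v ∈ a :: c :: R := by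
    simp at hv ⊢
    tauto
  obtain ⟨A, B, hAB⟩ := List.append_of_mem hvL
  rw [hAB] at hL hn hl hx hx'
  obtain ⟨b, L', h1, h2, h3, h4⟩ :=
    exists_chain_of_cycle A hL ht.rev (List.nodup_cons.2 ⟨hx, hn⟩)
  have hn' : (x' :: u :: L').Nodup := by
    have hx'L : x' ∉ L' := fun h => by
      rcases List.mem_cons.1 (h4 _ h) with h | h
      · exact hxx h.symm
      · exact hx' h
    have huL : u ∉ L' := fun h => by
      have := h4 _ h
      rw [← hAB] at this
      simp at this huP hu'
      tauto
    have : x' ≠ u := by rintro rfl; simp at huP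
    simp [*]
  have := hmax _ _ _ (.cons htu.swap_right h1) hn'
  simp only [List.length_cons] at this
  omega

/-- Exchanging the middle vertex of a rotated edge for an outer vertex keeps free vertices free. -/
lemma Free.rotate {a b z m w x₁ x₂ : V} {L R : List V} {n : ℕ} {v : V} (hL : Chain E a z L)
    (hR : Chain E w b R) (hx₂ : x₂ ∉ L ++ m :: R) (hx : x₁ ≠ x₂) (h₂ : Tri E a x₂ w)
    (hm : ∀ n, ¬ Free E (L ++ m :: R) n m) (h : Free E (L ++ m :: R) n v) :
    ∃ n', Free E (L.reverse ++ x₁ :: R) n' v := by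
  have hslot : ∀ {z' v w' u n}, Slot (L ++ m :: R) z' v w' → Free E (L ++ m :: R) n v →
      Tri E z' u w' → ∃ z'' w'', Slot (L.reverse ++ x₁ :: R) z'' v w'' ∧ Tri E z'' u w'' := by
    intro z' v w' u n hs hf ht
    rcases hs.of_append hL hR with hs | rfl | hs
    · exact ⟨w', z', (hs.reverse hL).append_left _, ht.rev⟩
    · exact absurd hf (hm _)
    · exact ⟨z', w', hs.append_right hL.reverse, ht⟩
  induction h with
  | @base z' m' w' y hs hy ht =>
    obtain ⟨z'', w'', hs', ht'⟩ := hslot hs (.base hs hy ht) ht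
    by_cases hyx : y = x₁
    · subst hyx
      refine ⟨1, .step hs' (.base (y := x₂) (.mid hL.reverse hR) ?_ h₂) ht'⟩
      simp at hx₂ ⊢
      tauto
    · refine ⟨0, .base hs' ?_ ht'⟩
      simp at hy ⊢
      tauto
  | @step z' m' w' m'' n hs hf ht ih =>
    obtain ⟨z'', w'', hs', ht'⟩ := hslot hs (.step hs hf ht) ht
    obtain ⟨n', h'⟩ := ih
    exact ⟨n' + 1, .step hs' h' ht'⟩

lemma Free.reverse {a b : V} {P : List V} (hP : Chain E a b P) {n : ℕ} {v : V}
    (h : Free E P n v) : Free E P.reverse n v := by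
  induction h with
  | base hs hy ht => exact .base (hs.reverse hP) (by simpa using hy) ht.rev
  | step hs hf ht ih => exact .step (hs.reverse hP) ih ht.rev

/-- The middle vertices of `P` that are free. -/
def freeSet (E : Finset (Finset V)) (P : List V) : Set V := {v | ∃ n, Free E P n v}

lemma freeSet_reverse {a b : V} {P : List V} (hP : Chain E a b P) :
    freeSet E P.reverse = freeSet E P := by
  ext v
  constructor
  · rintro ⟨n, h⟩
    exact ⟨n, by simpa using h.reverse hP.reverse⟩
  · rintro ⟨n, h⟩
    exact ⟨n, h.reverse hP⟩

/-- No simple chain with `k` edges has strictly more free vertices than `P`. -/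
def MaxFree (E : Finset (Finset V)) (k : ℕ) (P : List V) : Prop :=
  ∀ (a b : V) (Q : List V), Chain E a b Q → Q.Nodup → Q.length = 2 * k + 1 →
    ¬ freeSet E P ⊂ freeSet E Q

lemma not_two_le_outer_left [Fintype V] {k : ℕ} (hmax : MaxLen E k) {a b z m w : V} {L R : List V}
    (hL : Chain E a z L) (hR : Chain E w b R) (ht : Tri E z m w) (hn : (L ++ m :: R).Nodup)
    (hl : (L ++ m :: R).length = 2 * k + 1) (hfree : MaxFree E k (L ++ m :: R))
    (hw : 2 ≤ (outer E (L ++ m :: R) a w).card) (hm : 2 ≤ (outer E (L ++ m :: R) a m).card) :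
    False := by
  by_cases hf : ∃ n, Free E (L ++ m :: R) n m
  · obtain ⟨n, hf⟩ := hf
    obtain ⟨P', y, hP', hn', hl', -, hmP', hout⟩ := hf.exists_chain (hL.join ht hR) hn
    obtain ⟨x, hx, hxy⟩ := Finset.exists_mem_ne hm y
    obtain ⟨hxP, hx⟩ := mem_outer.1 hx
    have hxm : x ≠ m := by rintro rfl; simp at hxP
    have := hmax _ _ (x :: m :: P') (.cons hx.rev hP')
      (by simp [hxm, hout x hxP hxy, hmP', hn'])
    simp at this hl hl'
    omega
  · push Not at hf
    obtain ⟨x₁, hx₁, x₂, hx₂, hx⟩ := Finset.one_lt_card.1 hw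
    obtain ⟨h₁, t₁⟩ := mem_outer.1 hx₁
    obtain ⟨h₂, t₂⟩ := mem_outer.1 hx₂
    refine hfree _ _ (L.reverse ++ x₁ :: R) (hL.reverse.join t₁.swap_right hR) ?_ ?_ ?_
    · have : (L.reverse ++ x₁ :: R).Perm (x₁ :: (L ++ R)) := List.perm_iff_count.2 fun v => by
        simp [List.count_cons]; ring
      rw [this.nodup_iff]
      have h' := (List.perm_middle.nodup_iff.1 hn).of_cons
      simp at h₁
      simp [h', h₁]
    · simpa using hl
    · refine (Set.ssubset_iff_of_subset ?_).2 ⟨x₁, ?_, ?_⟩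
      · rintro v ⟨n, h⟩
        exact h.rotate hL hR h₂ hx t₂.swap_right hf
      · refine ⟨0, .base (y := x₂) (.mid hL.reverse hR) ?_ t₂.swap_right⟩
        simp at h₂ ⊢
        tauto
      · rintro ⟨n, h⟩
        obtain ⟨_, _, h⟩ := h.slot
        exact h₁ h.mem

lemma not_double_outer [Fintype V] {k : ℕ} (hmax : MaxLen E k) {P : List V} (hn : P.Nodup)
    (hl : P.length = 2 * k + 1) {u v u' v' : V}
    (hnew : ∀ x y, Tri E u v x → Tri E u' v' y →
      ∃ (a b : V) (Q : List V), Chain E a b Q ∧ Q.Perm (x :: y :: P))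
    (h : 2 ≤ (outer E P u v).card) (h' : 2 ≤ (outer E P u' v').card) : False := by
  obtain ⟨x, hx⟩ := Finset.card_pos.1 (by omega : 0 < (outer E P u v).card)
  obtain ⟨y, hy, hyx⟩ := Finset.exists_mem_ne h' x
  obtain ⟨hxP, hx⟩ := mem_outer.1 hx
  obtain ⟨hyP, hy⟩ := mem_outer.1 hy
  obtain ⟨a, b, Q, hQ, hp⟩ := hnew x y hx hy
  have := hmax _ _ Q hQ (hp.nodup_iff.2 (by simp [hxP, hyP, hn, hyx.symm]))
  rw [hp.length_eq] at this
  simp at this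
  omega

lemma not_outer_cross [Fintype V] {k n : ℕ} (hk : 18 ≤ n) (hE : ∀ e ∈ E, e.card = 3)
    (hmax : MaxLen E k)
    (hdeg : ∀ v, k * n + 5 * k ^ 2 + 6 ≤ 2 * hdegree E v + 2 * k)
    {a b z m w : V} {L R : List V}
    (hL : Chain E a z L) (hR : Chain E w b R) (hn : (L ++ m :: R).Nodup)
    (hl : (L ++ m :: R).length = 2 * k + 1)
    (h₁ : 3 ≤ (outer E (L ++ m :: R) a w).card) (h₂ : 2 ≤ (outer E (L ++ m :: R) b z).card) :
    False := by
  obtain ⟨y, hy⟩ := Finset.card_pos.1 (by omega : 0 < (outer E (L ++ m :: R) b z).card)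
  have h₃ : 1 < ((outer E (L ++ m :: R) a w).erase y).card := by
    have := Finset.pred_card_le_card_erase (s := outer E (L ++ m :: R) a w) (a := y)
    omega
  obtain ⟨x, hx, x', hx', hxx⟩ := Finset.one_lt_card.1 h₃
  obtain ⟨hxy, hx⟩ := Finset.mem_erase.1 hx
  obtain ⟨hxy', hx'⟩ := Finset.mem_erase.1 hx'
  rw [mem_outer] at hx hx' hy
  have hC : Chain E a w (L ++ y :: R.reverse) := hL.join hy.2.swap_left.swap_right hR.reverse
  have hnd : (L ++ y :: R.reverse).Nodup := by
    have hp : (L ++ y :: R.reverse).Perm (y :: (L ++ R)) := List.perm_iff_count.2 fun v => by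
      simp [List.count_cons]; ring
    rw [hp.nodup_iff]
    have h' := (List.perm_middle.nodup_iff.1 hn).of_cons
    have := hy.1
    simp at this
    simp [h', this]
  have hlen : (L ++ y :: R.reverse).length = 2 * k + 1 := by simpa using hl
  have hxn : x ∉ L ++ y :: R.reverse := by
    have := hx.1
    simp at this ⊢
    tauto
  have hxn' : x' ∉ L ++ y :: R.reverse := by
    have := hx'.1
    simp at this ⊢
    tauto
  obtain ⟨c, T, hT⟩ : ∃ c T, L ++ y :: R.reverse = a :: c :: T := by
    cases hL with
    | single => exact ⟨_, _, rfl⟩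
    | cons => exact ⟨_, _, rfl⟩
  rw [hT] at hC hnd hlen hxn hxn'
  exact no_double_cycle hk hE hmax hdeg hC hnd hlen hxn hxn' hxx hx.2.swap_right hx'.2.swap_right

/-- The ends of a chain send at most `n + 3` edges out through each of its edges. -/
lemma card_outer_edge_le [Fintype V] {k n : ℕ} (hk : 18 ≤ n)
    (hcard : Fintype.card V = n + (2 * k + 1)) (hE : ∀ e ∈ E, e.card = 3)
    (hmax : MaxLen E k)
    (hdeg : ∀ v, k * n + 5 * k ^ 2 + 6 ≤ 2 * hdegree E v + 2 * k)
    {a b z m w : V} {L R : List V}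
    (hL : Chain E a z L) (hR : Chain E w b R) (ht : Tri E z m w) (hn : (L ++ m :: R).Nodup)
    (hl : (L ++ m :: R).length = 2 * k + 1) (hfree : MaxFree E k (L ++ m :: R)) :
    (outer E (L ++ m :: R) a w).card + (outer E (L ++ m :: R) a m).card +
      (outer E (L ++ m :: R) b z).card + (outer E (L ++ m :: R) b m).card ≤ n + 3 := by
  have b₁ := card_outer_le (E := E) hn a w
  have b₂ := card_outer_le (E := E) hn a m
  have b₃ := card_outer_le (E := E) hn b z
  have b₄ := card_outer_le (E := E) hn b m
  have hrev : (L ++ m :: R).reverse = R.reverse ++ m :: L.reverse := by simp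
  have hn' : (R.reverse ++ m :: L.reverse).Nodup := hrev ▸ List.nodup_reverse.2 hn
  have hl' : (R.reverse ++ m :: L.reverse).length = 2 * k + 1 := by
    rw [← hrev, List.length_reverse, hl]
  have hfree' : MaxFree E k (R.reverse ++ m :: L.reverse) := by
    intro a' b' Q h₁ h₂ h₃
    rw [← hrev, freeSet_reverse (hL.join ht hR)]
    exact hfree a' b' Q h₁ h₂ h₃
  have ho : ∀ u v, outer E (R.reverse ++ m :: L.reverse) u v = outer E (L ++ m :: R) u v :=
    outer_congr fun x => by rw [← hrev, List.mem_reverse]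
  have c₁ := not_outer_cross hk hE hmax hdeg hL hR hn hl
  have c₂ := not_outer_cross hk hE hmax hdeg hR.reverse hL.reverse hn' hl'
  have c₃ := not_two_le_outer_left hmax hL hR ht hn hl hfree
  have c₄ := not_two_le_outer_left hmax hR.reverse hL.reverse ht.rev hn' hl' hfree'
  rw [ho, ho] at c₂ c₄
  have d₁ := not_double_outer (u := a) (v := w) (u' := b) (v' := m) hmax hn hl
    fun x y hx hy => ⟨z, m, L.reverse ++ x :: (R ++ y :: [m]),
      hL.reverse.join hx.swap_right (hR.join hy.swap_right (.single m)),
      List.perm_iff_count.2 fun v => by simp [List.count_cons]; ring⟩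
  have d₂ := not_double_outer (u := a) (v := m) (u' := b) (v' := m) hmax hn hl
    fun x y hx hy => ⟨z, w, L.reverse ++ x :: ([m] ++ y :: R.reverse),
      hL.reverse.join hx.swap_right ((Chain.single m).join hy.swap_left.swap_right hR.reverse),
      List.perm_iff_count.2 fun v => by simp [List.count_cons]; ring⟩
  have d₃ := not_double_outer (u := a) (v := m) (u' := b) (v' := z) hmax hn hl
    fun x y hx hy => ⟨m, w, [m] ++ x :: (L ++ y :: R.reverse),
      (Chain.single m).join hx.swap_left.swap_right
        (hL.join hy.swap_left.swap_right hR.reverse),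
      List.perm_iff_count.2 fun v => by simp [List.count_cons]; ring⟩
  grind

lemma Chain.sum_le {a b : V} (f g : V → ℕ) (M : ℕ) (P : List V)
    (hM : ∀ (L : List V) (z m w : V) (R : List V), P = L ++ m :: R → Chain E a z L →
      Chain E w b R → Tri E z m w → f w + f m + g z + g m ≤ M)
    {c : V} {R : List V} (hR : Chain E c b R) :
    ∀ L, P = L ++ R → Chain E a c (L ++ [c]) → ∀ k, R.length = 2 * k + 1 →
      (R.map fun v => f v + g v).sum ≤ f c + g b + k * M := by
  induction hR with
  | single v => intros; simp
  | @cons c m d b R ht hR ih =>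
    intro L hP hL k hk
    obtain ⟨R', rfl⟩ := hR.head_eq
    have h₁ := hM (L ++ [c]) c m d (d :: R') (by simpa using hP) hL hR ht
    have h₂ := ih hM (L ++ [c, m]) (by simpa using hP)
      (by simpa using hL.join ht (.single d)) (k - 1) (by simp at hk ⊢; omega)
    obtain ⟨k, rfl⟩ : ∃ j, k = j + 1 := ⟨k - 1, by simp at hk; omega⟩
    rw [List.map_cons, List.map_cons, List.sum_cons, List.sum_cons, add_mul, one_mul]
    rw [Nat.add_sub_cancel] at h₂
    omega

lemma exists_longest_chain [Fintype V] (v : V) :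
    ∃ k, MaxLen E k ∧ ∃ (a b : V) (P : List V), Chain E a b P ∧ P.Nodup ∧
      P.length = 2 * k + 1 ∧ MaxFree E k P := by
  classical
  have hex : ∃ k, MaxLen E k :=
    ⟨Fintype.card V, fun a b L _ hn => by have := hn.length_le_card; omega⟩
  refine ⟨Nat.find hex, Nat.find_spec hex, ?_⟩
  have hmax := Nat.find_spec hex
  have hmin := fun j => Nat.find_min hex (m := j)
  generalize Nat.find hex = k at hmax hmin ⊢
  have hne : ∃ (a b : V) (P : List V), Chain E a b P ∧ P.Nodup ∧ P.length = 2 * k + 1 := by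
    cases k with
    | zero => exact ⟨v, v, [v], .single v, by simp, by simp⟩
    | succ k =>
      have := hmin k (by omega)
      unfold MaxLen at this
      push Not at this
      obtain ⟨a, b, P, hP, hn, hl⟩ := this
      have h₁ := hmax a b P hP hn
      obtain ⟨j, hj⟩ := hP.odd_length
      exact ⟨a, b, P, hP, hn, by omega⟩
  obtain ⟨a, b, P, hP, hn, hl⟩ := hne
  obtain ⟨S, ⟨a, b, P, hP, hn, hl, rfl⟩, hS⟩ := (Set.toFinite {S | ∃ (a b : V) (P : List V),
    Chain E a b P ∧ P.Nodup ∧ P.length = 2 * k + 1 ∧ freeSet E P = S}).exists_maximal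
    ⟨_, a, b, P, hP, hn, hl, rfl⟩
  exact ⟨a, b, P, hP, hn, hl, fun a' b' Q h₁ h₂ h₃ h =>
    h.2 (hS ⟨a', b', Q, h₁, h₂, h₃, rfl⟩ h.1)⟩

lemma not_maximal [Fintype V] {k n : ℕ} (hk : 18 ≤ n)
    (hcard : Fintype.card V = n + (2 * k + 1)) (hE : ∀ e ∈ E, e.card = 3)
    (hmax : MaxLen E k)
    (hdeg : ∀ v, k * n + 5 * k ^ 2 + 6 ≤ 2 * hdegree E v + 2 * k)
    {a b : V} {P : List V} (hP : Chain E a b P) (hn : P.Nodup) (hl : P.length = 2 * k + 1)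
    (hfree : MaxFree E k P) : False := by
  have ha := end_bound hE hmax hdeg hP hn hl
  have hb := end_bound hE hmax hdeg hP.reverse (List.nodup_reverse.2 hn) (by simpa using hl)
  rw [(List.reverse_perm P).map _ |>.sum_eq] at hb
  simp only [outer_congr (fun _ => List.mem_reverse (as := P))] at hb
  have hs := hP.sum_le (fun v => (outer E P a v).card) (fun v => (outer E P b v).card) (n + 3) P
    (by
      rintro L z m w R rfl hL hR ht
      exact card_outer_edge_le hk hcard hE hmax hdeg hL hR ht hn hl hfree)
    [] rfl (.single a) k hl
  rw [List.sum_map_add, outer_self hE, outer_self hE] at hs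
  simp only [Finset.card_empty] at hs
  nlinarith [sq_nonneg ((k : ℤ) - 1)]

end LinearPath

theorem min_degree_implies_linear_path
    (t n : ℕ) (ht : t ≥ 3) (hn : n ≥ 2 * t + 17)
    (V : Type*) [Fintype V] [DecidableEq V] (hV : Fintype.card V = n)
    (E : Finset (Finset V)) (hE : ∀ e ∈ E, e.card = 3)
    (hdeg : ∀ v : V,
      ((t : ℚ) - 1) / 2 * n + 3 / 2 * t ^ 2 - 9 / 2 * t + 6 ≤ (hdegree E v : ℚ)) :
    HasLinearPath E t := by
  by_contra hno
  obtain ⟨v⟩ : Nonempty V := Fintype.card_pos_iff.1 (by omega)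
  obtain ⟨k, hmax, a, b, P, hP, hPn, hl, hfree⟩ := LinearPath.exists_longest_chain (E := E) v
  have hkt : k < t := by
    by_contra hc
    exact hno (LinearPath.hasLinearPath_of_chain hP hPn hE (by omega))
  obtain ⟨d, rfl⟩ : ∃ d, t = k + d + 1 := ⟨t - k - 1, by omega⟩
  obtain ⟨m, rfl⟩ : ∃ m, n = m + (2 * k + 1) := ⟨n - (2 * k + 1), by omega⟩
  refine LinearPath.not_maximal (by omega) hV hE hmax (fun u => ?_) hP hPn hl hfree
  have h := hdeg u
  have hd : (d : ℚ) ≤ (d : ℚ) ^ 2 := by exact_mod_cast Nat.le_self_pow two_ne_zero d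
  have h0 : (0 : ℚ) ≤ d * m := by positivity
  have h1 : (0 : ℚ) ≤ d * k := by positivity
  have : (k : ℚ) * m + 5 * k ^ 2 + 6 ≤ 2 * hdegree E u + 2 * k := by
    push_cast at h
    nlinarith
  exact_mod_cast this
end
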